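/- Let k be a field and let G be a finite group acting on the rational function field k(x1,x2) by monomial k-automorphisms. Then the fixed field k(x1,x2)^G is k-rational. -/

import Mathlib

open MvPolynomial

noncomputable section

/-- A field extension `K` of `k` is `k`-rational if it is isomorphic, as a `k`-algebra,
to a rational function field `k(x₁, …, xₙ)` in finitely many variables. -/
def IsRational (k K : Type*) [Field k] [Field K] [Algebra k K] : Prop :=
  ∃ n : ℕ, Nonempty (K ≃ₐ[k] FractionRing (MvPolynomial (Fin n) k))

namespace MonomialAction

open IntermediateField

variable {k K : Type*} [Field k] [Field K] [Algebra k K]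

/-! ### Descent to a subfield -/

/-- If `w` is a root of a monic polynomial of degree `n` over `E` and has at least `n` conjugates
under automorphisms fixing `E` and `f ∈ E(w)`, then `f ∈ E`. -/
lemma mem_of_conjugates {E : IntermediateField k K} {p : Polynomial E} (hp : p.Monic) {w f : K}
    (hw : Polynomial.aeval w p = 0) (S : Finset K) (hS : p.natDegree ≤ S.card)
    (h : ∀ s ∈ S, ∃ τ : K ≃ₐ[k] K, (∀ e ∈ E, τ e = e) ∧ τ f = f ∧ τ w = s)
    (hf : f ∈ E⟮w⟯) : f ∈ E := by
  have hwE : IsIntegral E w := ⟨p, hp, by simpa [Polynomial.aeval_def] using hw⟩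
  rw [← IntermediateField.mem_toSubalgebra,
    adjoin_simple_toSubalgebra_of_isAlgebraic hwE.isAlgebraic,
    Algebra.adjoin_singleton_eq_range_aeval] at hf
  obtain ⟨g, hg⟩ := hf
  have hg' : Polynomial.aeval w g = f := hg
  have hp1 : p ≠ 1 := by
    rintro rfl
    simp at hw
  set r := g %ₘ p with hr
  have hrw : Polynomial.aeval w r = f := by
    rw [hr, Polynomial.aeval_modByMonic_eq_self_of_root hw, hg']
  have hdeg : r.natDegree < p.natDegree := Polynomial.natDegree_modByMonic_lt g hp hp1
  have hz : r.map (algebraMap E K) - Polynomial.C f = 0 := by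
    apply Polynomial.eq_zero_of_natDegree_lt_card_of_eval_eq_zero' _ S
    · intro s hs
      obtain ⟨τ, hτE, hτf, hτw⟩ := h s hs
      have h1 : τ (Polynomial.aeval w r) = Polynomial.aeval s r := by
        rw [Polynomial.aeval_eq_sum_range, Polynomial.aeval_eq_sum_range, map_sum]
        refine Finset.sum_congr rfl fun i _ => ?_
        rw [Algebra.smul_def, Algebra.smul_def, map_mul, map_pow, hτw]
        congr 1
        exact hτE _ (r.coeff i).2
      rw [hrw, hτf] at h1
      simp [Polynomial.eval_map_algebraMap, ← h1]
    · rw [Polynomial.natDegree_sub_C]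
      exact lt_of_le_of_lt Polynomial.natDegree_map_le (lt_of_lt_of_le hdeg hS)
  have hc := congrArg (fun q => Polynomial.coeff q 0) hz
  simp only [Polynomial.coeff_sub, Polynomial.coeff_map, Polynomial.coeff_C_zero,
    Polynomial.coeff_zero, sub_eq_zero] at hc
  rw [← hc]
  exact (r.coeff 0).2

lemma map_eq_self_of_mem_adjoin (σ : K ≃ₐ[k] K) {u v : K} (hu : σ u = u) (hv : σ v = v) {e : K}
    (he : e ∈ k⟮u, v⟯) : σ e = e := by
  induction he using adjoin_induction with
  | mem x hx => rcases hx with rfl | rfl <;> assumption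
  | algebraMap x => exact σ.commutes x
  | add x y _ _ hx hy => rw [map_add, hx, hy]
  | inv x _ hx => rw [map_inv₀, hx]
  | mul x y _ _ hx hy => rw [map_mul, hx, hy]

lemma adjoin_pair_le {E : IntermediateField k K} {x y : K} (hx : x ∈ E) (hy : y ∈ E) :
    k⟮x, y⟯ ≤ E := by
  rw [adjoin_le_iff]
  rintro z (rfl | rfl)
  exacts [hx, hy]

lemma mem_left (x y : K) : x ∈ k⟮x, y⟯ := mem_adjoin_pair_left k x y

lemma mem_right (x y : K) : y ∈ k⟮x, y⟯ := mem_adjoin_pair_right k x y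

lemma adjoin_triple_le_simple (u v w : K) :
    k⟮u, v, w⟯ ≤ (k⟮u, v⟯⟮w⟯).restrictScalars k := by
  rw [adjoin_le_iff]
  rintro z (rfl | rfl | rfl)
  · exact IntermediateField.algebraMap_mem k⟮z, v⟯⟮w⟯ ⟨z, mem_left z v⟩
  · exact IntermediateField.algebraMap_mem k⟮u, z⟯⟮w⟯ ⟨z, mem_right u z⟩
  · exact mem_adjoin_simple_self _ z

lemma mem_of_quadratic {σ : K ≃ₐ[k] K} {u v w f α β : K} (hu : σ u = u) (hv : σ v = v)
    (hw : σ w ≠ w) (hα : α ∈ k⟮u, v⟯) (hβ : β ∈ k⟮u, v⟯) (hq : w * w = α * w + β)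
    (hf : f ∈ k⟮u, v, w⟯) (hσ : σ f = f) : f ∈ k⟮u, v⟯ := by
  classical
  set E := k⟮u, v⟯ with hE
  let p : Polynomial E := Polynomial.X ^ 2 + (- Polynomial.C ⟨α, hα⟩ * Polynomial.X
    - Polynomial.C ⟨β, hβ⟩)
  have hp : p.Monic := by unfold p; monicity!
  have hpd : p.natDegree = 2 := by unfold p; compute_degree!
  refine mem_of_conjugates (p := p) hp (w := w) ?_ {w, σ w} ?_ ?_ (adjoin_triple_le_simple u v w hf)
  · have h1 : algebraMap E K ⟨α, hα⟩ = α := rfl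
    have h2 : algebraMap E K ⟨β, hβ⟩ = β := rfl
    simp only [p, map_add, map_sub, map_mul, map_neg, map_pow, Polynomial.aeval_X,
      Polynomial.aeval_C, h1, h2]
    linear_combination hq
  · rw [hpd, Finset.card_pair hw.symm]
  · intro s hs
    simp only [Finset.mem_insert, Finset.mem_singleton] at hs
    rcases hs with rfl | rfl
    · exact ⟨1, fun _ _ => rfl, rfl, rfl⟩
    · exact ⟨σ, fun e he => map_eq_self_of_mem_adjoin σ hu hv he, hσ, rfl⟩

lemma mem_of_cubic {σ : K ≃ₐ[k] K} {u v w f α β γ : K} (hu : σ u = u) (hv : σ v = v)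
    (hw : σ w ≠ w) (hw' : σ (σ w) ≠ w) (hα : α ∈ k⟮u, v⟯) (hβ : β ∈ k⟮u, v⟯) (hγ : γ ∈ k⟮u, v⟯)
    (hq : w ^ 3 = α * w ^ 2 + β * w + γ)
    (hf : f ∈ k⟮u, v, w⟯) (hσ : σ f = f) : f ∈ k⟮u, v⟯ := by
  classical
  set E := k⟮u, v⟯ with hE
  let p : Polynomial E := Polynomial.X ^ 3 + (- Polynomial.C ⟨α, hα⟩ * Polynomial.X ^ 2
    - Polynomial.C ⟨β, hβ⟩ * Polynomial.X - Polynomial.C ⟨γ, hγ⟩)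
  have hp : p.Monic := by unfold p; monicity!
  have hpd : p.natDegree = 3 := by unfold p; compute_degree!
  refine mem_of_conjugates (p := p) hp (w := w) ?_ {w, σ w, σ (σ w)} ?_ ?_
    (adjoin_triple_le_simple u v w hf)
  · have h1 : algebraMap E K ⟨α, hα⟩ = α := rfl
    have h2 : algebraMap E K ⟨β, hβ⟩ = β := rfl
    have h3 : algebraMap E K ⟨γ, hγ⟩ = γ := rfl
    simp only [p, map_add, map_sub, map_mul, map_neg, map_pow, Polynomial.aeval_X,
      Polynomial.aeval_C, h1, h2, h3]
    linear_combination hq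
  · have : σ w ≠ σ (σ w) := fun h => hw (σ.injective h).symm
    rw [hpd, Finset.card_insert_of_notMem (by simp [hw.symm, hw'.symm]), Finset.card_pair this]
  · intro s hs
    have he : ∀ e ∈ E, σ e = e := fun e he => map_eq_self_of_mem_adjoin σ hu hv he
    simp only [Finset.mem_insert, Finset.mem_singleton] at hs
    rcases hs with rfl | rfl | rfl
    · exact ⟨1, fun _ _ => rfl, rfl, rfl⟩
    · exact ⟨σ, he, hσ, rfl⟩
    · exact ⟨σ * σ, fun e h => by simp [he e h], by simp [hσ], rfl⟩

/-! ### Transcendence bases -/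

lemma isTranscendenceBasis_of_isAlgebraic {x y u v : K} (h : IsTranscendenceBasis k ![x, y])
    (hx : IsAlgebraic k⟮u, v⟯ x) (hy : IsAlgebraic k⟮u, v⟯ y) :
    IsTranscendenceBasis k ![u, v] := by
  have h2 := h.lift_cardinalMk_eq_trdeg
  have : Algebra.IsAlgebraic (Algebra.adjoin k (Set.range ![u, v])) K := by
    constructor
    intro z
    refine (h.isAlgebraic.isAlgebraic z).adjoin_of_forall_isAlgebraic ?_
    rintro z ⟨⟨i, rfl⟩, -⟩
    rw [← IntermediateField.isAlgebraic_adjoin_iff]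
    rw [show Set.range ![u, v] = {u, v} by
      simp [Matrix.range_cons, Matrix.range_empty, Set.pair_comm]]
    fin_cases i
    exacts [hx, hy]
  apply Algebra.IsAlgebraic.isTranscendenceBasis_of_lift_le_trdeg_of_finite
  simpa using h2.le

/-! ### Quadratic descents -/

/-- The elements `u`, `v` of `k(x, y)` are fixed by `S`, and generate a field containing the
`S`-invariants of `k(x, y)`. -/
structure Descends (S : Set (K ≃ₐ[k] K)) (x y u v : K) : Prop where
  map_left : ∀ σ ∈ S, σ u = u
  map_right : ∀ σ ∈ S, σ v = v
  left_mem : u ∈ k⟮x, y⟯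
  right_mem : v ∈ k⟮x, y⟯
  mem_of_forall : ∀ f ∈ k⟮x, y⟯, (∀ σ ∈ S, σ f = f) → f ∈ k⟮u, v⟯

lemma Descends.trans {S T : Set (K ≃ₐ[k] K)} {x y x' y' u v : K} (h : Descends S x y x' y')
    (h' : Descends T x' y' u v) : Descends (S ∪ T) x y u v where
  map_left := by
    rintro σ (hσ | hσ)
    exacts [map_eq_self_of_mem_adjoin σ (h.map_left σ hσ) (h.map_right σ hσ) h'.left_mem,
      h'.map_left σ hσ]
  map_right := by
    rintro σ (hσ | hσ)
    exacts [map_eq_self_of_mem_adjoin σ (h.map_left σ hσ) (h.map_right σ hσ) h'.right_mem,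
      h'.map_right σ hσ]
  left_mem := adjoin_pair_le h.left_mem h.right_mem h'.left_mem
  right_mem := adjoin_pair_le h.left_mem h.right_mem h'.right_mem
  mem_of_forall f hf hσ := h'.mem_of_forall f
    (h.mem_of_forall f hf fun σ h => hσ σ (.inl h)) fun σ h => hσ σ (.inr h)

lemma Descends.congr {S : Set (K ≃ₐ[k] K)} {x y x' y' u v : K} (h : Descends S x y u v)
    (e : k⟮x', y'⟯ = k⟮x, y⟯) : Descends S x' y' u v :=
  ⟨h.map_left, h.map_right, e ▸ h.left_mem, e ▸ h.right_mem, e ▸ h.mem_of_forall⟩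

lemma descends_empty (x y : K) : Descends (∅ : Set (K ≃ₐ[k] K)) x y x y :=
  ⟨by simp, by simp, mem_left x y, mem_right x y, fun _ h _ => h⟩

lemma Descends.of_single {σ : K ≃ₐ[k] K} {x y u v : K} (hu : σ u = u) (hv : σ v = v)
    (hu' : u ∈ k⟮x, y⟯) (hv' : v ∈ k⟮x, y⟯) (h : ∀ f ∈ k⟮x, y⟯, σ f = f → f ∈ k⟮u, v⟯) :
    Descends {σ} x y u v :=
  ⟨by simpa, by simpa, hu', hv', by simpa⟩

lemma Descends.of_quadratic {σ : K ≃ₐ[k] K} {x y u v w α β : K} (hu : σ u = u) (hv : σ v = v)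
    (hu' : u ∈ k⟮x, y⟯) (hv' : v ∈ k⟮x, y⟯)
    (hw : σ w ≠ w) (hq : w * w = α * w + β) (hα : α ∈ k⟮u, v⟯) (hβ : β ∈ k⟮u, v⟯)
    (hx : x ∈ k⟮u, v, w⟯) (hy : y ∈ k⟮u, v, w⟯) : Descends {σ} x y u v :=
  .of_single hu hv hu' hv'
    fun _ hf hσ => mem_of_quadratic hu hv hw hα hβ hq (adjoin_pair_le hx hy hf) hσ

lemma mem_triple (u v w : K) : u ∈ k⟮u, v, w⟯ ∧ v ∈ k⟮u, v, w⟯ ∧ w ∈ k⟮u, v, w⟯ :=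
  ⟨subset_adjoin k _ (by simp), subset_adjoin k _ (by simp), subset_adjoin k _ (by simp)⟩

lemma descends_swap {σ : K ≃ₐ[k] K} {x y : K} (hx : σ x = y) (hy : σ y = x) (hne : x ≠ y) :
    Descends {σ} x y (x + y) (x * y) := by
  obtain ⟨h1, h2, h3⟩ := mem_triple (k := k) (x + y) (x * y) x
  refine .of_quadratic (w := x) (by rw [map_add, hx, hy, add_comm])
    (by rw [map_mul, hx, hy, mul_comm])
    (add_mem (mem_left _ _) (mem_right _ _)) (mul_mem (mem_left _ _) (mem_right _ _))
    (by rw [hx]; exact hne.symm) (show x * x = (x + y) * x + -(x * y) by ring)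
    (mem_left _ _) (neg_mem (mem_right _ _)) h3 ?_
  simpa using sub_mem h1 h3

lemma descends_inv {σ : K ≃ₐ[k] K} {x y e : K} (hx : σ x = x) (hy : σ y = e / y) (he : σ e = e)
    (hex : e ∈ k⟮x, y + e / y⟯) (hex' : e ∈ k⟮x, y⟯) (he0 : e ≠ 0) (hy0 : y ≠ 0) (hne : y * y ≠ e) :
    Descends {σ} x y x (y + e / y) := by
  obtain ⟨h1, h2, h3⟩ := mem_triple (k := k) x (y + e / y) y
  refine .of_quadratic (w := y) (α := y + e / y) (β := - e) hx ?_ (mem_left _ _)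
    (add_mem (mem_right _ _) (div_mem hex' (mem_right _ _))) ?_ ?_ (mem_right _ _)
    (neg_mem hex) h1 h3
  · rw [map_add, map_div₀, hy, he]
    field_simp
    ring
  · rw [hy, Ne, div_eq_iff hy0]
    exact hne.symm
  · field_simp
    ring

lemma descends_neg {σ : K ≃ₐ[k] K} {x y : K} {d : k} (hd : d ≠ 0) (hx : σ x = - x)
    (hy : σ y = algebraMap k K d / y) (hy0 : y ≠ 0) (hne : y * y ≠ algebraMap k K d) :
    Descends {σ} x y (y + algebraMap k K d / y) (x * (y - algebraMap k K d / y)) := by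
  have hd0 : algebraMap k K d ≠ 0 := by simpa
  have hσ : σ (algebraMap k K d) = algebraMap k K d := σ.commutes d
  have hdm : ∀ E : IntermediateField k K, algebraMap k K d ∈ E := fun E => E.algebraMap_mem d
  set e := algebraMap k K d
  obtain ⟨h1, h2, h3⟩ := mem_triple (k := k) (y + e / y) (x * (y - e / y)) y
  have hsub : y - e / y ≠ 0 := by
    rw [sub_ne_zero, Ne, eq_div_iff hy0]
    exact hne
  have hm : e / y ∈ k⟮x, y⟯ := div_mem (hdm _) (mem_right _ _)
  refine .of_quadratic (w := y) (α := y + e / y) (β := - e) ?_ ?_ (add_mem (mem_right _ _) hm)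
    (mul_mem (mem_left _ _) (sub_mem (mem_right _ _) hm)) ?_ ?_ (mem_left _ _)
    (neg_mem (hdm _)) ?_ h3
  · rw [map_add, map_div₀, hy, hσ]
    field_simp
    ring
  · rw [map_mul, map_sub, map_div₀, hx, hy, hσ]
    field_simp
    ring
  · rw [hy, Ne, div_eq_iff hy0]
    exact hne.symm
  · field_simp
    ring
  · have hx' : x = (x * (y - e / y)) / (y - e / y) := (mul_div_cancel_right₀ x hsub).symm
    have := div_mem h2 (sub_mem h3 (div_mem (hdm k⟮y + e / y, x * (y - e / y), y⟯) h3))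
    rwa [← hx'] at this

lemma descends_affine {σ : K ≃ₐ[k] K} {x t : K} (hx : σ x = x⁻¹) (ht : σ t = t / x) (hx0 : x ≠ 0)
    (hne : x * x ≠ 1) : Descends {σ} x t (x + x⁻¹) (t + t / x) := by
  obtain ⟨h1, h2, h3⟩ := mem_triple (k := k) (x + x⁻¹) (t + t / x) x
  have hx1 : 1 + x⁻¹ ≠ 0 := by
    intro h
    apply hne
    have : x = -1 := by
      field_simp at h
      linear_combination h
    rw [this]; ring
  refine .of_quadratic (w := x) (α := x + x⁻¹) (β := - 1) ?_ ?_
    (add_mem (mem_left _ _) (inv_mem (mem_left _ _)))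
    (add_mem (mem_right _ _) (div_mem (mem_right _ _) (mem_left _ _))) ?_ ?_ (mem_left _ _)
    (neg_mem (one_mem _)) h3 ?_
  · rw [map_add, map_inv₀, hx, inv_inv, add_comm]
  · rw [map_add, map_div₀, ht, hx]
    field_simp
    ring
  · rw [hx, Ne, inv_eq_iff_eq_inv, ← div_eq_one_iff_eq (inv_ne_zero hx0), div_inv_eq_mul]
    exact hne
  · field_simp
    ring
  · have ht' : t = (t + t / x) / (1 + x⁻¹) := by
      rw [eq_div_iff hx1]
      ring
    have := div_mem h2 (add_mem (one_mem k⟮x + x⁻¹, t + t / x, x⟯) (inv_mem h3))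
    rwa [← ht'] at this

/-! ### Inversion of both coordinates -/

lemma aeval_ne_zero {x y : K} (h : AlgebraicIndependent k ![x, y]) (P : MvPolynomial (Fin 2) k)
    (s t : k) (hP : eval ![s, t] P ≠ 0) : aeval ![x, y] P ≠ 0 := by
  intro h0
  rw [algebraicIndependent_iff.1 h P h0] at hP
  simp at hP

section Inversion

variable {x y : K} {a b : k}

lemma sq_ne_left (h : AlgebraicIndependent k ![x, y]) (ha : a ≠ 0) : x * x ≠ algebraMap k K a := by
  have := aeval_ne_zero h (X 0 * X 0 - C a) 0 0 (by simpa)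
  rw [← sub_ne_zero]
  simpa using this

lemma sq_ne_right (h : AlgebraicIndependent k ![x, y]) (ha : a ≠ 0) : y * y ≠ algebraMap k K a := by
  have := aeval_ne_zero h (X 1 * X 1 - C a) 0 0 (by simpa)
  rw [← sub_ne_zero]
  simpa using this

lemma left_ne_zero (h : AlgebraicIndependent k ![x, y]) : x ≠ 0 := by
  simpa using aeval_ne_zero h (X 0) 1 1 (by simp)

lemma right_ne_zero (h : AlgebraicIndependent k ![x, y]) : y ≠ 0 := by
  simpa using aeval_ne_zero h (X 1) 1 1 (by simp)

/-- The first coordinate of `k(x, y)` modulo `x ↦ a / x`, `y ↦ b / y`. -/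
def inversionU (a b x y : K) : K := (x - a / x) / (x * y - a * b / (x * y))

/-- The second coordinate of `k(x, y)` modulo `x ↦ a / x`, `y ↦ b / y`. -/
def inversionV (a b x y : K) : K := (y - b / y) / (x * y - a * b / (x * y))

lemma descends_inversion {σ : K ≃ₐ[k] K} (h : AlgebraicIndependent k ![x, y]) (ha : a ≠ 0)
    (hb : b ≠ 0) (hx : σ x = algebraMap k K a / x) (hy : σ y = algebraMap k K b / y) :
    Descends {σ} x y (inversionU (algebraMap k K a) (algebraMap k K b) x y)
      (inversionV (algebraMap k K a) (algebraMap k K b) x y) := by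
  have hx0 := left_ne_zero h
  have hy0 := right_ne_zero h
  have hxa := sq_ne_left h ha
  have hyb := sq_ne_right h hb
  have hD : x * y * (x * y) ≠ algebraMap k K a * algebraMap k K b := by
    have := aeval_ne_zero h (X 0 * X 1 * (X 0 * X 1) - C a * C b) 0 0 (by simp [ha, hb])
    rw [← sub_ne_zero]
    simpa using this
  have ha0 : algebraMap k K a ≠ 0 := by simpa
  have hb0 : algebraMap k K b ≠ 0 := by simpa
  have hσa : σ (algebraMap k K a) = algebraMap k K a := σ.commutes a
  have hσb : σ (algebraMap k K b) = algebraMap k K b := σ.commutes b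
  have ham : ∀ E : IntermediateField k K, algebraMap k K a ∈ E := fun E => E.algebraMap_mem a
  have hbm : ∀ E : IntermediateField k K, algebraMap k K b ∈ E := fun E => E.algebraMap_mem b
  generalize algebraMap k K a = a at *
  generalize algebraMap k K b = b at *
  have hD1 : x * y * (x * y) - a * b ≠ 0 := sub_ne_zero.2 hD
  have hx1 : x * x - a ≠ 0 := sub_ne_zero.2 hxa
  have hy1 : y * y - b ≠ 0 := sub_ne_zero.2 hyb
  have hU : inversionU a b x y = (x * x - a) * y / (x * y * (x * y) - a * b) := by
    unfold inversionU
    rw [show x - a / x = (x * x - a) / x by field_simp,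
      show x * y - a * b / (x * y) = (x * y * (x * y) - a * b) / (x * y) by field_simp]
    field_simp
  have hV : inversionV a b x y = (y * y - b) * x / (x * y * (x * y) - a * b) := by
    unfold inversionV
    rw [show y - b / y = (y * y - b) / y by field_simp,
      show x * y - a * b / (x * y) = (x * y * (x * y) - a * b) / (x * y) by field_simp]
    field_simp
  have hD2 : x ^ 2 * y ^ 2 - a * b ≠ 0 := by convert hD1 using 2; ring
  have hD3 : y ^ 2 * x ^ 2 - a * b ≠ 0 := by convert hD1 using 2; ring
  have hx2 : x ^ 2 - a ≠ 0 := by convert hx1 using 2; ring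
  have hy2 : y ^ 2 - b ≠ 0 := by convert hy1 using 2; ring
  have hσU : σ (inversionU a b x y) = inversionU a b x y := by
    unfold inversionU
    simp only [map_div₀, map_sub, map_mul, hx, hy, hσa, hσb]
    rw [← neg_div_neg_eq]
    congr 1 <;> field_simp <;> ring
  have hσV : σ (inversionV a b x y) = inversionV a b x y := by
    unfold inversionV
    simp only [map_div₀, map_sub, map_mul, hx, hy, hσa, hσb]
    rw [← neg_div_neg_eq]
    congr 1 <;> field_simp <;> ring
  have hU0 : inversionU a b x y ≠ 0 := by
    rw [hU]
    exact div_ne_zero (mul_ne_zero hx1 hy0) hD1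
  have hV0 : inversionV a b x y ≠ 0 := by
    rw [hV]
    exact div_ne_zero (mul_ne_zero hy1 hx0) hD1
  have hyU : y = (1 - a * inversionV a b x y / x) / inversionU a b x y := by
    rw [eq_div_iff hU0, hU, hV]
    field_simp
    ring
  have hxE : x * x = (1 + a * inversionV a b x y ^ 2 - b * inversionU a b x y ^ 2) /
      inversionV a b x y * x + -a := by
    rw [div_mul_eq_mul_div, ← sub_eq_iff_eq_add, eq_div_iff hV0, hU, hV]
    field_simp
    ring
  have hum : inversionU a b x y ∈ k⟮x, y⟯ := by
    rw [hU]
    have h1 := mem_left (k := k) x y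
    have h2 := mem_right (k := k) x y
    have h3 := mul_mem h1 h2
    exact div_mem (mul_mem (sub_mem (mul_mem h1 h1) (ham _)) h2)
      (sub_mem (mul_mem h3 h3) (mul_mem (ham _) (hbm _)))
  have hvm : inversionV a b x y ∈ k⟮x, y⟯ := by
    rw [hV]
    have h1 := mem_left (k := k) x y
    have h2 := mem_right (k := k) x y
    have h3 := mul_mem h1 h2
    exact div_mem (mul_mem (sub_mem (mul_mem h2 h2) (hbm _)) h1)
      (sub_mem (mul_mem h3 h3) (mul_mem (ham _) (hbm _)))
  generalize inversionU a b x y = u at *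
  generalize inversionV a b x y = v at *
  obtain ⟨h1, h2, h3⟩ := mem_triple (k := k) u v x
  refine .of_quadratic hσU hσV hum hvm ?_ hxE ?_ (neg_mem (ham _)) h3 ?_
  · rw [hx, Ne, div_eq_iff hx0]
    exact hxa.symm
  · exact div_mem (sub_mem (add_mem (one_mem _) (mul_mem (ham _) (pow_mem (mem_right _ _) 2)))
      (mul_mem (hbm _) (pow_mem (mem_left _ _) 2))) (mem_right _ _)
  · rw [hyU]
    exact div_mem (sub_mem (one_mem _) (div_mem (mul_mem (ham _) h2) h3)) h1

end Inversion

/-! ### Descents along conics -/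

lemma descends_conic_of_two_ne_zero {τ : K ≃ₐ[k] K} {x y : K} {a b : k}
    (h : AlgebraicIndependent k ![x, y])
    (h2 : (2 : k) ≠ 0) (ha : a ≠ 0) (hb : b ≠ 0) (hx : τ x = - x)
    (hy : τ y = - algebraMap k K b / y) :
    Descends {τ} (inversionU (algebraMap k K a) (algebraMap k K b) x y)
      (inversionV (algebraMap k K a) (algebraMap k K b) x y)
      ((x - algebraMap k K a / x) * (y + algebraMap k K b / y) / (y - algebraMap k K b / y))
      ((y - algebraMap k K b / y) * (x + algebraMap k K a / x) / (x - algebraMap k K a / x)) := by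
  have hx0 := left_ne_zero h
  have hy0 := right_ne_zero h
  have hxa := sq_ne_left h ha
  have hyb := sq_ne_right h hb
  have hD : x * y * (x * y) ≠ algebraMap k K a * algebraMap k K b := by
    have := aeval_ne_zero h (X 0 * X 1 * (X 0 * X 1) - C a * C b) 0 0 (by simp [ha, hb])
    rw [← sub_ne_zero]
    simpa using this
  have h4 : (y * y - algebraMap k K b) ^ 2 * (x * x + algebraMap k K a) ^ 2
      + 4 * algebraMap k K b * (x * x - algebraMap k K a) ^ 2 * (y * y) ≠ 0 := by
    have := aeval_ne_zero h ((X 1 * X 1 - C b) ^ 2 * (X 0 * X 0 + C a) ^ 2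
      + 4 * C b * (X 0 * X 0 - C a) ^ 2 * (X 1 * X 1)) 0 0 (by simp [ha, hb])
    simpa using this
  have h20 : (2 : K) ≠ 0 := by
    have := (map_ne_zero (algebraMap k K)).2 h2
    rwa [map_ofNat] at this
  have ha0 : algebraMap k K a ≠ 0 := by simpa
  have hb0 : algebraMap k K b ≠ 0 := by simpa
  have hσa : τ (algebraMap k K a) = algebraMap k K a := τ.commutes a
  have hσb : τ (algebraMap k K b) = algebraMap k K b := τ.commutes b
  have ham : ∀ E : IntermediateField k K, algebraMap k K a ∈ E := fun E => E.algebraMap_mem a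
  have hbm : ∀ E : IntermediateField k K, algebraMap k K b ∈ E := fun E => E.algebraMap_mem b
  have h2m : ∀ E : IntermediateField k K, (2 : K) ∈ E := fun E => ofNat_mem E 2
  generalize algebraMap k K a = a at *
  generalize algebraMap k K b = b at *
  have hp : x - a / x ≠ 0 := by
    rw [sub_ne_zero, Ne, eq_div_iff hx0]
    exact hxa
  have hq : y - b / y ≠ 0 := by
    rw [sub_ne_zero, Ne, eq_div_iff hy0]
    exact hyb
  have hd : x * y - a * b / (x * y) ≠ 0 := by
    rw [sub_ne_zero, Ne, eq_div_iff (mul_ne_zero hx0 hy0)]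
    exact hD
  have hτp : τ (x - a / x) = - (x - a / x) := by
    rw [map_sub, map_div₀, hx, hσa]
    field_simp
    ring
  have hτq : τ (y - b / y) = y - b / y := by
    rw [map_sub, map_div₀, hy, hσb]
    field_simp
    ring
  have hτp' : τ (x + a / x) = - (x + a / x) := by
    rw [map_add, map_div₀, hx, hσa]
    field_simp
    ring
  have hτq' : τ (y + b / y) = - (y + b / y) := by
    rw [map_add, map_div₀, hy, hσb]
    field_simp
    ring
  have hd2 : 2 * (x * y - a * b / (x * y)) =
      (x - a / x) * (y + b / y) + (y - b / y) * (x + a / x) := by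
    field_simp
    ring
  have hp4 : (x + a / x) ^ 2 = (x - a / x) ^ 2 + 4 * a := by
    field_simp
    ring
  have hq4 : (y + b / y) ^ 2 = (y - b / y) ^ 2 + 4 * b := by
    field_simp
    ring
  have h4' : (y - b / y) ^ 2 * (x + a / x) ^ 2 + 4 * b * (x - a / x) ^ 2 ≠ 0 := by
    have : (y - b / y) ^ 2 * (x + a / x) ^ 2 + 4 * b * (x - a / x) ^ 2 =
      ((y * y - b) ^ 2 * (x * x + a) ^ 2 + 4 * b * (x * x - a) ^ 2 * (y * y)) / (x * y) ^ 2 := by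
      field_simp
    rw [this]
    exact div_ne_zero h4 (pow_ne_zero _ (mul_ne_zero hx0 hy0))
  unfold inversionU inversionV
  generalize x - a / x = p at *
  generalize y - b / y = q at *
  generalize x + a / x = p' at *
  generalize y + b / y = q' at *
  generalize x * y - a * b / (x * y) = d at *
  have hQ : (q * p' / p) ^ 2 + 4 * b ≠ 0 := by
    have : (q * p' / p) ^ 2 + 4 * b = (q ^ 2 * p' ^ 2 + 4 * b * p ^ 2) / p ^ 2 := by field_simp
    rw [this]
    exact div_ne_zero h4' (pow_ne_zero _ hp)
  have hv : q / d = 2 / (p * q' / q + q * p' / p * (p / q)) := by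
    have : p * q' / q + q * p' / p * (p / q) = 2 * d / q := by
      rw [hd2]
      field_simp
    rw [this]
    field_simp
  have hu : p / d = (p / q) * (q / d) := by field_simp
  obtain ⟨h1, h2, h3⟩ := mem_triple (k := k) (p * q' / q) (q * p' / p) (p / q)
  have hvm : q / d ∈ k⟮p * q' / q, q * p' / p, p / q⟯ := by
    rw [hv]
    exact div_mem (h2m _) (add_mem h1 (mul_mem h2 h3))
  have h40 : (4 : K) ≠ 0 := by
    rw [show (4 : K) = 2 * 2 by norm_num]
    exact mul_ne_zero h20 h20
  have hP : p * q' / q = (q / d)⁻¹ + q / d * (b * ((p / d) / (q / d)) ^ 2 - a) := by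
    field_simp
    apply mul_left_cancel₀ h40
    linear_combination (2 * p * q' - 2 * d - (p * q' + q * p')) * hd2 - q ^ 2 * hp4 + p ^ 2 * hq4
  have hQ' : q * p' / p = ((q / d)⁻¹ - q / d * (b * ((p / d) / (q / d)) ^ 2 - a)) /
      ((p / d) / (q / d)) := by
    field_simp
    apply mul_left_cancel₀ h40
    linear_combination (2 * q * p' - 2 * d - (p * q' + q * p')) * hd2 + q ^ 2 * hp4 - p ^ 2 * hq4
  have hwm : (p / d) / (q / d) ∈ k⟮p / d, q / d⟯ := div_mem (mem_left _ _) (mem_right _ _)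
  have hdm : q / d * (b * ((p / d) / (q / d)) ^ 2 - a) ∈ k⟮p / d, q / d⟯ :=
    mul_mem (mem_right _ _) (sub_mem (mul_mem (hbm _) (pow_mem hwm 2)) (ham _))
  refine .of_quadratic (w := p / q) (α := 0)
    (β := ((p * q' / q) ^ 2 + 4 * a) / ((q * p' / p) ^ 2 + 4 * b)) ?_ ?_
    (hP ▸ add_mem (inv_mem (mem_right _ _)) hdm)
    (hQ' ▸ div_mem (sub_mem (inv_mem (mem_right _ _)) hdm) hwm) ?_ ?_ (zero_mem _) ?_ ?_ hvm
  · simp only [map_div₀, map_mul, hτp, hτq, hτq']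
    ring
  · simp only [map_div₀, map_mul, hτp, hτq, hτp']
    field_simp
  · rw [map_div₀, hτp, hτq, neg_div]
    intro hw
    have : 2 * (p / q) = 0 := by linear_combination -hw
    simp [h20, hp, hq] at this
  · rw [zero_mul, zero_add, eq_div_iff hQ]
    field_simp
    linear_combination q ^ 2 * hp4 - p ^ 2 * hq4
  · have h4m : ∀ E : IntermediateField k K, (4 : K) ∈ E := fun E => by
      rw [show (4 : K) = 2 * 2 by norm_num]
      exact mul_mem (h2m E) (h2m E)
    exact div_mem (add_mem (pow_mem (mem_left _ _) 2) (mul_mem (h4m _) (ham _)))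
      (add_mem (pow_mem (mem_right _ _) 2) (mul_mem (h4m _) (hbm _)))
  · rw [hu]
    exact mul_mem h3 hvm

lemma descends_conic_of_order_four {σ : K ≃ₐ[k] K} {x y : K} {b : k}
    (h : AlgebraicIndependent k ![x, y]) (hb : b ≠ 0) (hx : σ x = y)
    (hy : σ y = algebraMap k K b / x) : ∃ u v : K,
    Descends {σ} (inversionU (algebraMap k K b) (algebraMap k K b) x y)
      (inversionV (algebraMap k K b) (algebraMap k K b) x y) u v := by
  have hx0 := left_ne_zero h
  have hy0 := right_ne_zero h
  have hxa := sq_ne_left h hb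
  have hyb := sq_ne_right h hb
  have hD : x * y * (x * y) ≠ algebraMap k K b * algebraMap k K b := by
    have := aeval_ne_zero h (X 0 * X 1 * (X 0 * X 1) - C b * C b) 0 0 (by simp [hb])
    rw [← sub_ne_zero]
    simpa using this
  have h4 :
      (x * x - algebraMap k K b) ^ 2 * y ^ 2 + (y * y - algebraMap k K b) ^ 2 * x ^ 2 ≠ 0 := by
    have := aeval_ne_zero h ((X 0 * X 0 - C b) ^ 2 * X 1 ^ 2 + (X 1 * X 1 - C b) ^ 2 * X 0 ^ 2)
      1 0 (by simp [hb])
    simpa using this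
  have h5 : (algebraMap k K b * (x ^ 2 - y ^ 2) * (y * y - algebraMap k K b) ^ 3 * x ^ 3
        + (x ^ 2 * y ^ 2 - algebraMap k K b ^ 2) * (x * x - algebraMap k K b) ^ 3 * y ^ 3)
      * (algebraMap k K b * (x ^ 2 - y ^ 2) * (y * y - algebraMap k K b) * x
        - (x ^ 2 * y ^ 2 - algebraMap k K b ^ 2) * (x * x - algebraMap k K b) * y)
      - algebraMap k K b * (x * x - algebraMap k K b) * (y * y - algebraMap k K b) * x * y *
        ((x * x - algebraMap k K b) ^ 2 * y ^ 2 + (y * y - algebraMap k K b) ^ 2 * x ^ 2) ^ 2 ≠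
          0 := by
    have := aeval_ne_zero h ((C b * (X 0 ^ 2 - X 1 ^ 2) * (X 1 * X 1 - C b) ^ 3 * X 0 ^ 3
        + (X 0 ^ 2 * X 1 ^ 2 - C b ^ 2) * (X 0 * X 0 - C b) ^ 3 * X 1 ^ 3)
      * (C b * (X 0 ^ 2 - X 1 ^ 2) * (X 1 * X 1 - C b) * X 0
        - (X 0 ^ 2 * X 1 ^ 2 - C b ^ 2) * (X 0 * X 0 - C b) * X 1)
      - C b * (X 0 * X 0 - C b) * (X 1 * X 1 - C b) * X 0 * X 1 *
        ((X 0 * X 0 - C b) ^ 2 * X 1 ^ 2 + (X 1 * X 1 - C b) ^ 2 * X 0 ^ 2) ^ 2)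
      1 0 (by simp [hb])
    simpa using this
  have hb0 : algebraMap k K b ≠ 0 := by simpa
  have hσb : σ (algebraMap k K b) = algebraMap k K b := σ.commutes b
  have hbm : ∀ E : IntermediateField k K, algebraMap k K b ∈ E := fun E => E.algebraMap_mem b
  generalize algebraMap k K b = b at *
  have hp : x - b / x ≠ 0 := by
    rw [sub_ne_zero, Ne, eq_div_iff hx0]
    exact hxa
  have hq : y - b / y ≠ 0 := by
    rw [sub_ne_zero, Ne, eq_div_iff hy0]
    exact hyb
  have hd : x * y - b * b / (x * y) ≠ 0 := by
    rw [sub_ne_zero, Ne, eq_div_iff (mul_ne_zero hx0 hy0)]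
    exact hD
  have hσp : σ (x - b / x) = y - b / y := by
    rw [map_sub, map_div₀, hx, hσb]
  have hσq : σ (y - b / y) = - (x - b / x) := by
    rw [map_sub, map_div₀, hy, hσb]
    field_simp
    ring
  have hσd : σ (x * y - b * b / (x * y)) = - (b * (x / y - y / x)) := by
    simp only [map_sub, map_div₀, map_mul, hx, hy, hσb]
    field_simp
    ring
  have hσd' : σ (b * (x / y - y / x)) = x * y - b * b / (x * y) := by
    simp only [map_sub, map_div₀, map_mul, hx, hy, hσb]
    field_simp
  have hdd : (x * y - b * b / (x * y)) * (b * (x / y - y / x)) =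
      b * ((x - b / x) ^ 2 - (y - b / y) ^ 2) := by
    field_simp
    ring
  have hpq : (x - b / x) ^ 2 + (y - b / y) ^ 2 ≠ 0 := by
    have : (x - b / x) ^ 2 + (y - b / y) ^ 2 =
      ((x * x - b) ^ 2 * y ^ 2 + (y * y - b) ^ 2 * x ^ 2) / (x * y) ^ 2 := by
      field_simp
    rw [this]
    exact div_ne_zero h4 (pow_ne_zero _ (mul_ne_zero hx0 hy0))
  have hPQ' : (b * (x / y - y / x) * (y - b / y) ^ 3 + (x * y - b * b / (x * y)) * (x - b / x) ^ 3)
      * (b * (x / y - y / x) * (y - b / y) - (x * y - b * b / (x * y)) * (x - b / x))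
      - b * ((x - b / x) * (y - b / y) * ((x - b / x) ^ 2 + (y - b / y) ^ 2) ^ 2) ≠ 0 := by
    rw [← mul_ne_zero_iff_right (pow_ne_zero 6 (mul_ne_zero hx0 hy0))]
    convert h5 using 1
    field_simp
  unfold inversionU inversionV
  generalize x - b / x = p at *
  generalize y - b / y = q at *
  generalize b * (x / y - y / x) = d' at *
  generalize x * y - b * b / (x * y) = d at *
  have hP0 : (d' * q ^ 3 + d * p ^ 3) / (p * q * (p ^ 2 + q ^ 2)) =
    d / q + (d' * q - d * p) / (p ^ 2 + q ^ 2) / (p / q) := by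
    field_simp
    ring
  have hPQ : (d' * q ^ 3 + d * p ^ 3) / (p * q * (p ^ 2 + q ^ 2)) *
      ((d' * q - d * p) / (p ^ 2 + q ^ 2)) - b ≠ 0 := by
    rw [div_mul_div_comm, sub_ne_zero, Ne, div_eq_iff (by positivity), ← sub_eq_zero]
    convert hPQ' using 2
    ring
  have hs : (p / q - q / p) * ((d' * q ^ 3 + d * p ^ 3) / (p * q * (p ^ 2 + q ^ 2)) *
      ((d' * q - d * p) / (p ^ 2 + q ^ 2)) - b) =
      ((d' * q - d * p) / (p ^ 2 + q ^ 2)) ^ 2 -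
      ((d' * q ^ 3 + d * p ^ 3) / (p * q * (p ^ 2 + q ^ 2))) ^ 2 := by
    field_simp
    linear_combination p * q * (p ^ 2 + q ^ 2) ^ 2 * hdd
  have hσP : σ ((d' * q ^ 3 + d * p ^ 3) / (p * q * (p ^ 2 + q ^ 2))) =
      (d' * q ^ 3 + d * p ^ 3) / (p * q * (p ^ 2 + q ^ 2)) := by
    simp only [map_div₀, map_mul, map_add, map_pow, hσp, hσq, hσd, hσd']
    rw [← neg_div_neg_eq]
    congr 1 <;> ring
  have hσQ : σ ((d' * q - d * p) / (p ^ 2 + q ^ 2)) = (d' * q - d * p) / (p ^ 2 + q ^ 2) := by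
    simp only [map_div₀, map_mul, map_add, map_sub, map_pow, hσp, hσq, hσd, hσd']
    congr 1 <;> ring
  have hv : q / d = ((d' * q ^ 3 + d * p ^ 3) / (p * q * (p ^ 2 + q ^ 2)) -
      (d' * q - d * p) / (p ^ 2 + q ^ 2) / (p / q))⁻¹ := by
    rw [hP0]
    simp
  have hwm : (p / d) / (q / d) ∈ k⟮p / d, q / d⟯ := div_mem (mem_left _ _) (mem_right _ _)
  have hdm : (q / d)⁻¹ ∈ k⟮p / d, q / d⟯ := inv_mem (mem_right _ _)
  have hd'm : b * (((p / d) / (q / d)) ^ 2 - 1) * (q / d) ∈ k⟮p / d, q / d⟯ :=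
    mul_mem (mul_mem (hbm _) (sub_mem (pow_mem hwm 2) (one_mem _))) (mem_right _ _)
  have hd' : d' / q = b * (((p / d) / (q / d)) ^ 2 - 1) * (q / d) := by
    field_simp
    linear_combination hdd
  have hw1 : ((p / d) / (q / d)) ^ 2 + 1 = (p ^ 2 + q ^ 2) / q ^ 2 := by field_simp
  have hw1m : ((p / d) / (q / d)) ^ 2 + 1 ∈ k⟮p / d, q / d⟯ := add_mem (pow_mem hwm 2) (one_mem _)
  have hPm : (d' * q ^ 3 + d * p ^ 3) / (p * q * (p ^ 2 + q ^ 2)) ∈ k⟮p / d, q / d⟯ := by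
    have := div_mem (add_mem hd'm (mul_mem hdm (pow_mem hwm 3))) (mul_mem hwm hw1m)
    rw [← hd', hw1] at this
    convert this using 1
    field_simp
  have hQm : (d' * q - d * p) / (p ^ 2 + q ^ 2) ∈ k⟮p / d, q / d⟯ := by
    have := div_mem (sub_mem hd'm (mul_mem hdm hwm)) hw1m
    rw [← hd', hw1] at this
    convert this using 1
    field_simp
  generalize (d' * q ^ 3 + d * p ^ 3) / (p * q * (p ^ 2 + q ^ 2)) = P at *
  generalize (d' * q - d * p) / (p ^ 2 + q ^ 2) = Q at *
  have hu : p / d = (p / q) * (q / d) := by field_simp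
  obtain ⟨h1, h2, h3⟩ := mem_triple (k := k) P Q (p / q)
  have hvm : q / d ∈ k⟮P, Q, p / q⟯ := by
    rw [hv]
    exact inv_mem (sub_mem h1 (div_mem h2 h3))
  refine ⟨P, Q, .of_quadratic (w := p / q) (α := (Q ^ 2 - P ^ 2) / (P * Q - b)) (β := 1)
    hσP hσQ hPm hQm ?_ ?_ ?_ (one_mem _) ?_ hvm⟩
  · rw [map_div₀, hσp, hσq]
    intro hw
    apply hpq
    field_simp at hw
    linear_combination -hw
  · rw [← hs, mul_div_cancel_right₀ _ hPQ]
    field_simp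
    ring
  · exact div_mem (sub_mem (pow_mem (mem_right _ _) 2) (pow_mem (mem_left _ _) 2))
      (sub_mem (mul_mem (mem_left _ _) (mem_right _ _)) (hbm _))
  · rw [hu]
    exact mul_mem h3 hvm

lemma descends_conic_of_order_six {σ : K ≃ₐ[k] K} {u v : K}
    (h : AlgebraicIndependent k ![u, v]) (hu : σ u = v / (u ^ 2 - u * v + v ^ 2))
    (hv : σ v = u / (u ^ 2 - u * v + v ^ 2)) : ∃ P Q : K, Descends {σ} u v P Q := by
  have hu0 := left_ne_zero h
  have hv0 := right_ne_zero h
  have hW : u ^ 2 - u * v + v ^ 2 ≠ 0 := by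
    have := aeval_ne_zero h (X 0 ^ 2 - X 0 * X 1 + X 1 ^ 2) 1 0 (by simp)
    simpa using this
  have huv : u ^ 2 - v ^ 2 ≠ 0 := by
    have := aeval_ne_zero h (X 0 ^ 2 - X 1 ^ 2) 1 0 (by simp)
    simpa using this
  have hPQ' : ((u ^ 2 - u * v + v ^ 2) * v - u) * (u ^ 3 - (u ^ 2 - u * v + v ^ 2) * v ^ 3) -
      u * v * (u ^ 2 - v ^ 2) ^ 2 ≠ 0 := by
    have := aeval_ne_zero h (((X 0 ^ 2 - X 0 * X 1 + X 1 ^ 2) * X 1 - X 0) *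
      (X 0 ^ 3 - (X 0 ^ 2 - X 0 * X 1 + X 1 ^ 2) * X 1 ^ 3) -
      X 0 * X 1 * (X 0 ^ 2 - X 1 ^ 2) ^ 2) 1 0 (by simp)
    simpa using this
  have hσW : σ (u ^ 2 - u * v + v ^ 2) = (u ^ 2 - u * v + v ^ 2)⁻¹ := by
    simp only [map_add, map_sub, map_mul, map_pow, hu, hv]
    have key : ∀ W : K, W ≠ 0 → W = u ^ 2 - u * v + v ^ 2 →
        (v / W) ^ 2 - v / W * (u / W) + (u / W) ^ 2 = W⁻¹ := by
      intro W hW hWd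
      field_simp
      linear_combination -hWd
    exact key _ hW rfl
  obtain ⟨W, hWd⟩ : ∃ W, W = u ^ 2 - u * v + v ^ 2 := ⟨_, rfl⟩
  rw [← hWd] at hu hv hW hPQ' hσW
  obtain ⟨P, hP⟩ : ∃ P, P = (u ^ 3 - W * v ^ 3) / (u * v * (u ^ 2 - v ^ 2)) := ⟨_, rfl⟩
  obtain ⟨Q, hQ⟩ : ∃ Q, Q = (W * v - u) / (u ^ 2 - v ^ 2) := ⟨_, rfl⟩
  have hvu : v ^ 2 - u ^ 2 ≠ 0 := by
    rw [← neg_sub]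
    exact neg_ne_zero.2 huv
  have hσP : σ P = P := by
    simp only [hP, map_div₀, map_mul, map_sub, map_pow, hu, hv, hσW]
    field_simp
    ring
  have hσQ : σ Q = Q := by
    simp only [hQ, map_div₀, map_mul, map_sub, map_pow, hu, hv, hσW]
    field_simp
    ring
  have hPQ : P * Q - 1 ≠ 0 := by
    rw [hP, hQ, div_mul_div_comm, sub_ne_zero, Ne, div_eq_iff (by positivity), ← sub_eq_zero]
    convert hPQ' using 2
    ring
  have hum := mem_left (k := k) u v
  have hvm' := mem_right (k := k) u v
  have hWm : W ∈ k⟮u, v⟯ :=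
    hWd ▸ add_mem (sub_mem (pow_mem hum 2) (mul_mem hum hvm')) (pow_mem hvm' 2)
  have hdm : u ^ 2 - v ^ 2 ∈ k⟮u, v⟯ := sub_mem (pow_mem hum 2) (pow_mem hvm' 2)
  have hPm : P ∈ k⟮u, v⟯ := hP ▸ div_mem (sub_mem (pow_mem hum 3) (mul_mem hWm (pow_mem hvm' 3)))
    (mul_mem (mul_mem hum hvm') hdm)
  have hQm : Q ∈ k⟮u, v⟯ := hQ ▸ div_mem (sub_mem (mul_mem hWm hvm') hum) hdm
  have hvP : v⁻¹ = P + Q / (u / v) := by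
    rw [hP, hQ]
    field_simp
    ring
  have hs : (u / v + v / u) * (P * Q - 1) = - (1 + P ^ 2 + Q ^ 2) := by
    rw [hP, hQ]
    field_simp
    rw [hWd]
    ring
  obtain ⟨h1, h2, h3⟩ := mem_triple (k := k) P Q (u / v)
  have hvm : v ∈ k⟮P, Q, u / v⟯ := by
    have := inv_mem (add_mem h1 (div_mem h2 h3))
    rwa [← hvP, inv_inv] at this
  refine ⟨P, Q, .of_quadratic (w := u / v) (α := - (1 + P ^ 2 + Q ^ 2) / (P * Q - 1)) (β := -1)
    hσP hσQ hPm hQm ?_ ?_ ?_ (neg_mem (one_mem _)) ?_ hvm⟩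
  · rw [map_div₀, hu, hv]
    intro hw
    apply huv
    field_simp at hw
    linear_combination -hw
  · rw [← hs, mul_div_cancel_right₀ _ hPQ]
    field_simp
    ring
  · exact div_mem (neg_mem (add_mem (add_mem (one_mem _) (pow_mem (mem_left _ _) 2))
      (pow_mem (mem_right _ _) 2))) (sub_mem (mul_mem (mem_left _ _) (mem_right _ _)) (one_mem _))
  · have := mul_mem h3 hvm
    rwa [div_mul_cancel₀ _ hv0] at this

/-! ### Cyclic permutation of three monomials -/

/-- The first coordinate of the cyclic invariants of `k(x, y, z)`, `xyz ∈ k`;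
`cyclicU y x z` is the second. -/
def cyclicU (x y z : K) : K :=
  (x ^ 2 * y + y ^ 2 * z + z ^ 2 * x - 3 * (x * y * z)) /
    (x ^ 2 + y ^ 2 + z ^ 2 - x * y - y * z - z * x)

lemma cyclicU_mem {E : IntermediateField k K} {x y z : K} (hx : x ∈ E) (hy : y ∈ E) (hz : z ∈ E) :
    cyclicU x y z ∈ E := by
  have h3 : (3 : K) ∈ E := ofNat_mem E 3
  have hxy := mul_mem hx hy
  exact div_mem (sub_mem (add_mem (add_mem (mul_mem (pow_mem hx 2) hy) (mul_mem (pow_mem hy 2) hz))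
    (mul_mem (pow_mem hz 2) hx)) (mul_mem h3 (mul_mem hxy hz)))
    (sub_mem (sub_mem (sub_mem (add_mem (add_mem (pow_mem hx 2) (pow_mem hy 2)) (pow_mem hz 2)) hxy)
      (mul_mem hy hz)) (mul_mem hz hx))

lemma cyclicU_den_comm (x y z : K) : y ^ 2 + x ^ 2 + z ^ 2 - y * x - x * z - z * y =
    x ^ 2 + y ^ 2 + z ^ 2 - x * y - y * z - z * x := by ring

lemma cyclicU_rotate (x y z : K) : cyclicU y z x = cyclicU x y z := by
  unfold cyclicU
  congr 1 <;> ring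

lemma cyclic_sum {x y z : K} (h : x ^ 2 + y ^ 2 + z ^ 2 - x * y - y * z - z * x ≠ 0) :
    (x + y + z) * (cyclicU x y z * cyclicU y x z) =
      x * y * z + cyclicU x y z ^ 3 + cyclicU y x z ^ 3 := by
  unfold cyclicU
  rw [cyclicU_den_comm x y z]
  obtain ⟨D, hD⟩ : ∃ D, D = x ^ 2 + y ^ 2 + z ^ 2 - x * y - y * z - z * x := ⟨_, rfl⟩
  rw [← hD] at h ⊢
  field_simp
  rw [hD]
  ring

lemma cyclic_pairs {x y z : K} (h : x ^ 2 + y ^ 2 + z ^ 2 - x * y - y * z - z * x ≠ 0) :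
    x * y + y * z + z * x = (cyclicU x y z + cyclicU y x z) * (x + y + z) -
      3 * (cyclicU x y z ^ 2 - cyclicU x y z * cyclicU y x z + cyclicU y x z ^ 2) := by
  unfold cyclicU
  rw [cyclicU_den_comm x y z]
  obtain ⟨D, hD⟩ : ∃ D, D = x ^ 2 + y ^ 2 + z ^ 2 - x * y - y * z - z * x := ⟨_, rfl⟩
  rw [← hD] at h ⊢
  field_simp
  rw [hD]
  ring

lemma cyclicU_norm {x y z : K} (h : x ^ 2 + y ^ 2 + z ^ 2 - x * y - y * z - z * x ≠ 0) :
    cyclicU x y z ^ 2 - cyclicU x y z * cyclicU y x z + cyclicU y x z ^ 2 =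
      ((x * y + y * z + z * x) ^ 2 - 3 * (x * y * z) * (x + y + z)) /
        (x ^ 2 + y ^ 2 + z ^ 2 - x * y - y * z - z * x) := by
  unfold cyclicU
  rw [cyclicU_den_comm x y z]
  obtain ⟨D, hD⟩ : ∃ D, D = x ^ 2 + y ^ 2 + z ^ 2 - x * y - y * z - z * x := ⟨_, rfl⟩
  rw [← hD] at h ⊢
  field_simp
  rw [hD]
  ring

section Cyclic

variable {x y : K} {c : k}

lemma cyclic_ne_zero (h : AlgebraicIndependent k ![x, y]) (hc : c ≠ 0) {z : K}
    (hz : z = algebraMap k K c / (x * y)) :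
    x ^ 2 + y ^ 2 + z ^ 2 - x * y - y * z - z * x ≠ 0 ∧ cyclicU x y z ≠ 0 ∧ cyclicU y x z ≠ 0 ∧
      (x * y + y * z + z * x) ^ 2 - 3 * (x * y * z) * (x + y + z) ≠ 0 := by
  have hx0 := left_ne_zero h
  have hy0 := right_ne_zero h
  have hxy := mul_ne_zero hx0 hy0
  have hD : x ^ 2 + y ^ 2 + z ^ 2 - x * y - y * z - z * x ≠ 0 := by
    have := aeval_ne_zero h (X 0 ^ 4 * X 1 ^ 2 + X 0 ^ 2 * X 1 ^ 4 + C c ^ 2 - X 0 ^ 3 * X 1 ^ 3 -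
      C c * X 0 * X 1 ^ 2 - C c * X 0 ^ 2 * X 1) 0 0 (by simp [hc])
    rw [← mul_ne_zero_iff_right (pow_ne_zero 2 hxy)]
    convert this using 1
    simp only [hz, map_add, map_sub, map_mul, map_pow, aeval_X, aeval_C, Matrix.cons_val_zero,
      Matrix.cons_val_one]
    field_simp
  refine ⟨hD, div_ne_zero ?_ hD, div_ne_zero ?_ (by rwa [cyclicU_den_comm]), ?_⟩
  · have := aeval_ne_zero h (X 0 ^ 3 * X 1 ^ 3 + C c * X 1 ^ 3 + C c ^ 2 -
      3 * C c * X 0 * X 1 ^ 2) 0 0 (by simp [hc])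
    rw [← mul_ne_zero_iff_right (mul_ne_zero hx0 (pow_ne_zero 2 hy0))]
    convert this using 1
    simp only [hz, map_add, map_sub, map_mul, map_pow, aeval_X, aeval_C, Matrix.cons_val_zero,
      Matrix.cons_val_one, map_ofNat]
    field_simp
  · have := aeval_ne_zero h (X 0 ^ 3 * X 1 ^ 3 + C c * X 0 ^ 3 + C c ^ 2 -
      3 * C c * X 1 * X 0 ^ 2) 0 0 (by simp [hc])
    rw [← mul_ne_zero_iff_right (mul_ne_zero hy0 (pow_ne_zero 2 hx0))]
    convert this using 1
    simp only [hz, map_add, map_sub, map_mul, map_pow, aeval_X, aeval_C, Matrix.cons_val_zero,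
      Matrix.cons_val_one, map_ofNat]
    field_simp
  · have := aeval_ne_zero h ((X 0 ^ 2 * X 1 ^ 2 + C c * X 1 + C c * X 0) ^ 2 * 1 -
      3 * C c * X 0 * X 1 * (X 0 ^ 2 * X 1 + X 0 * X 1 ^ 2 + C c)) 1 0 (by simp [hc])
    rw [← mul_ne_zero_iff_right (pow_ne_zero 2 hxy)]
    convert this using 1
    simp only [hz, map_add, map_sub, map_mul, map_pow, aeval_X, aeval_C, Matrix.cons_val_zero,
      Matrix.cons_val_one, map_ofNat, map_one]
    field_simp

lemma cyclic_cubic {z s t e : K} (hs : s = x + y + z) (ht : t = x * y + y * z + z * x)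
    (he : e = x * y * z) : x ^ 3 = s * x ^ 2 + (-t) * x + e := by
  rw [hs, ht, he]
  ring

lemma cyclic_mem (h : AlgebraicIndependent k ![x, y]) (hc : c ≠ 0) {z : K}
    (hz : z = algebraMap k K c / (x * y)) (E : IntermediateField k K) (hu : cyclicU x y z ∈ E)
    (hv : cyclicU y x z ∈ E) : x + y + z ∈ E ∧ x * y + y * z + z * x ∈ E ∧ (x ∈ E → y ∈ E) := by
  obtain ⟨hD, hu0, hv0, -⟩ := cyclic_ne_zero h hc hz
  have hx0 := left_ne_zero h
  have hy0 := right_ne_zero h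
  have hxyz : x * y * z = algebraMap k K c := by
    rw [hz]
    field_simp
  have hcm : algebraMap k K c ∈ E := E.algebraMap_mem c
  have h3m : (3 : K) ∈ E := ofNat_mem E 3
  have h1 : x + y + z ∈ E := by
    rw [← mul_div_cancel_right₀ (x + y + z) (mul_ne_zero hu0 hv0), cyclic_sum hD, hxyz]
    exact div_mem (add_mem (add_mem hcm (pow_mem hu 3)) (pow_mem hv 3)) (mul_mem hu hv)
  have h2 : x * y + y * z + z * x ∈ E := by
    rw [cyclic_pairs hD]
    exact sub_mem (mul_mem (add_mem hu hv) h1) (mul_mem h3m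
      (add_mem (sub_mem (pow_mem hu 2) (mul_mem hu hv)) (pow_mem hv 2)))
  refine ⟨h1, h2, fun hx => ?_⟩
  have hne : (x - y) * (x - z) ≠ 0 := by
    have := aeval_ne_zero h ((X 0 - X 1) * (X 0 ^ 2 * X 1 - C c)) 1 0 (by simp [hc])
    rw [← mul_ne_zero_iff_right (mul_ne_zero hx0 hy0)]
    convert this using 1
    simp only [hz, map_sub, map_mul, map_pow, aeval_X, aeval_C, Matrix.cons_val_zero,
      Matrix.cons_val_one]
    field_simp
  have hDm : x ^ 2 + y ^ 2 + z ^ 2 - x * y - y * z - z * x ∈ E := by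
    rw [show x ^ 2 + y ^ 2 + z ^ 2 - x * y - y * z - z * x =
      (x + y + z) ^ 2 - 3 * (x * y + y * z + z * x) by ring]
    exact sub_mem (pow_mem h1 2) (mul_mem h3m h2)
  have hN : x ^ 2 * y + y ^ 2 * z + z ^ 2 * x ∈ E := by
    have : x ^ 2 * y + y ^ 2 * z + z ^ 2 * x = cyclicU x y z *
        (x ^ 2 + y ^ 2 + z ^ 2 - x * y - y * z - z * x) + 3 * algebraMap k K c := by
      rw [← hxyz, cyclicU, div_mul_cancel₀ _ hD]
      ring
    rw [this]
    exact add_mem (mul_mem hu hDm) (mul_mem h3m hcm)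
  have hS : y + z ∈ E := by
    rw [show y + z = (x + y + z) - x by ring]
    exact sub_mem h1 hx
  have hP : y * z ∈ E := by
    rw [show y * z = (x * y * z) / x by field_simp, hxyz]
    exact div_mem hcm hx
  have hM : (x - y) * (x - z) ∈ E := by
    rw [show (x - y) * (x - z) = x ^ 2 - x * (y + z) + y * z by ring]
    exact add_mem (sub_mem (pow_mem hx 2) (mul_mem hx hS)) hP
  have hy : y = ((x ^ 2 * y + y ^ 2 * z + z ^ 2 * x) - x * ((y + z) ^ 2 - y * z)) /
      ((x - y) * (x - z)) := by
    rw [eq_div_iff hne]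
    ring
  rw [hy]
  exact div_mem (sub_mem hN (mul_mem hx (sub_mem (pow_mem hS 2) hP))) hM

lemma descends_cyclic {σ : K ≃ₐ[k] K} {z : K} (h : AlgebraicIndependent k ![x, y]) (hc : c ≠ 0)
    (hz : z = algebraMap k K c / (x * y)) (hx : σ x = y) (hy : σ y = z) :
    Descends {σ} x y (cyclicU x y z) (cyclicU y x z) := by
  have hx0 := left_ne_zero h
  have hy0 := right_ne_zero h
  have hσz : σ z = x := by
    rw [hz] at hy ⊢
    rw [map_div₀, map_mul, hx, hy, σ.commutes]
    have : algebraMap k K c ≠ 0 := by simpa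
    field_simp
  have hxyz : x * y * z = algebraMap k K c := by
    rw [hz]
    field_simp
  have hσu : σ (cyclicU x y z) = cyclicU x y z := by
    rw [← cyclicU_rotate x y z]
    simp only [cyclicU, map_div₀, map_add, map_sub, map_mul, map_pow, map_ofNat, hx, hy, hσz]
    congr 1 <;> ring
  have hσv : σ (cyclicU y x z) = cyclicU y x z := by
    rw [← cyclicU_rotate y x z]
    simp only [cyclicU, map_div₀, map_add, map_sub, map_mul, map_pow, map_ofNat, hx, hy, hσz]
    congr 1 <;> ring
  have hxy : y ≠ x := by
    have := aeval_ne_zero h (X 1 - X 0) 1 0 (by simp)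
    rw [← sub_ne_zero]
    simpa using this
  have hxz : z ≠ x := by
    have := aeval_ne_zero h (C c - X 0 ^ 2 * X 1) 0 0 (by simp [hc])
    intro hzx
    apply this
    simp only [map_sub, map_mul, map_pow, aeval_X, aeval_C, Matrix.cons_val_zero,
      Matrix.cons_val_one, ← hxyz, hzx]
    ring
  obtain ⟨h1, h2, -⟩ := cyclic_mem h hc hz k⟮cyclicU x y z, cyclicU y x z⟯ (mem_left _ _)
    (mem_right _ _)
  obtain ⟨m1, m2, m3⟩ := mem_triple (k := k) (cyclicU x y z) (cyclicU y x z) x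
  have hle := adjoin_pair_le m3 ((cyclic_mem h hc hz _ m1 m2).2.2 m3)
  have hzm : z ∈ k⟮x, y⟯ := hz ▸ div_mem (IntermediateField.algebraMap_mem _ c)
    (mul_mem (mem_left _ _) (mem_right _ _))
  exact .of_single hσu hσv (cyclicU_mem (mem_left _ _) (mem_right _ _) hzm)
    (cyclicU_mem (mem_right _ _) (mem_left _ _) hzm) fun f hf hσf =>
    mem_of_cubic hσu hσv (w := x) (by rwa [hx]) (by rwa [hx, hy])
    h1 (neg_mem h2) (IntermediateField.algebraMap_mem _ c) (cyclic_cubic rfl rfl hxyz.symm)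
    (hle hf) hσf

lemma isAlgebraic_of_cubic {E : IntermediateField k K} {w α β γ : K} (hα : α ∈ E) (hβ : β ∈ E)
    (hγ : γ ∈ E) (hq : w ^ 3 = α * w ^ 2 + β * w + γ) : IsAlgebraic E w := by
  let p : Polynomial E := Polynomial.X ^ 3 + (- Polynomial.C ⟨α, hα⟩ * Polynomial.X ^ 2
    - Polynomial.C ⟨β, hβ⟩ * Polynomial.X - Polynomial.C ⟨γ, hγ⟩)
  have hp : p.Monic := by unfold p; monicity!
  refine ⟨p, hp.ne_zero, ?_⟩
  have h1 : algebraMap E K ⟨α, hα⟩ = α := rfl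
  have h2 : algebraMap E K ⟨β, hβ⟩ = β := rfl
  have h3 : algebraMap E K ⟨γ, hγ⟩ = γ := rfl
  simp only [p, map_add, map_sub, map_mul, map_neg, map_pow, Polynomial.aeval_X,
    Polynomial.aeval_C, h1, h2, h3]
  linear_combination hq

lemma isTranscendenceBasis_cyclic {z : K} (h : IsTranscendenceBasis k ![x, y]) (hc : c ≠ 0)
    (hz : z = algebraMap k K c / (x * y)) :
    IsTranscendenceBasis k ![cyclicU x y z, cyclicU y x z] := by
  have hx0 := left_ne_zero h.1
  have hy0 := right_ne_zero h.1
  have hxyz : x * y * z = algebraMap k K c := by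
    rw [hz]
    field_simp
  obtain ⟨h1, h2, -⟩ := cyclic_mem h.1 hc hz k⟮cyclicU x y z, cyclicU y x z⟯ (mem_left _ _)
    (mem_right _ _)
  have hcm := IntermediateField.algebraMap_mem k⟮cyclicU x y z, cyclicU y x z⟯ c
  refine isTranscendenceBasis_of_isAlgebraic h
    (isAlgebraic_of_cubic h1 (neg_mem h2) hcm (cyclic_cubic rfl rfl hxyz.symm))
    (isAlgebraic_of_cubic h1 (neg_mem h2) hcm ?_)
  rw [← hxyz]
  ring

end Cyclic

/-! ### Integer matrices of finite order -/

section Matrices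

open Matrix

variable {M B : Matrix (Fin 2) (Fin 2) ℤ} {n : ℕ}

lemma sq_fin_two (M : Matrix (Fin 2) (Fin 2) ℤ) : M ^ 2 = M.trace • M - M.det • 1 := by
  ext i j
  rw [sq, mul_apply, Fin.sum_univ_two, det_fin_two, trace_fin_two, Matrix.sub_apply,
    Matrix.smul_apply, Matrix.smul_apply]
  fin_cases i <;> fin_cases j <;> simp <;> ring

lemma trace_le_two_of_pow_eq_one (hn : n ≠ 0) (h : M ^ n = 1) (hd : M.det = 1) :
    M.trace ≤ 2 := by
  by_contra! ht
  have key : ∀ m : ℕ, 2 ≤ (M ^ m).trace ∧ (M ^ m).trace < (M ^ (m + 1)).trace := by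
    intro m
    induction m with
    | zero => simpa using ht
    | succ m ih =>
      refine ⟨ih.1.trans ih.2.le, ?_⟩
      have : (M ^ (m + 1 + 1)).trace = M.trace * (M ^ (m + 1)).trace - (M ^ m).trace := by
        rw [show m + 1 + 1 = m + 2 by ring, pow_add, sq_fin_two, hd, mul_sub, pow_succ,
          trace_sub, Matrix.mul_smul, trace_smul, Matrix.mul_smul, trace_smul, mul_one,
          ← pow_succ]
        simp
      rw [this]
      nlinarith [ih.1, ih.2]
  obtain ⟨m, rfl⟩ := Nat.exists_eq_succ_of_ne_zero hn
  have := key m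
  rw [h] at this
  simp at this
  omega

lemma eq_one_of_trace_eq_two (hn : n ≠ 0) (h : M ^ n = 1) (hd : M.det = 1) (ht : M.trace = 2) :
    M = 1 := by
  have hN : (M - 1) * (M - 1) = 0 := by
    have := sq_fin_two M
    rw [hd, ht] at this
    rw [show (M - 1) * (M - 1) = M ^ 2 - (2 : ℤ) • M + (1 : ℤ) • 1 by noncomm_ring, this]
    abel
  have key : ∀ m : ℕ, M ^ m = 1 + m • (M - 1) := by
    intro m
    induction m with
    | zero => simp
    | succ m ih =>
      have hM : M = 1 + (M - 1) := by abel
      rw [pow_succ, ih]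
      conv_lhs => rw [hM]
      rw [add_sub_cancel_left, add_mul, mul_add, smul_mul_assoc, mul_add, hN, add_smul]
      simp
      abel
  have h1 := key n
  rw [h, left_eq_add] at h1
  ext i j
  have h2 := congrFun (congrFun h1 i) j
  rw [Matrix.smul_apply, Matrix.zero_apply, Matrix.sub_apply, smul_eq_zero, sub_eq_zero] at h2
  exact h2.resolve_left hn

lemma neg_pow_two_mul (h : M ^ n = 1) : (-M) ^ (2 * n) = 1 := by
  rw [pow_mul, neg_sq, ← pow_mul, mul_comm, pow_mul, h, one_pow]

lemma det_neg_fin_two (M : Matrix (Fin 2) (Fin 2) ℤ) : (-M).det = M.det := by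
  simp [det_neg]

lemma abs_trace_le_two (hn : n ≠ 0) (h : M ^ n = 1) (hd : M.det = 1) :
    |M.trace| ≤ 2 := by
  rw [abs_le]
  have := trace_le_two_of_pow_eq_one (mul_ne_zero two_ne_zero hn) (neg_pow_two_mul h)
    (by rwa [det_neg_fin_two])
  rw [trace_neg] at this
  exact ⟨by omega, trace_le_two_of_pow_eq_one hn h hd⟩

lemma eq_neg_one_of_trace_eq_neg_two (hn : n ≠ 0) (h : M ^ n = 1) (hd : M.det = 1)
    (ht : M.trace = -2) : M = -1 := by
  have := eq_one_of_trace_eq_two (mul_ne_zero two_ne_zero hn) (neg_pow_two_mul h)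
    (by rwa [det_neg_fin_two]) (by rw [trace_neg, ht]; rfl)
  rw [← this, neg_neg]

lemma det_eq_one_or (hn : n ≠ 0) (h : M ^ n = 1) : M.det = 1 ∨ M.det = -1 := by
  have : M.det ^ n = 1 := by rw [← det_pow, h, det_one]
  exact Int.isUnit_iff.1 (IsUnit.of_pow_eq_one this hn)

lemma trace_eq_zero_of_det (hn : n ≠ 0) (h : M ^ n = 1) (hd : M.det = -1) : M.trace = 0 := by
  have h2 : (M ^ 2) ^ n = 1 := by rw [← pow_mul, mul_comm, pow_mul, h, one_pow]
  have := trace_le_two_of_pow_eq_one hn h2 (by rw [det_pow, hd]; rfl)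
  rw [sq_fin_two, hd, trace_sub, trace_smul, trace_smul] at this
  simp at this
  nlinarith

/-- Rotations of finite order have one of five traces. -/
lemma trace_cases (hn : n ≠ 0) (h : M ^ n = 1) (hd : M.det = 1) :
    M = 1 ∨ M = -1 ∨ M.trace = 0 ∨ M.trace = 1 ∨ M.trace = -1 := by
  have h1 := abs_le.1 (abs_trace_le_two hn h hd)
  by_cases h2 : M.trace = 2
  · exact .inl (eq_one_of_trace_eq_two hn h hd h2)
  by_cases h3 : M.trace = -2
  · exact .inr (.inl (eq_neg_one_of_trace_eq_neg_two hn h hd h3))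
  omega

/-- Integral binary quadratic forms of discriminant `-3` or `-4` represent `±1`. -/
lemma exists_quadratic_form_eq (A B C : ℤ) (h : B ^ 2 - 4 * A * C = -3 ∨ B ^ 2 - 4 * A * C = -4) :
    ∃ α β : ℤ, A * α ^ 2 + B * α * β + C * β ^ 2 = 1 ∨ A * α ^ 2 + B * α * β + C * β ^ 2 = -1 := by
  induction hm : A.natAbs using Nat.strong_induction_on generalizing A B C with
  | _ m ih =>
    subst hm
    have hA : A ≠ 0 := by
      rintro rfl
      rcases h with h | h <;> nlinarith
    obtain ⟨s, hs⟩ : ∃ s : ℤ, |B + 2 * A * s| ≤ |A| := by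
      refine ⟨-((B + |A|) / (2 * |A|)) * A.sign, ?_⟩
      have hpos := abs_pos.2 hA
      have h1 : 2 * A * (-((B + |A|) / (2 * |A|)) * A.sign) =
          -(2 * |A| * ((B + |A|) / (2 * |A|))) := by
        rw [← Int.sign_mul_self_eq_abs]
        ring
      rw [h1, abs_le]
      have h2 := Int.emod_add_mul_ediv (B + |A|) (2 * |A|)
      have h3 := Int.emod_nonneg (B + |A|) (b := 2 * |A|) (by omega)
      have h4 := Int.emod_lt_of_pos (B + |A|) (b := 2 * |A|) (by omega)
      constructor <;> linarith
    obtain ⟨B', hB'⟩ : ∃ B', B' = B + 2 * A * s := ⟨_, rfl⟩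
    obtain ⟨C', hC'⟩ : ∃ C', C' = A * s ^ 2 + B * s + C := ⟨_, rfl⟩
    have hdisc : B' ^ 2 - 4 * A * C' = B ^ 2 - 4 * A * C := by
      rw [hB', hC']
      ring
    rw [← hB'] at hs
    by_cases hlt : C'.natAbs < A.natAbs
    · obtain ⟨α, β, hαβ⟩ := ih _ hlt C' (-B') A (by
        rw [neg_sq, show (4 * C' * A) = 4 * A * C' by ring, hdisc]
        exact h) rfl
      refine ⟨-β + s * α, α, ?_⟩
      have : A * (-β + s * α) ^ 2 + B * (-β + s * α) * α + C * α ^ 2 =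
        C' * α ^ 2 + -B' * α * β + A * β ^ 2 := by
        rw [hB', hC']
        ring
      rwa [this]
    · have h1 : |A| ≤ |C'| := by
        rw [Int.abs_eq_natAbs, Int.abs_eq_natAbs]
        exact_mod_cast not_lt.1 hlt
      have h2 : B' ^ 2 ≤ A ^ 2 := sq_le_sq.2 hs
      have h3 : A ^ 2 ≤ |A * C'| := by
        rw [abs_mul, ← sq_abs, sq]
        exact mul_le_mul_of_nonneg_left h1 (abs_nonneg _)
      have h4 : 0 ≤ A * C' := by
        rcases h with h | h <;> nlinarith [sq_nonneg B']
      rw [abs_of_nonneg h4] at h3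
      have h5 : A ^ 2 ≤ 1 := by
        rcases h with h | h <;> nlinarith
      have h6 : A ^ 2 = 1 := le_antisymm h5 (by have := sq_pos_of_ne_zero hA; omega)
      refine ⟨1, 0, ?_⟩
      simpa using _root_.sq_eq_one_iff.1 h6

/-- A rotation of trace `0` or `±1` has a cyclic vector. -/
lemma exists_det_cyclic (hd : M.det = 1) (ht : M.trace = 0 ∨ M.trace = 1 ∨ M.trace = -1) :
    ∃ α β : ℤ, IsUnit (α * (M 1 0 * α + M 1 1 * β) - β * (M 0 0 * α + M 0 1 * β)) := by
  rw [det_fin_two] at hd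
  rw [trace_fin_two] at ht
  obtain ⟨α, β, h⟩ := exists_quadratic_form_eq (M 1 0) (M 1 1 - M 0 0) (- M 0 1) (by
    have : (M 1 1 - M 0 0) ^ 2 - 4 * M 1 0 * - M 0 1 =
      (M 0 0 + M 1 1) ^ 2 - 4 * (M 0 0 * M 1 1 - M 0 1 * M 1 0) := by ring
    rw [this, hd]
    rcases ht with h | h | h <;> rw [h] <;> norm_num)
  refine ⟨α, β, Int.isUnit_iff.2 ?_⟩
  have : α * (M 1 0 * α + M 1 1 * β) - β * (M 0 0 * α + M 0 1 * β) =
    M 1 0 * α ^ 2 + (M 1 1 - M 0 0) * α * β + - M 0 1 * β ^ 2 := by ring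
  rwa [this]

/-- A reflection fixes a primitive vector. -/
lemma exists_fixed_vector (hd : M.det = -1) (ht : M.trace = 0) : ∃ α β : ℤ, IsCoprime α β ∧
    M 0 0 * α + M 0 1 * β = α ∧ M 1 0 * α + M 1 1 * β = β := by
  rw [det_fin_two] at hd
  rw [trace_fin_two] at ht
  obtain ⟨α, β, h0, h1, h2⟩ : ∃ α β : ℤ, (α ≠ 0 ∨ β ≠ 0) ∧
      M 0 0 * α + M 0 1 * β = α ∧ M 1 0 * α + M 1 1 * β = β := by
    have h11 : M 1 1 = - M 0 0 := by omega
    rw [h11] at hd ⊢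
    by_cases h : M 0 0 = -1
    · refine ⟨M 0 1, 1 - M 0 0, .inr (by omega), by ring, by linear_combination -hd⟩
    · refine ⟨1 + M 0 0, M 1 0, .inl (by omega), by linear_combination -hd, by ring⟩
  have hg : (0 : ℤ) < Int.gcd α β := by
    have := Int.gcd_pos_iff.2 h0
    exact_mod_cast this
  obtain ⟨α', hα⟩ := Int.gcd_dvd_left α β
  obtain ⟨β', hβ⟩ := Int.gcd_dvd_right α β
  refine ⟨α', β', ?_, ?_, ?_⟩
  · have := Int.gcd_eq_gcd_ab α β
    refine ⟨Int.gcdA α β, Int.gcdB α β, ?_⟩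
    apply mul_left_cancel₀ hg.ne'
    linear_combination -this - Int.gcdA α β * hα - Int.gcdB α β * hβ
  · apply mul_left_cancel₀ hg.ne'
    linear_combination h1 + (1 - M 0 0) * hα - M 0 1 * hβ
  · apply mul_left_cancel₀ hg.ne'
    linear_combination h2 - M 1 0 * hα + (1 - M 1 1) * hβ

end Matrices

/-! ### Monomial actions -/

section Monomial

open Matrix

/-- The Laurent monomial in `x` and `y` with exponent vector `v`. -/
def mono (x y : K) (v : Fin 2 → ℤ) : K := x ^ v 0 * y ^ v 1

variable (k) in
/-- Equality up to a nonzero scalar from `k`. -/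
def Rel (z w : K) : Prop := ∃ c : k, c ≠ 0 ∧ z = algebraMap k K c * w

lemma Rel.refl (z : K) : Rel k z z := ⟨1, one_ne_zero, by simp⟩

lemma Rel.symm {z w : K} : Rel k z w → Rel k w z := by
  rintro ⟨c, hc, rfl⟩
  refine ⟨c⁻¹, inv_ne_zero hc, ?_⟩
  rw [← mul_assoc, ← map_mul, inv_mul_cancel₀ hc, map_one, one_mul]

lemma Rel.trans {z w t : K} : Rel k z w → Rel k w t → Rel k z t := by
  rintro ⟨c, hc, rfl⟩ ⟨d, hd, rfl⟩
  exact ⟨c * d, mul_ne_zero hc hd, by rw [map_mul, mul_assoc]⟩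

lemma Rel.mul {z w z' w' : K} : Rel k z w → Rel k z' w' → Rel k (z * z') (w * w') := by
  rintro ⟨c, hc, rfl⟩ ⟨d, hd, rfl⟩
  exact ⟨c * d, mul_ne_zero hc hd, by rw [map_mul]; ring⟩

lemma Rel.zpow {z w : K} (n : ℤ) : Rel k z w → Rel k (z ^ n) (w ^ n) := by
  rintro ⟨c, hc, rfl⟩
  exact ⟨c ^ n, zpow_ne_zero n hc, by rw [map_zpow₀, mul_zpow]⟩

lemma Rel.map {z w : K} (σ : K ≃ₐ[k] K) : Rel k z w → Rel k (σ z) (σ w) := by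
  rintro ⟨c, hc, rfl⟩
  exact ⟨c, hc, by simp⟩

lemma mono_ne_zero {x y : K} (hx : x ≠ 0) (hy : y ≠ 0) (v : Fin 2 → ℤ) : mono x y v ≠ 0 :=
  mul_ne_zero (zpow_ne_zero _ hx) (zpow_ne_zero _ hy)

lemma mono_add {x y : K} (hx : x ≠ 0) (hy : y ≠ 0) (v w : Fin 2 → ℤ) :
    mono x y (v + w) = mono x y v * mono x y w := by
  simp only [mono, Pi.add_apply, zpow_add₀ hx, zpow_add₀ hy]
  ring

lemma mono_smul (x y : K) (n : ℤ) (v : Fin 2 → ℤ) : mono x y (n • v) = mono x y v ^ n := by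
  simp only [mono, Pi.smul_apply, smul_eq_mul, mul_zpow, ← _root_.zpow_mul, mul_comm n]

lemma mono_mem (x y : K) (v : Fin 2 → ℤ) : mono x y v ∈ k⟮x, y⟯ :=
  mul_mem (zpow_mem (mem_left x y) _) (zpow_mem (mem_right x y) _)

lemma Rel.mem {z w : K} {E : IntermediateField k K} (h : Rel k z w) (hw : w ∈ E) : z ∈ E := by
  obtain ⟨c, -, rfl⟩ := h
  exact mul_mem (E.algebraMap_mem c) hw

@[simp] lemma mono_left (x y : K) : mono x y ![1, 0] = x := by simp [mono]

@[simp] lemma mono_right (x y : K) : mono x y ![0, 1] = y := by simp [mono]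

/-- Monomials in algebraically independent elements are independent up to scalars. -/
lemma eq_of_rel_mono {x y : K} (h : AlgebraicIndependent k ![x, y]) {v w : Fin 2 → ℤ}
    (hr : Rel k (mono x y v) (mono x y w)) : v = w := by
  have hx := left_ne_zero h
  have hy := right_ne_zero h
  obtain ⟨c, hc, he⟩ := hr
  obtain ⟨s, hs⟩ : ∃ s : Fin 2 → ℕ, ∀ i, (s i : ℤ) = v i + (|v i| + |w i|) :=
    ⟨fun i => (v i + (|v i| + |w i|)).toNat, fun i => Int.toNat_of_nonneg (by
      have := neg_abs_le (v i)
      have := abs_nonneg (w i)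
      omega)⟩
  obtain ⟨t, ht⟩ : ∃ t : Fin 2 → ℕ, ∀ i, (t i : ℤ) = w i + (|v i| + |w i|) :=
    ⟨fun i => (w i + (|v i| + |w i|)).toNat, fun i => Int.toNat_of_nonneg (by
      have := neg_abs_le (w i)
      have := abs_nonneg (v i)
      omega)⟩
  have hv : ∀ r : Fin 2 → ℕ, aeval ![x, y] (monomial (Finsupp.equivFunOnFinite.symm r) (1 : k)) =
      mono x y (fun i => (r i : ℤ)) := by
    intro r
    rw [aeval_monomial, Finsupp.prod_fintype _ _ (by simp), Fin.prod_univ_two]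
    simp [mono]
  have key : monomial (Finsupp.equivFunOnFinite.symm s) (1 : k) =
      C c * monomial (Finsupp.equivFunOnFinite.symm t) 1 := by
    apply h
    rw [map_mul, hv, hv, aeval_C]
    have e1 : (fun i => (s i : ℤ)) = v + fun i => |v i| + |w i| := funext hs
    have e2 : (fun i => (t i : ℤ)) = w + fun i => |v i| + |w i| := funext ht
    rw [e1, e2, mono_add hx hy, mono_add hx hy, he, mul_assoc]
  rw [C_mul_monomial, monomial_eq_monomial_iff] at key
  have hst : s = t := Finsupp.equivFunOnFinite.symm.injective (by
    rcases key with h1 | h1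
    · exact h1.1
    · exact absurd h1.1 one_ne_zero)
  funext i
  have h1 := hs i
  have h2 := ht i
  rw [hst] at h1
  omega

/-- The automorphism `σ` acts on monomials in `x` and `y`, up to scalars, through `M`. -/
def Acts (σ : K ≃ₐ[k] K) (x y : K) (M : Matrix (Fin 2) (Fin 2) ℤ) : Prop :=
  ∀ v, Rel k (σ (mono x y v)) (mono x y (M *ᵥ v))

variable {σ τ : K ≃ₐ[k] K} {x y : K} {M N : Matrix (Fin 2) (Fin 2) ℤ}

lemma Acts.of_generators (hx0 : x ≠ 0) (hy0 : y ≠ 0)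
    (hx : Rel k (σ x) (mono x y fun i => M i 0)) (hy : Rel k (σ y) (mono x y fun i => M i 1)) :
    Acts σ x y M := by
  intro v
  have : M *ᵥ v = v 0 • (fun i => M i 0) + v 1 • fun i => M i 1 := by
    funext i
    simp [mulVec, dotProduct, Fin.sum_univ_two, mul_comm]
  rw [this, mono_add hx0 hy0, mono_smul, mono_smul]
  simp only [mono, map_mul, map_zpow₀]
  exact (hx.zpow _).mul (hy.zpow _)

lemma Acts.one : Acts (1 : K ≃ₐ[k] K) x y 1 := fun v => by
  rw [one_mulVec]
  exact Rel.refl _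

lemma Acts.mul (h : Acts σ x y M) (h' : Acts τ x y N) : Acts (σ * τ) x y (M * N) := fun v => by
  rw [← mulVec_mulVec]
  exact ((h' v).map σ).trans (h _)

lemma Acts.pow (h : Acts σ x y M) (n : ℕ) : Acts (σ ^ n) x y (M ^ n) := by
  induction n with
  | zero => simpa using Acts.one
  | succ n ih => simpa [pow_succ] using ih.mul h

lemma Acts.unique (hi : AlgebraicIndependent k ![x, y]) (h : Acts σ x y M) (h' : Acts σ x y N) :
    M = N := by
  have : ∀ v, M *ᵥ v = N *ᵥ v := fun v => eq_of_rel_mono hi ((h v).symm.trans (h' v))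
  exact ext_of_mulVec_single fun i => this _

lemma Acts.left (h : Acts σ x y M) :
    ∃ c : k, c ≠ 0 ∧ σ x = algebraMap k K c * (x ^ M 0 0 * y ^ M 1 0) := by
  obtain ⟨c, hc, h⟩ := h ![1, 0]
  refine ⟨c, hc, ?_⟩
  simpa [mono, mulVec, dotProduct, Fin.sum_univ_two] using h

lemma Acts.right (h : Acts σ x y M) :
    ∃ c : k, c ≠ 0 ∧ σ y = algebraMap k K c * (x ^ M 0 1 * y ^ M 1 1) := by
  obtain ⟨c, hc, h⟩ := h ![0, 1]
  refine ⟨c, hc, ?_⟩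
  simpa [mono, mulVec, dotProduct, Fin.sum_univ_two] using h

/-- A finite group acting monomially on `k(x, y)`, such that only the identity acts diagonally. -/
structure Setup (H : Subgroup (K ≃ₐ[k] K)) (x y : K) : Prop where
  isTranscendenceBasis : IsTranscendenceBasis k ![x, y]
  finite : Finite H
  acts : ∀ h ∈ H, ∃ M, Acts h x y M
  faithful : ∀ h ∈ H, Acts h x y 1 → h x = x ∧ h y = y

variable {H : Subgroup (K ≃ₐ[k] K)} {S : Set (K ≃ₐ[k] K)} {u v : K}

namespace Setup

lemma algebraicIndependent (s : Setup H x y) : AlgebraicIndependent k ![x, y] :=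
  s.isTranscendenceBasis.1

lemma exists_pow_eq_one (s : Setup H x y) (hσ : σ ∈ H) (h : Acts σ x y M) :
    ∃ n ≠ 0, M ^ n = 1 := by
  have := s.finite
  obtain ⟨n, hn, h1⟩ := (isOfFinOrder_of_finite (⟨σ, hσ⟩ : H)).exists_pow_eq_one
  refine ⟨n, hn.ne', (h.pow n).unique s.algebraicIndependent ?_⟩
  have : σ ^ n = 1 := congrArg Subtype.val h1
  rw [this]
  exact Acts.one

lemma agree (s : Setup H x y) (hσ : σ ∈ H) (hτ : τ ∈ H) (h : Acts σ x y M) (h' : Acts τ x y M) :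
    σ x = τ x ∧ σ y = τ y := by
  obtain ⟨N, hN⟩ := s.acts _ (H.inv_mem hτ)
  have h1 : N * M = 1 := by
    have h2 := hN.mul h'
    rw [inv_mul_cancel] at h2
    exact h2.unique s.algebraicIndependent Acts.one
  have h2 := hN.mul h
  rw [h1] at h2
  have h3 := s.faithful _ (H.mul_mem (H.inv_mem hτ) hσ) h2
  constructor
  · have := congrArg τ h3.1
    rwa [← AlgEquiv.mul_apply, mul_inv_cancel_left] at this
  · have := congrArg τ h3.2
    rwa [← AlgEquiv.mul_apply, mul_inv_cancel_left] at this

end Setup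

/-- `w` acts on `k(x, y)` like a product of elements of `S` and their inverses. -/
def IsWord (S : Set (K ≃ₐ[k] K)) (x y : K) (h : K ≃ₐ[k] K) : Prop :=
  ∃ w ∈ Subgroup.closure S, h x = w x ∧ h y = w y

lemma IsWord.of_mul (hτ : τ ∈ Subgroup.closure S) (h : IsWord S x y (τ * σ)) :
    IsWord S x y σ := by
  obtain ⟨w, hw, h1, h2⟩ := h
  refine ⟨τ⁻¹ * w, mul_mem (inv_mem hτ) hw, ?_, ?_⟩
  · rw [AlgEquiv.mul_apply, ← h1, ← AlgEquiv.mul_apply, inv_mul_cancel_left]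
  · rw [AlgEquiv.mul_apply, ← h2, ← AlgEquiv.mul_apply, inv_mul_cancel_left]

lemma Descends.map_mem_closure (h : Descends S x y u v) (hσ : σ ∈ Subgroup.closure S) :
    σ u = u ∧ σ v = v := by
  induction hσ using Subgroup.closure_induction with
  | mem σ hσ => exact ⟨h.map_left σ hσ, h.map_right σ hσ⟩
  | one => exact ⟨rfl, rfl⟩
  | mul σ τ _ _ h1 h2 =>
    rw [AlgEquiv.mul_apply, AlgEquiv.mul_apply, h2.1, h2.2]
    exact h1
  | inv σ _ h1 =>
    constructor
    · conv_lhs => rw [← h1.1]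
      exact σ.symm_apply_apply u
    · conv_lhs => rw [← h1.2]
      exact σ.symm_apply_apply v

lemma map_eq_map_of_mem_adjoin (hx : σ x = τ x) (hy : σ y = τ y) {f : K} (hf : f ∈ k⟮x, y⟯) :
    σ f = τ f := by
  have h1 : (τ⁻¹ * σ) f = f := by
    refine map_eq_self_of_mem_adjoin _ ?_ ?_ hf
    · rw [AlgEquiv.mul_apply, hx]
      exact τ.symm_apply_apply x
    · rw [AlgEquiv.mul_apply, hy]
      exact τ.symm_apply_apply y
  have := congrArg τ h1
  rwa [← AlgEquiv.mul_apply, mul_inv_cancel_left] at this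

/-- Descent along generators gives descent along the whole group. -/
lemma Descends.of_words (h : Descends S x y u v) (hS : S ⊆ H) (hw : ∀ σ ∈ H, IsWord S x y σ) :
    Descends (H : Set (K ≃ₐ[k] K)) x y u v where
  map_left σ hσ := by
    obtain ⟨w, hw, h1, h2⟩ := hw σ hσ
    rw [map_eq_map_of_mem_adjoin h1 h2 h.left_mem]
    exact (h.map_mem_closure hw).1
  map_right σ hσ := by
    obtain ⟨w, hw, h1, h2⟩ := hw σ hσ
    rw [map_eq_map_of_mem_adjoin h1 h2 h.right_mem]
    exact (h.map_mem_closure hw).2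
  left_mem := h.left_mem
  right_mem := h.right_mem
  mem_of_forall f hf hσ := h.mem_of_forall f hf fun σ hS' => hσ σ (hS hS')

/-- An automorphism with the same matrix as a word is a word. -/
lemma Setup.isWord (s : Setup H x y) (hS : S ⊆ H) (hσ : σ ∈ H) (h : Acts σ x y M)
    (hτ : τ ∈ Subgroup.closure S) (h' : Acts τ x y M) : IsWord S x y σ :=
  ⟨τ, hτ, s.agree hσ ((Subgroup.closure_le H).2 hS hτ) h h'⟩

/-- Change of basis. -/
lemma Setup.change (s : Setup H x y) {P Q : Matrix (Fin 2) (Fin 2) ℤ} (hPQ : P * Q = 1)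
    {x' y' : K} (hx : Rel k x' (mono x y fun i => P i 0))
    (hy : Rel k y' (mono x y fun i => P i 1)) :
    Setup H x' y' ∧ k⟮x, y⟯ = k⟮x', y'⟯ ∧
      ∀ (σ : K ≃ₐ[k] K) M, Acts σ x y M → Acts σ x' y' (Q * M * P) := by
  have hQP : Q * P = 1 := mul_eq_one_comm.1 hPQ
  have hx0 := left_ne_zero s.algebraicIndependent
  have hy0 := right_ne_zero s.algebraicIndependent
  have hm : ∀ v, Rel k (mono x' y' v) (mono x y (P *ᵥ v)) := by
    intro v
    have : P *ᵥ v = v 0 • (fun i => P i 0) + v 1 • fun i => P i 1 := by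
      funext i
      simp [mulVec, dotProduct, Fin.sum_univ_two, mul_comm]
    rw [this, mono_add hx0 hy0, mono_smul, mono_smul]
    exact (hx.zpow _).mul (hy.zpow _)
  have hm' : ∀ v, Rel k (mono x y v) (mono x' y' (Q *ᵥ v)) := by
    intro v
    have := (hm (Q *ᵥ v)).symm
    rwa [mulVec_mulVec, hPQ, one_mulVec] at this
  have hacts : ∀ (σ : K ≃ₐ[k] K) M, Acts σ x y M → Acts σ x' y' (Q * M * P) := by
    intro σ M h v
    have h1 := ((hm v).map σ).trans ((h _).trans (hm' _))
    rwa [mulVec_mulVec, mulVec_mulVec] at h1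
  have hE : k⟮x, y⟯ = k⟮x', y'⟯ := by
    apply le_antisymm
    · refine adjoin_pair_le ?_ ?_
      · have := hm' ![1, 0]
        rw [mono_left] at this
        exact this.mem (mono_mem _ _ _)
      · have := hm' ![0, 1]
        rw [mono_right] at this
        exact this.mem (mono_mem _ _ _)
    · exact adjoin_pair_le (hx.mem (mono_mem _ _ _)) (hy.mem (mono_mem _ _ _))
  have hmem : ∀ f ∈ k⟮x, y⟯, IsAlgebraic k⟮x', y'⟯ f := by
    intro f hf
    rw [hE] at hf
    exact isAlgebraic_algebraMap (⟨f, hf⟩ : k⟮x', y'⟯)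
  have htb : IsTranscendenceBasis k ![x', y'] :=
    isTranscendenceBasis_of_isAlgebraic s.isTranscendenceBasis (hmem x (mem_left x y))
      (hmem y (mem_right x y))
  refine ⟨⟨htb, s.finite, fun h hh => ?_, fun h hh h1 => ?_⟩, hE, hacts⟩
  · obtain ⟨M, hM⟩ := s.acts h hh
    exact ⟨_, hacts h M hM⟩
  · obtain ⟨M, hM⟩ := s.acts h hh
    have h2 : Q * M * P = 1 := (hacts h M hM).unique htb.1 h1
    have h3 : M = 1 := by
      calc M = (P * Q) * M * (P * Q) := by rw [hPQ, Matrix.one_mul, Matrix.mul_one]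
        _ = P * (Q * M * P) * Q := by simp only [Matrix.mul_assoc]
        _ = 1 := by rw [h2, Matrix.mul_one, hPQ]
    rw [h3] at hM
    obtain ⟨h4, h5⟩ := s.faithful h hh hM
    constructor
    · exact map_eq_self_of_mem_adjoin h h4 h5 (hx.mem (mono_mem _ _ _))
    · exact map_eq_self_of_mem_adjoin h h4 h5 (hy.mem (mono_mem _ _ _))

end Monomial

/-! ### Groups containing a rotation of order four -/

section OrderFour

open Matrix

variable {S T : Set (K ≃ₐ[k] K)} {H : Subgroup (K ≃ₐ[k] K)} {σ g : K ≃ₐ[k] K} {x y u v : K} {b : k}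

lemma Descends.of_closure (h : Descends S x y u v) (hST : S ⊆ Subgroup.closure T)
    (hTS : T ⊆ Subgroup.closure S) : Descends T x y u v where
  map_left _ hσ := (h.map_mem_closure (hTS hσ)).1
  map_right _ hσ := (h.map_mem_closure (hTS hσ)).2
  left_mem := h.left_mem
  right_mem := h.right_mem
  mem_of_forall f hf hσ := h.mem_of_forall f hf fun τ hτ => by
    have : Subgroup.closure T ≤ MulAction.stabilizer (K ≃ₐ[k] K) f := by
      rw [Subgroup.closure_le]
      exact hσ
    exact this (hST hτ)

lemma adjoin_pair_comm (x y : K) : k⟮x, y⟯ = k⟮y, x⟯ := by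
  rw [Set.pair_comm]

lemma adjoin_pair_neg (x y : K) : k⟮x, -y⟯ = k⟮x, y⟯ :=
  le_antisymm (adjoin_pair_le (mem_left _ _) (neg_mem (mem_right _ _)))
    (adjoin_pair_le (mem_left _ _) (by
      have := neg_mem (mem_right (k := k) x (-y))
      rwa [neg_neg] at this))

lemma Descends.symm (h : Descends S x y u v) : Descends S x y v u where
  map_left := h.map_right
  map_right := h.map_left
  left_mem := h.right_mem
  right_mem := h.left_mem
  mem_of_forall := by
    rw [adjoin_pair_comm v u]
    exact h.mem_of_forall

lemma Descends.neg_right (h : Descends S x y u v) : Descends S x y u (-v) where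
  map_left := h.map_left
  map_right σ hσ := by rw [map_neg, h.map_right σ hσ]
  left_mem := h.left_mem
  right_mem := neg_mem h.right_mem
  mem_of_forall := by
    rw [adjoin_pair_neg]
    exact h.mem_of_forall

/-- The rotation `x ↦ y ↦ b / x`. -/
lemma exists_descends_order_four (h : AlgebraicIndependent k ![x, y]) (hb : b ≠ 0) (hx : σ x = y)
    (hy : σ y = algebraMap k K b / x) : ∃ u v : K, Descends {σ} x y u v := by
  obtain ⟨u, v, huv⟩ := descends_conic_of_order_four h hb hx hy
  have h1 : Descends {σ * σ} x y _ _ := descends_inversion h hb hb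
    (by rw [AlgEquiv.mul_apply, hx, hy])
    (by rw [AlgEquiv.mul_apply, hy, map_div₀, hx, AlgEquiv.commutes])
  refine ⟨u, v, (h1.trans huv).of_closure ?_ ?_⟩
  · rintro τ (rfl | rfl)
    · exact mul_mem (Subgroup.subset_closure rfl) (Subgroup.subset_closure rfl)
    · exact Subgroup.subset_closure rfl
  · rintro τ rfl
    exact Subgroup.subset_closure (.inr rfl)

/-- Two commuting partial inversions. -/
lemma descends_inv_inv {τ τ' : K ≃ₐ[k] K} {a b : k} (h : AlgebraicIndependent k ![x, y])
    (ha : a ≠ 0) (hb : b ≠ 0) (hx : τ x = x) (hy : τ y = algebraMap k K b / y)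
    (hx' : τ' x = algebraMap k K a / x) (hy' : τ' y = y) :
    Descends ({τ} ∪ {τ'}) x y (x + algebraMap k K a / x) (y + algebraMap k K b / y) := by
  have h1 : Descends {τ} x y x (y + algebraMap k K b / y) :=
    descends_inv hx hy (τ.commutes b) (IntermediateField.algebraMap_mem _ b)
      (IntermediateField.algebraMap_mem _ b)
      (by simpa using hb) (right_ne_zero h) (sq_ne_right h hb)
  have h2 : Descends {τ'} (y + algebraMap k K b / y) x (y + algebraMap k K b / y)
      (x + algebraMap k K a / x) :=
    descends_inv (by rw [map_add, map_div₀, hy', AlgEquiv.commutes]) hx' (τ'.commutes a)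
      (IntermediateField.algebraMap_mem _ a) (IntermediateField.algebraMap_mem _ a)
      (by simpa using ha) (left_ne_zero h) (sq_ne_left h ha)
  exact h1.trans (h2.symm.congr (adjoin_pair_comm _ _))

/-- The dihedral group generated by `x ↦ y ↦ b / x` and the swap of `x` and `y`. -/
lemma exists_descends_dihedral_four (h : AlgebraicIndependent k ![x, y]) (hb : b ≠ 0)
    (hx : σ x = y) (hy : σ y = algebraMap k K b / x) (hgx : g x = y) (hgy : g y = x) :
    ∃ u v : K, Descends {σ, g} x y u v := by
  have hx0 := left_ne_zero h
  have hy0 := right_ne_zero h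
  have h1 : Descends ({g * σ} ∪ {σ * g}) x y _ _ := descends_inv_inv h hb hb
    (by rw [AlgEquiv.mul_apply, hx, hgy])
    (by rw [AlgEquiv.mul_apply, hy, map_div₀, AlgEquiv.commutes, hgx])
    (by rw [AlgEquiv.mul_apply, hgx, hy]) (by rw [AlgEquiv.mul_apply, hgy, hx])
  have hne : x + algebraMap k K b / x ≠ y + algebraMap k K b / y := by
    intro h2
    have := aeval_ne_zero h (X 0 * X 0 * X 1 + C b * X 1 - X 0 * X 1 * X 1 - C b * X 0) 0 1
      (by simpa)
    apply this
    field_simp at h2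
    simp
    linear_combination h2
  have h2 := descends_swap (σ := g) (x := x + algebraMap k K b / x) (y := y + algebraMap k K b / y)
    (by rw [map_add, map_div₀, hgx, AlgEquiv.commutes])
    (by rw [map_add, map_div₀, hgy, AlgEquiv.commutes]) hne
  refine ⟨_, _, (h1.trans h2).of_closure ?_ ?_⟩
  · have hσ : σ ∈ Subgroup.closure {σ, g} := Subgroup.subset_closure (.inl rfl)
    have hg : g ∈ Subgroup.closure {σ, g} := Subgroup.subset_closure (.inr rfl)
    rintro τ ((rfl | rfl) | rfl)
    · exact mul_mem hg hσ
    · exact mul_mem hσ hg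
    · exact hg
  · have hg : g ∈ Subgroup.closure ({g * σ} ∪ {σ * g} ∪ {g}) := Subgroup.subset_closure (.inr rfl)
    have hgs : g * σ ∈ Subgroup.closure ({g * σ} ∪ {σ * g} ∪ {g}) :=
      Subgroup.subset_closure (.inl (.inl rfl))
    rintro τ (rfl | rfl)
    · simpa using mul_mem (inv_mem hg) hgs
    · exact hg

/-- The twisted dihedral group generated by `x ↦ y ↦ b / x` and `x ↦ -y`, `y ↦ -x`. -/
lemma exists_descends_dihedral_four_of_neg (h : AlgebraicIndependent k ![x, y]) (hb : b ≠ 0)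
    (h2 : (2 : k) ≠ 0) (hx : σ x = y) (hy : σ y = algebraMap k K b / x) (hgx : g x = -y)
    (hgy : g y = -x) : ∃ u v : K, Descends {σ, g} x y u v := by
  have hx0 := left_ne_zero h
  have hy0 := right_ne_zero h
  have h1 : Descends {σ * σ} x y _ _ := descends_inversion h hb hb
    (by rw [AlgEquiv.mul_apply, hx, hy])
    (by rw [AlgEquiv.mul_apply, hy, map_div₀, hx, AlgEquiv.commutes])
  have h3 := descends_conic_of_two_ne_zero (τ := g * σ) h h2 hb hb
    (by rw [AlgEquiv.mul_apply, hx, hgy])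
    (by rw [AlgEquiv.mul_apply, hy, map_div₀, hgx, AlgEquiv.commutes, div_neg, neg_div])
  have hxb := sub_ne_zero.2 (sq_ne_left h hb)
  have hyb := sub_ne_zero.2 (sq_ne_right h hb)
  obtain ⟨B, hB⟩ : ∃ B, B = algebraMap k K b := ⟨_, rfl⟩
  have hgB : g B = B := by rw [hB, AlgEquiv.commutes]
  rw [← hB] at h1 h3 hxb hyb
  have hne : (x - B / x) * (y + B / y) / (y - B / y) ≠
      -((y - B / y) * (x + B / x) / (x - B / x)) := by
    intro h4
    have h5 : y * (x * x - B) ^ 2 * (y * y + B) + x * (y * y - B) ^ 2 * (x * x + B) = 0 := by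
      have e1 : x - B / x = (x * x - B) / x := by field_simp
      have e2 : y - B / y = (y * y - B) / y := by field_simp
      rw [e1, e2] at h4
      rw [← sq] at hxb hyb e1 e2
      field_simp at h4
      linear_combination h4
    have h6 := algebraicIndependent_iff.1 h (X 1 * (X 0 * X 0 - C b) ^ 2 * (X 1 * X 1 + C b) +
      X 0 * (X 1 * X 1 - C b) ^ 2 * (X 0 * X 0 + C b)) (by simpa [← hB] using h5)
    have h7 := congrArg (aeval ![(0 : Polynomial k), Polynomial.X]) h6
    have h8 := Polynomial.X_pow_add_C_ne_zero (two_pos) b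
    rw [sq] at h8
    simp [Polynomial.algebraMap_eq, hb, h8] at h7
  have h4 := descends_swap (σ := g) (x := (x - B / x) * (y + B / y) / (y - B / y))
    (y := -((y - B / y) * (x + B / x) / (x - B / x)))
    (by
      simp only [map_mul, map_add, map_sub, map_div₀, hgx, hgy, hgB]
      rw [div_neg, div_neg, show -y - -(B / y) = -(y - B / y) by ring,
        show -x - -(B / x) = -(x - B / x) by ring, show -x + -(B / x) = -(x + B / x) by ring,
        div_neg, neg_mul_neg])
    (by
      simp only [map_neg, map_mul, map_add, map_sub, map_div₀, hgx, hgy, hgB]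
      rw [div_neg, div_neg, show -y - -(B / y) = -(y - B / y) by ring,
        show -x - -(B / x) = -(x - B / x) by ring, show -y + -(B / y) = -(y + B / y) by ring,
        div_neg, neg_mul_neg, neg_neg]) hne
  refine ⟨_, _, (h1.trans (h3.neg_right.trans h4)).of_closure ?_ ?_⟩
  · have hσ : σ ∈ Subgroup.closure {σ, g} := Subgroup.subset_closure (.inl rfl)
    have hg : g ∈ Subgroup.closure {σ, g} := Subgroup.subset_closure (.inr rfl)
    rintro τ (rfl | rfl | rfl)
    · exact mul_mem hσ hσ
    · exact mul_mem hg hσ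
    · exact hg
  · have hg : g ∈ Subgroup.closure ({σ * σ} ∪ ({g * σ} ∪ {g})) :=
      Subgroup.subset_closure (.inr (.inr rfl))
    have hgs : g * σ ∈ Subgroup.closure ({σ * σ} ∪ ({g * σ} ∪ {g})) :=
      Subgroup.subset_closure (.inr (.inl rfl))
    rintro τ (rfl | rfl)
    · simpa using mul_mem (inv_mem hg) hgs
    · exact hg

/-- A rotation of order three, four or six takes a standard form in a suitable basis. -/
lemma Setup.exists_cyclic_basis (s : Setup H x y) {M : Matrix (Fin 2) (Fin 2) ℤ}
    (hM : Acts σ x y M) (hd : M.det = 1) (ht : M.trace = 0 ∨ M.trace = 1 ∨ M.trace = -1) :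
    ∃ x' : K, Setup H x' (σ x') ∧ k⟮x, y⟯ = k⟮x', σ x'⟯ ∧
      Acts σ x' (σ x') !![0, -1; 1, M.trace] := by
  obtain ⟨α, β, hu⟩ := exists_det_cyclic hd ht
  set P : Matrix (Fin 2) (Fin 2) ℤ :=
    !![α, M 0 0 * α + M 0 1 * β; β, M 1 0 * α + M 1 1 * β] with hP
  have hdet : IsUnit P.det := by
    rw [hP, det_fin_two_of]
    convert hu using 1
    ring
  have hc : M * P = P * !![0, -1; 1, M.trace] := by
    rw [det_fin_two] at hd
    ext i j
    fin_cases i <;> fin_cases j <;>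
      simp [hP, Matrix.mul_apply, Fin.sum_univ_two, trace_fin_two] <;> grind
  obtain ⟨s', hE, hA⟩ := s.change (P := P) (Q := P⁻¹) (mul_nonsing_inv P hdet)
    (x' := mono x y ![α, β]) (y' := σ (mono x y ![α, β])) (by
      convert Rel.refl (k := k) _ using 2
      funext i
      fin_cases i <;> rfl) (by
      convert hM ![α, β] using 2
      funext i
      fin_cases i <;> simp [hP, mulVec, dotProduct, Fin.sum_univ_two])
  refine ⟨_, s', hE, ?_⟩
  have := hA σ M hM
  rwa [Matrix.mul_assoc, hc, ← Matrix.mul_assoc, nonsing_inv_mul P hdet, Matrix.one_mul] at this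

end OrderFour

section CaseFour

open Matrix

lemma rotation_cases_of_order_four {B : Matrix (Fin 2) (Fin 2) ℤ} {n m : ℕ} (hn : n ≠ 0)
    (h : B ^ n = 1) (hm : m ≠ 0) (h' : (B * !![0, -1; 1, 0]) ^ m = 1) (hd : B.det = 1) :
    ∃ i : ℕ, B = !![0, -1; 1, 0] ^ i := by
  have hd' : (B * !![0, -1; 1, 0]).det = 1 := by rw [det_mul, hd]; simp
  rcases eq_or_ne B.trace 2 with h1 | h1
  · exact ⟨0, eq_one_of_trace_eq_two hn h hd h1⟩
  rcases eq_or_ne B.trace (-2) with h2 | h2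
  · exact ⟨2, by rw [eq_neg_one_of_trace_eq_neg_two hn h hd h2]; decide⟩
  rcases eq_or_ne (B * !![0, -1; 1, 0]).trace 2 with h3 | h3
  · have h5 := eq_one_of_trace_eq_two hm h' hd' h3
    refine ⟨3, ?_⟩
    calc B = B * !![0, -1; 1, 0] * !![0, -1; 1, 0] ^ 3 := by
          rw [Matrix.mul_assoc, show (!![0, -1; 1, 0] * !![0, -1; 1, 0] ^ 3 :
            Matrix (Fin 2) (Fin 2) ℤ) = 1 by decide, Matrix.mul_one]
      _ = _ := by rw [h5, Matrix.one_mul]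
  rcases eq_or_ne (B * !![0, -1; 1, 0]).trace (-2) with h4 | h4
  · have h5 := eq_neg_one_of_trace_eq_neg_two hm h' hd' h4
    refine ⟨1, ?_⟩
    calc B = B * !![0, -1; 1, 0] * !![0, -1; 1, 0] ^ 3 := by
          rw [Matrix.mul_assoc, show (!![0, -1; 1, 0] * !![0, -1; 1, 0] ^ 3 :
            Matrix (Fin 2) (Fin 2) ℤ) = 1 by decide, Matrix.mul_one]
      _ = _ := by rw [h5]; decide
  have ha := abs_le.1 (abs_trace_le_two hn h hd)
  have hb := abs_le.1 (abs_trace_le_two hm h' hd')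
  have e : (B * !![0, -1; 1, 0]).trace = B 0 1 - B 1 0 := by
    simp [trace_fin_two, Matrix.mul_apply, Fin.sum_univ_two, sub_eq_add_neg]
  rw [e] at hb h3 h4
  rw [trace_fin_two] at ha h1 h2
  rw [det_fin_two] at hd
  have h5 : -1 ≤ B 0 0 + B 1 1 ∧ B 0 0 + B 1 1 ≤ 1 := by omega
  have h6 : -1 ≤ B 0 1 - B 1 0 ∧ B 0 1 - B 1 0 ≤ 1 := by omega
  exfalso
  have h7 : (B 0 0 + B 1 1) ^ 2 ≤ 1 := by nlinarith
  have h8 : (B 0 1 - B 1 0) ^ 2 ≤ 1 := by nlinarith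
  have h9 : B 0 0 = 0 ∧ B 1 1 = 0 ∧ B 0 1 = 0 ∧ B 1 0 = 0 := by
    refine ⟨?_, ?_, ?_, ?_⟩ <;>
    · rw [← sq_eq_zero_iff]
      nlinarith [sq_nonneg (B 0 0), sq_nonneg (B 1 1), sq_nonneg (B 0 1), sq_nonneg (B 1 0)]
  simp [h9] at hd

lemma reflection_cases_of_order_four {B : Matrix (Fin 2) (Fin 2) ℤ} {n m : ℕ} (hn : n ≠ 0)
    (h : B ^ n = 1) (hm : m ≠ 0) (h' : (B * !![0, -1; 1, 0]) ^ m = 1) (hd : B.det = -1) :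
    ∃ i : ℕ, B * !![0, -1; 1, 0] ^ i = !![0, 1; 1, 0] := by
  have h1 := trace_eq_zero_of_det hn h hd
  have h2 := trace_eq_zero_of_det hm h' (by rw [det_mul, hd]; simp)
  have e : (B * !![0, -1; 1, 0]).trace = B 0 1 - B 1 0 := by
    simp [trace_fin_two, Matrix.mul_apply, Fin.sum_univ_two, sub_eq_add_neg]
  rw [e] at h2
  rw [trace_fin_two] at h1
  rw [det_fin_two] at hd
  have h3 : B 1 0 = B 0 1 := by omega
  have h4 : B 1 1 = - B 0 0 := by omega
  rw [h3, h4] at hd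
  have hp : -1 ≤ B 0 0 ∧ B 0 0 ≤ 1 := by constructor <;> nlinarith
  have hq : -1 ≤ B 0 1 ∧ B 0 1 ≤ 1 := by constructor <;> nlinarith
  have hB : B = !![B 0 0, B 0 1; B 0 1, - B 0 0] := by
    rw [eta_fin_two B, h3, h4]
    simp
  generalize B 0 0 = p at *
  generalize B 0 1 = q at *
  obtain ⟨hp1, hp2⟩ := hp
  obtain ⟨hq1, hq2⟩ := hq
  subst hB
  clear h h'
  interval_cases p <;> interval_cases q <;> simp at hd
  · exact ⟨1, by decide⟩
  · exact ⟨2, by decide⟩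
  · exact ⟨0, by decide⟩
  · exact ⟨3, by decide⟩

variable {S : Set (K ≃ₐ[k] K)} {H : Subgroup (K ≃ₐ[k] K)} {σ g : K ≃ₐ[k] K} {x y : K}
  {M N : Matrix (Fin 2) (Fin 2) ℤ}

lemma Setup.det_eq_one_or (s : Setup H x y) (hσ : σ ∈ H) (h : Acts σ x y M) :
    M.det = 1 ∨ M.det = -1 := by
  obtain ⟨n, hn, h1⟩ := s.exists_pow_eq_one hσ h
  exact MonomialAction.det_eq_one_or hn h1

lemma Setup.isWord_of_rotations (s : Setup H x y) (hS : S ⊆ H)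
    (hw : ∀ h ∈ H, ∀ M, Acts h x y M → M.det = 1 → IsWord S x y h) (hg : g ∈ S)
    (hN : Acts g x y N) (hd : N.det = -1) : ∀ h ∈ H, IsWord S x y h := by
  intro h hh
  obtain ⟨M, hM⟩ := s.acts h hh
  rcases s.det_eq_one_or hh hM with h1 | h1
  · exact hw h hh M hM h1
  · refine IsWord.of_mul (Subgroup.subset_closure hg) (hw _ (H.mul_mem (hS hg) hh) _ (hN.mul hM) ?_)
    rw [det_mul, hd, h1]
    rfl

lemma Setup.exists_descends_of_standard_four (s : Setup H x y) (hσ : σ ∈ H) (hx : σ x = y)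
    (hM : Acts σ x y !![0, -1; 1, 0]) : ∃ u v : K, Descends (H : Set (K ≃ₐ[k] K)) x y u v := by
  have hi := s.algebraicIndependent
  have hx0 := left_ne_zero hi
  have hy0 := right_ne_zero hi
  obtain ⟨b, hb, hy⟩ := hM.right
  replace hy : σ y = algebraMap k K b / x := by simpa [div_eq_mul_inv] using hy
  have hrot : ∀ S : Set (K ≃ₐ[k] K), S ⊆ H → σ ∈ S →
      ∀ h ∈ H, ∀ M, Acts h x y M → M.det = 1 → IsWord S x y h := by
    intro S hS hσS h hh B hB hd
    obtain ⟨n, hn, h1⟩ := s.exists_pow_eq_one hh hB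
    obtain ⟨m, hm, h2⟩ := s.exists_pow_eq_one (H.mul_mem hh hσ) (hB.mul hM)
    obtain ⟨i, rfl⟩ := rotation_cases_of_order_four hn h1 hm h2 hd
    exact s.isWord hS hh hB (pow_mem (Subgroup.subset_closure hσS) i) (hM.pow i)
  by_cases hg : ∃ g ∈ H, ∃ N, Acts g x y N ∧ N.det = -1
  · obtain ⟨g, hg, hN⟩ : ∃ g ∈ H, Acts g x y !![0, 1; 1, 0] := by
      obtain ⟨g, hg, N, hN, hd⟩ := hg
      obtain ⟨n, hn, h1⟩ := s.exists_pow_eq_one hg hN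
      obtain ⟨m, hm, h2⟩ := s.exists_pow_eq_one (H.mul_mem hg hσ) (hN.mul hM)
      obtain ⟨i, hi⟩ := reflection_cases_of_order_four hn h1 hm h2 hd
      exact ⟨g * σ ^ i, H.mul_mem hg (H.pow_mem hσ i), hi ▸ hN.mul (hM.pow i)⟩
    have hS : ({σ, g} : Set (K ≃ₐ[k] K)) ⊆ H := by
      rintro τ (rfl | rfl) <;> assumption
    have hw := s.isWord_of_rotations hS (hrot _ hS (.inl rfl)) (.inr rfl) hN (by simp)
    obtain ⟨c, hc, hgx⟩ := hN.left
    obtain ⟨d, hd, hgy⟩ := hN.right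
    replace hgx : g x = algebraMap k K c * y := by simpa using hgx
    replace hgy : g y = algebraMap k K d * x := by simpa using hgy
    have h1 := (s.faithful _ (H.mul_mem hg hg) (by
      rw [show (1 : Matrix (Fin 2) (Fin 2) ℤ) = !![0, 1; 1, 0] * !![0, 1; 1, 0] by decide]
      exact hN.mul hN)).1
    have h2 := (s.faithful _ (H.mul_mem (H.mul_mem hg hσ) (H.mul_mem hg hσ)) (by
      rw [show (1 : Matrix (Fin 2) (Fin 2) ℤ) = (!![0, 1; 1, 0] * !![0, -1; 1, 0]) *
        (!![0, 1; 1, 0] * !![0, -1; 1, 0]) by decide]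
      exact (hN.mul hM).mul (hN.mul hM))).1
    simp only [AlgEquiv.mul_apply, map_mul, AlgEquiv.commutes, hgx, hgy, hx] at h1 h2
    rw [← mul_assoc, ← map_mul, mul_eq_right₀ hx0] at h1 h2
    rw [map_eq_one_iff _ (algebraMap k K).injective] at h1 h2
    have hcd : c = d := mul_right_cancel₀ hd (h1.trans h2.symm)
    subst hcd
    rcases mul_self_eq_one_iff.1 h1 with rfl | rfl
    · obtain ⟨u, v, h⟩ := exists_descends_dihedral_four hi hb hx hy (by simpa using hgx)
        (by simpa using hgy)
      exact ⟨u, v, h.of_words hS hw⟩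
    · by_cases h3 : (2 : k) = 0
      · have h4 : (-1 : k) = 1 := by linear_combination -h3
        rw [h4] at hgx hgy
        obtain ⟨u, v, h⟩ := exists_descends_dihedral_four hi hb hx hy (by simpa using hgx)
          (by simpa using hgy)
        exact ⟨u, v, h.of_words hS hw⟩
      · obtain ⟨u, v, h⟩ := exists_descends_dihedral_four_of_neg hi hb h3 hx hy (by simpa using hgx)
          (by simpa using hgy)
        exact ⟨u, v, h.of_words hS hw⟩
  · have hS : ({σ} : Set (K ≃ₐ[k] K)) ⊆ H := by
      rintro τ rfl
      exact hσ
    obtain ⟨u, v, h⟩ := exists_descends_order_four hi hb hx hy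
    refine ⟨u, v, h.of_words hS fun h hh => ?_⟩
    obtain ⟨B, hB⟩ := s.acts h hh
    refine hrot _ hS rfl h hh B hB ((s.det_eq_one_or hh hB).resolve_right fun hd => ?_)
    exact hg ⟨h, hh, B, hB, hd⟩

/-- Descent for groups containing a rotation of order four. -/
lemma Setup.exists_descends_of_trace_eq_zero (s : Setup H x y) (hσ : σ ∈ H) (hM : Acts σ x y M)
    (hd : M.det = 1) (ht : M.trace = 0) :
    ∃ u v : K, Descends (H : Set (K ≃ₐ[k] K)) x y u v := by
  obtain ⟨x', s', hE, hA⟩ := s.exists_cyclic_basis hM hd (.inl ht)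
  rw [ht] at hA
  obtain ⟨u, v, h⟩ := s'.exists_descends_of_standard_four hσ rfl hA
  exact ⟨u, v, h.congr hE⟩

end CaseFour

/-! ### Groups containing a rotation of order three -/

section OrderThree

open Matrix

variable {S : Set (K ≃ₐ[k] K)} {σ g ι : K ≃ₐ[k] K} {x y z u v : K} {c : k}

/-- The group generated by `x ↦ y ↦ z ↦ x` and the swap of `x` and `y`. -/
lemma exists_descends_dihedral_three (h : IsTranscendenceBasis k ![x, y]) (hc : c ≠ 0)
    (hz : z = algebraMap k K c / (x * y)) (hx : σ x = y) (hy : σ y = z) (hgx : g x = y)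
    (hgy : g y = x) : ∃ u v : K, Descends ({σ} ∪ {g}) x y u v := by
  have hgz : g z = z := by
    rw [hz, map_div₀, map_mul, AlgEquiv.commutes, hgx, hgy, mul_comm y]
  have hi := (isTranscendenceBasis_cyclic h hc hz).1
  have h2 := descends_swap (σ := g) (x := cyclicU x y z) (y := cyclicU y x z)
    (by simp only [cyclicU, map_div₀, map_mul, map_add, map_sub, map_pow, hgx, hgy, hgz,
      map_ofNat])
    (by simp only [cyclicU, map_div₀, map_mul, map_add, map_sub, map_pow, hgx, hgy, hgz,
      map_ofNat])
    (by
      have := aeval_ne_zero hi (X 0 - X 1) 1 0 (by simp)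
      rw [← sub_ne_zero]
      simpa using this)
  exact ⟨_, _, (descends_cyclic h.1 hc hz hx hy).trans h2⟩

lemma cyclicU_inv (h : x * y * z = 1)
    (hD : x ^ 2 + y ^ 2 + z ^ 2 - x * y - y * z - z * x ≠ 0) :
    cyclicU x⁻¹ y⁻¹ z⁻¹ = cyclicU y x z /
      (cyclicU x y z ^ 2 - cyclicU x y z * cyclicU y x z + cyclicU y x z ^ 2) := by
  rw [cyclicU_norm hD, h, inv_eq_of_mul_eq_one_right (show x * (y * z) = 1 by rw [← h]; ring),
    inv_eq_of_mul_eq_one_right (show y * (x * z) = 1 by rw [← h]; ring),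
    inv_eq_of_mul_eq_one_right (show z * (x * y) = 1 by rw [← h]; ring)]
  unfold cyclicU
  rw [cyclicU_den_comm x y z, div_div_div_cancel_right₀ hD]
  congr 1
  · linear_combination (x * y ^ 2 + y * z ^ 2 + z * x ^ 2 - 3 * (x * y * z)) * h
  · linear_combination (-3 * (x + y + z)) * h

/-- The group generated by `x ↦ y ↦ z ↦ x` and `x ↦ 1 / y`, `y ↦ 1 / x`. -/
lemma descends_twisted_dihedral_three (h : IsTranscendenceBasis k ![x, y])
    (hz : z = 1 / (x * y)) (hx : σ x = y) (hy : σ y = z) (hgx : g x = y⁻¹)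
    (hgy : g y = x⁻¹) : Descends ({σ} ∪ {g}) x y (cyclicU x y z / cyclicU y x z)
      (cyclicU y x z + cyclicU y x z /
        (cyclicU x y z ^ 2 - cyclicU x y z * cyclicU y x z + cyclicU y x z ^ 2)) := by
  have hz1 : z = algebraMap k K 1 / (x * y) := by rw [map_one, hz]
  have hx0 := left_ne_zero h.1
  have hy0 := right_ne_zero h.1
  have hxyz : x * y * z = 1 := by rw [hz]; field_simp
  have hgz : g z = z⁻¹ := by
    rw [hz, map_div₀, map_mul, map_one, hgx, hgy]
    field_simp
  obtain ⟨hD, hu0, hv0, -⟩ := cyclic_ne_zero h.1 one_ne_zero hz1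
  have hi := (isTranscendenceBasis_cyclic h one_ne_zero hz1).1
  have h1 := descends_cyclic h.1 one_ne_zero hz1 hx hy
  have hgu : g (cyclicU x y z) = cyclicU x y z /
      (cyclicU x y z ^ 2 - cyclicU x y z * cyclicU y x z + cyclicU y x z ^ 2) := by
    have h2 := cyclicU_inv (x := y) (y := x) (z := z) (by rw [← hxyz]; ring)
      (by rwa [cyclicU_den_comm])
    rw [show cyclicU y x z ^ 2 - cyclicU y x z * cyclicU x y z + cyclicU x y z ^ 2 =
      cyclicU x y z ^ 2 - cyclicU x y z * cyclicU y x z + cyclicU y x z ^ 2 by ring] at h2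
    rw [← h2]
    simp only [cyclicU, map_div₀, map_mul, map_add, map_sub, map_pow, hgx, hgy, hgz, map_ofNat]
  have hgv : g (cyclicU y x z) = cyclicU y x z /
      (cyclicU x y z ^ 2 - cyclicU x y z * cyclicU y x z + cyclicU y x z ^ 2) := by
    rw [← cyclicU_inv hxyz hD]
    simp only [cyclicU, map_div₀, map_mul, map_add, map_sub, map_pow, hgx, hgy, hgz, map_ofNat]
  generalize cyclicU x y z = u at *
  generalize cyclicU y x z = v at *
  have hW : u ^ 2 - u * v + v ^ 2 ≠ 0 := by
    have := aeval_ne_zero hi (X 0 ^ 2 - X 0 * X 1 + X 1 ^ 2) 1 0 (by simp)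
    simpa using this
  have hW1 : u ^ 2 - u * v + v ^ 2 - 1 ≠ 0 := by
    have := aeval_ne_zero hi (X 0 ^ 2 - X 0 * X 1 + X 1 ^ 2 - 1) 0 0 (by simp)
    simpa using this
  have he : v ^ 2 / (u ^ 2 - u * v + v ^ 2) = 1 / ((u / v) ^ 2 - u / v + 1) := by
    field_simp
  have hgw : g (u / v) = u / v := by
    rw [map_div₀, hgu, hgv, div_div_div_cancel_right₀ hW]
  have hmem : ∀ t : K, v ^ 2 / (u ^ 2 - u * v + v ^ 2) ∈ k⟮u / v, t⟯ := by
    intro t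
    have h2 := mem_left (k := k) (u / v) t
    rw [he]
    exact div_mem (one_mem _) (add_mem (sub_mem (pow_mem h2 2) h2) (one_mem _))
  have h2 : Descends {g} (u / v) v (u / v) (v + v ^ 2 / (u ^ 2 - u * v + v ^ 2) / v) := by
    refine descends_inv hgw ?_ ?_ (hmem _) (hmem _) (div_ne_zero (pow_ne_zero 2 hv0) hW) hv0 ?_
    · rw [hgv]
      field_simp
    · rw [he, map_div₀, map_add, map_sub, map_pow, hgw, map_one]
    · rw [ne_eq, eq_div_iff hW, ← sq]
      intro h3
      exact mul_ne_zero (pow_ne_zero 2 hv0) hW1 (by linear_combination h3)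
  rw [show v ^ 2 / (u ^ 2 - u * v + v ^ 2) / v = v / (u ^ 2 - u * v + v ^ 2) by field_simp] at h2
  refine h1.trans (h2.congr (le_antisymm ?_ ?_))
  · refine adjoin_pair_le ?_ (mem_right _ _)
    have := mul_mem (mem_left (k := k) (u / v) v) (mem_right (u / v) v)
    rwa [div_mul_cancel₀ _ hv0] at this
  · exact adjoin_pair_le (div_mem (mem_left _ _) (mem_right _ _)) (mem_right _ _)

/-- The group generated by `x ↦ y ↦ z ↦ x` and the inversion of `x` and `y`. -/
lemma exists_descends_order_six (h : IsTranscendenceBasis k ![x, y])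
    (hz : z = 1 / (x * y)) (hx : σ x = y) (hy : σ y = z) (hιx : ι x = x⁻¹)
    (hιy : ι y = y⁻¹) : ∃ u v : K, Descends ({σ} ∪ {ι}) x y u v := by
  have hz1 : z = algebraMap k K 1 / (x * y) := by rw [map_one, hz]
  have hx0 := left_ne_zero h.1
  have hy0 := right_ne_zero h.1
  have hxyz : x * y * z = 1 := by rw [hz]; field_simp
  have hιz : ι z = z⁻¹ := by
    rw [hz, map_div₀, map_mul, map_one, hιx, hιy]
    field_simp
  obtain ⟨hD, hu0, hv0, -⟩ := cyclic_ne_zero h.1 one_ne_zero hz1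
  obtain ⟨P, Q, hPQ⟩ := descends_conic_of_order_six (σ := ι)
    (isTranscendenceBasis_cyclic h one_ne_zero hz1).1
    (by
      rw [← cyclicU_inv hxyz hD]
      simp only [cyclicU, map_div₀, map_mul, map_add, map_sub, map_pow, hιx, hιy, hιz, map_ofNat])
    (by
      have h2 := cyclicU_inv (x := y) (y := x) (z := z) (by rw [← hxyz]; ring)
        (by rwa [cyclicU_den_comm])
      rw [show cyclicU y x z ^ 2 - cyclicU y x z * cyclicU x y z + cyclicU x y z ^ 2 =
        cyclicU x y z ^ 2 - cyclicU x y z * cyclicU y x z + cyclicU y x z ^ 2 by ring] at h2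
      rw [← h2]
      simp only [cyclicU, map_div₀, map_mul, map_add, map_sub, map_pow, hιx, hιy, hιz, map_ofNat])
  exact ⟨P, Q, (descends_cyclic h.1 one_ne_zero hz1 hx hy).trans hPQ⟩

/-- The group generated by `x ↦ y ↦ z ↦ x`, the inversion of `x` and `y`, and their swap. -/
lemma exists_descends_dihedral_six (h : IsTranscendenceBasis k ![x, y])
    (hz : z = 1 / (x * y)) (hx : σ x = y) (hy : σ y = z) (hιx : ι x = x⁻¹)
    (hιy : ι y = y⁻¹) (hgx : g x = y) (hgy : g y = x) :
    ∃ u v : K, Descends ({σ} ∪ {g * ι} ∪ {g}) x y u v := by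
  have hz1 : z = algebraMap k K 1 / (x * y) := by rw [map_one, hz]
  have hgz : g z = z := by
    rw [hz, map_div₀, map_mul, map_one, hgx, hgy, mul_comm y]
  obtain ⟨hD, hu0, hv0, -⟩ := cyclic_ne_zero h.1 one_ne_zero hz1
  have h1 := descends_twisted_dihedral_three (σ := σ) (g := g * ι) h hz hx hy
    (by rw [AlgEquiv.mul_apply, hιx, map_inv₀, hgx])
    (by rw [AlgEquiv.mul_apply, hιy, map_inv₀, hgy])
  have hi := (isTranscendenceBasis_cyclic h one_ne_zero hz1).1
  have hgu : g (cyclicU x y z) = cyclicU y x z := by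
    simp only [cyclicU, map_div₀, map_mul, map_add, map_sub, map_pow, hgx, hgy, hgz, map_ofNat]
  have hgv : g (cyclicU y x z) = cyclicU x y z := by
    simp only [cyclicU, map_div₀, map_mul, map_add, map_sub, map_pow, hgx, hgy, hgz, map_ofNat]
  generalize cyclicU x y z = u at *
  generalize cyclicU y x z = v at *
  have hW : u ^ 2 - u * v + v ^ 2 ≠ 0 := by
    have := aeval_ne_zero hi (X 0 ^ 2 - X 0 * X 1 + X 1 ^ 2) 1 0 (by simp)
    simpa using this
  have huv : v ^ 2 - u ^ 2 ≠ 0 := by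
    have := aeval_ne_zero hi (X 1 ^ 2 - X 0 ^ 2) 1 0 (by simp)
    simpa using this
  have h2 := descends_affine (σ := g) (x := (u / v)⁻¹) (t := v + v / (u ^ 2 - u * v + v ^ 2))
    (by rw [map_inv₀, map_div₀, hgu, hgv, inv_inv, inv_div])
    (by
      simp only [map_add, map_sub, map_mul, map_div₀, map_pow, hgu, hgv]
      rw [show v ^ 2 - v * u + u ^ 2 = u ^ 2 - u * v + v ^ 2 by ring]
      field_simp)
    (inv_ne_zero (div_ne_zero hu0 hv0))
    (by
      rw [inv_div, ne_eq, div_mul_div_comm, div_eq_one_iff_eq (mul_ne_zero hu0 hu0)]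
      intro h3
      exact huv (by linear_combination h3))
  refine ⟨_, _, h1.trans (h2.congr (le_antisymm ?_ ?_))⟩
  · refine adjoin_pair_le ?_ (mem_right _ _)
    have := inv_mem (mem_left (k := k) (u / v)⁻¹ (v + v / (u ^ 2 - u * v + v ^ 2)))
    rwa [inv_inv] at this
  · exact adjoin_pair_le (inv_mem (mem_left _ _)) (mem_right _ _)

end OrderThree

section CaseThree

open Matrix

lemma pow_three_of_order_three :
    (!![0, -1; 1, -1] : Matrix (Fin 2) (Fin 2) ℤ) ^ 3 = 1 := by decide

lemma eq_mul_pow_of_order_three {B C : Matrix (Fin 2) (Fin 2) ℤ} {i : ℕ} (hi : i ≤ 3)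
    (h : B * !![0, -1; 1, -1] ^ i = C) : B = C * !![0, -1; 1, -1] ^ (3 - i) := by
  rw [← h, Matrix.mul_assoc, ← pow_add, Nat.add_sub_cancel' hi, pow_three_of_order_three,
    Matrix.mul_one]

lemma rotation_cases_of_order_three {B : Matrix (Fin 2) (Fin 2) ℤ}
    (h : ∀ i : ℕ, ∃ n ≠ 0, (B * !![0, -1; 1, -1] ^ i) ^ n = 1) (hd : B.det = 1) :
    ∃ i : ℕ, B = !![0, -1; 1, -1] ^ i ∨ B = -!![0, -1; 1, -1] ^ i := by
  have hdi : ∀ i : ℕ, (B * !![0, -1; 1, -1] ^ i).det = 1 := fun i => by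
    rw [det_mul, hd, det_pow]
    simp
  have key : ∀ i ≤ 3, (∃ i : ℕ, B = !![0, -1; 1, -1] ^ i ∨ B = -!![0, -1; 1, -1] ^ i) ∨
      |(B * !![0, -1; 1, -1] ^ i).trace| ≤ 1 := by
    intro i hi
    obtain ⟨n, hn, h1⟩ := h i
    have h2 := abs_le.1 (abs_trace_le_two hn h1 (hdi i))
    by_cases h3 : (B * !![0, -1; 1, -1] ^ i).trace = 2
    · have h4 := eq_mul_pow_of_order_three hi (eq_one_of_trace_eq_two hn h1 (hdi i) h3)
      exact .inl ⟨3 - i, .inl (by rwa [Matrix.one_mul] at h4)⟩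
    by_cases h4 : (B * !![0, -1; 1, -1] ^ i).trace = -2
    · have h4 := eq_mul_pow_of_order_three hi (eq_neg_one_of_trace_eq_neg_two hn h1 (hdi i) h4)
      exact .inl ⟨3 - i, .inr (by rwa [neg_mul, Matrix.one_mul] at h4)⟩
    exact .inr (abs_le.2 (by omega))
  rcases key 0 (by norm_num) with h0 | h0
  · exact h0
  rcases key 1 (by norm_num) with h1 | h1
  · exact h1
  rcases key 2 (by norm_num) with h2 | h2
  · exact h2
  exfalso
  rw [show (!![0, -1; 1, -1] : Matrix (Fin 2) (Fin 2) ℤ) ^ 2 = !![-1, 1; -1, 0] by decide] at h2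
  simp only [trace_fin_two, Matrix.mul_apply, Fin.sum_univ_two, pow_zero, pow_one, Matrix.mul_one,
    of_apply, cons_val', cons_val_zero, cons_val_one, cons_val_fin_one] at h0 h1 h2
  rw [det_fin_two] at hd
  generalize B 0 0 = p at *
  generalize B 0 1 = q at *
  generalize B 1 0 = r at *
  generalize B 1 1 = s at *
  obtain ⟨t, rfl⟩ : ∃ t, s = t - p := ⟨s + p, by ring⟩
  obtain ⟨t', rfl⟩ : ∃ t', r = q - t + p - t' := ⟨q - t + p - r, by ring⟩
  have h3 : t ^ 2 + t * t' + t' ^ 2 ≤ 1 := by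
    rw [abs_le] at h0 h1 h2
    have a1 : -1 ≤ t ∧ t ≤ 1 := by omega
    have a2 : -1 ≤ t' ∧ t' ≤ 1 := by omega
    have a3 : -1 ≤ t + t' ∧ t + t' ≤ 1 := by omega
    obtain ⟨a1, a1'⟩ := a1
    obtain ⟨a2, a2'⟩ := a2
    clear h0 h1 h2 hd h key hdi
    interval_cases t <;> interval_cases t' <;> simp at *
  nlinarith [sq_nonneg (2 * p + q - t), sq_nonneg (3 * q - (t + 2 * t'))]

lemma reflection_cases_of_order_three {B : Matrix (Fin 2) (Fin 2) ℤ}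
    (h : ∀ i : ℕ, ∃ n ≠ 0, (B * !![0, -1; 1, -1] ^ i) ^ n = 1) (hd : B.det = -1) :
    ∃ i : ℕ, B * !![0, -1; 1, -1] ^ i = !![0, 1; 1, 0] ∨
      B * !![0, -1; 1, -1] ^ i = !![0, -1; -1, 0] := by
  have ht : ∀ i : ℕ, (B * !![0, -1; 1, -1] ^ i).trace = 0 := fun i => by
    obtain ⟨n, hn, h1⟩ := h i
    refine trace_eq_zero_of_det hn h1 ?_
    rw [det_mul, hd, det_pow]
    simp
  have h0 := ht 0
  have h1 := ht 1
  simp only [trace_fin_two, Matrix.mul_apply, Fin.sum_univ_two, pow_zero, pow_one, Matrix.mul_one,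
    of_apply, cons_val', cons_val_zero, cons_val_one, cons_val_fin_one] at h0 h1
  rw [det_fin_two] at hd
  have h3 : B 1 0 = B 0 1 + B 0 0 := by omega
  have h4 : B 1 1 = - B 0 0 := by omega
  have hB : B = !![B 0 0, B 0 1; B 0 1 + B 0 0, - B 0 0] := by
    rw [eta_fin_two B, h3, h4]
    simp
  rw [h3, h4] at hd
  clear h h0 h1 h3 h4 ht
  generalize B 0 0 = p at *
  generalize B 0 1 = q at *
  subst hB
  have hp : -1 ≤ p ∧ p ≤ 1 := by
    constructor <;> nlinarith [sq_nonneg (p + 2 * q), sq_nonneg (2 * p + q)]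
  have hq : -1 ≤ q ∧ q ≤ 1 := by
    constructor <;> nlinarith [sq_nonneg (p + 2 * q), sq_nonneg (2 * p + q)]
  obtain ⟨hp1, hp2⟩ := hp
  obtain ⟨hq1, hq2⟩ := hq
  interval_cases p <;> interval_cases q <;> simp at hd
  · exact ⟨1, by decide⟩
  · exact ⟨2, by decide⟩
  · exact ⟨0, by decide⟩
  · exact ⟨0, by decide⟩
  · exact ⟨2, by decide⟩
  · exact ⟨1, by decide⟩

variable {S : Set (K ≃ₐ[k] K)} {H : Subgroup (K ≃ₐ[k] K)} {σ g ι : K ≃ₐ[k] K} {x y : K}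
  {M N : Matrix (Fin 2) (Fin 2) ℤ} {c : k}

lemma Setup.exists_pow_mul_eq_one (s : Setup H x y) (hσ : σ ∈ H) (hg : g ∈ H) (hM : Acts σ x y M)
    (hN : Acts g x y N) (i : ℕ) : ∃ n ≠ 0, (N * M ^ i) ^ n = 1 :=
  s.exists_pow_eq_one (H.mul_mem hg (H.pow_mem hσ i)) (hN.mul (hM.pow i))

lemma Setup.rescale (s : Setup H x y) {a b : k} (ha : a ≠ 0) (hb : b ≠ 0) :
    Setup H (x / algebraMap k K a) (y / algebraMap k K b) ∧
      k⟮x, y⟯ = k⟮x / algebraMap k K a, y / algebraMap k K b⟯ ∧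
      ∀ (σ : K ≃ₐ[k] K) M, Acts σ x y M →
        Acts σ (x / algebraMap k K a) (y / algebraMap k K b) M := by
  obtain ⟨s', hE, hA⟩ := s.change (P := 1) (Q := 1) (x' := x / algebraMap k K a)
    (y' := y / algebraMap k K b) (Matrix.mul_one 1)
    ⟨a⁻¹, inv_ne_zero ha, by simp [mono, div_eq_inv_mul]⟩
    ⟨b⁻¹, inv_ne_zero hb, by simp [mono, div_eq_inv_mul]⟩
  refine ⟨s', hE, fun σ M hM => ?_⟩
  simpa using hA σ M hM

/-- All rotations are words in the standard rotation of order three and the inversion. -/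
lemma Setup.isWord_rotation_three (s : Setup H x y) (hS : S ⊆ H) (hσ : σ ∈ S)
    (hM : Acts σ x y !![0, -1; 1, -1])
    (hι : ∀ ι ∈ H, Acts ι x y (-1) → ∃ ι ∈ Subgroup.closure S, Acts ι x y (-1)) :
    ∀ h ∈ H, ∀ M, Acts h x y M → M.det = 1 → IsWord S x y h := by
  intro h hh B hB hd
  obtain ⟨i, rfl | rfl⟩ := rotation_cases_of_order_three
    (s.exists_pow_mul_eq_one (hS hσ) hh hM hB) hd
  · exact s.isWord hS hh hB (pow_mem (Subgroup.subset_closure hσ) i) (hM.pow i)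
  · obtain ⟨ι, hι1, hι2⟩ := hι (h * σ ^ (2 * i)) (H.mul_mem hh (H.pow_mem (hS hσ) _)) (by
      have := hB.mul (hM.pow (2 * i))
      rwa [neg_mul, ← pow_add, show i + 2 * i = 3 * i by ring,
        pow_mul !![0, -1; 1, -1], pow_three_of_order_three,
        one_pow] at this)
    refine s.isWord hS hh hB (mul_mem hι1 (pow_mem (Subgroup.subset_closure hσ) i)) ?_
    have := hι2.mul (hM.pow i)
    rwa [neg_mul, Matrix.one_mul] at this

/-- A swap in a group containing `x ↦ y ↦ z ↦ x` has trivial constants. -/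
lemma Setup.swap_three (s : Setup H x y) (hσ : σ ∈ H) (hM : Acts σ x y !![0, -1; 1, -1])
    (hx : σ x = y) (hc : c ≠ 0) (hy : σ y = algebraMap k K c / (x * y)) (hg : g ∈ H)
    (hN : Acts g x y !![0, 1; 1, 0]) : g x = y ∧ g y = x := by
  have hx0 := left_ne_zero s.algebraicIndependent
  have hy0 := right_ne_zero s.algebraicIndependent
  obtain ⟨a, ha, hgx⟩ := hN.left
  obtain ⟨b, hb, hgy⟩ := hN.right
  replace hgx : g x = algebraMap k K a * y := by simpa using hgx
  replace hgy : g y = algebraMap k K b * x := by simpa using hgy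
  have hc' : algebraMap k K c ≠ 0 := by simpa
  have h1 := (s.faithful _ (H.mul_mem hg hg) (by
    rw [show (1 : Matrix (Fin 2) (Fin 2) ℤ) = !![0, 1; 1, 0] * !![0, 1; 1, 0] by decide]
    exact hN.mul hN)).1
  have hgs : g * (σ * σ) ∈ H := H.mul_mem hg (H.mul_mem hσ hσ)
  have h2 := (s.faithful _ (H.mul_mem hgs hgs) (by
    rw [show (1 : Matrix (Fin 2) (Fin 2) ℤ) = (!![0, 1; 1, 0] * (!![0, -1; 1, -1] *
      !![0, -1; 1, -1])) * (!![0, 1; 1, 0] * (!![0, -1; 1, -1] * !![0, -1; 1, -1])) by decide]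
    exact (hN.mul (hM.mul hM)).mul (hN.mul (hM.mul hM)))).1
  simp only [AlgEquiv.mul_apply, map_mul, map_div₀, AlgEquiv.commutes, hgx, hgy, hx, hy] at h1 h2
  rw [← mul_assoc, ← map_mul, mul_eq_right₀ hx0, map_eq_one_iff _ (algebraMap k K).injective] at h1
  have ha' : algebraMap k K a ≠ 0 := by simpa
  have hb' : algebraMap k K b ≠ 0 := by simpa
  have hab : algebraMap k K a * algebraMap k K b = 1 := by rw [← map_mul, h1, map_one]
  have h3 : algebraMap k K a = 1 := by
    field_simp at h2
    grind
  have h4 : algebraMap k K b = 1 := by rwa [h3, one_mul] at hab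
  rw [hgx, hgy, h3, h4]
  simp

/-- The constants of an antiswap in a group containing `x ↦ y ↦ z ↦ x`. -/
lemma Setup.antiswap_three (s : Setup H x y) (hσ : σ ∈ H) (hM : Acts σ x y !![0, -1; 1, -1])
    (hx : σ x = y) (hc : c ≠ 0) (hy : σ y = algebraMap k K c / (x * y)) (hg : g ∈ H)
    (hN : Acts g x y !![0, -1; -1, 0]) : ∃ e : k, e ≠ 0 ∧ c = e ^ 3 ∧
      g x = algebraMap k K e ^ 2 / y ∧ g y = algebraMap k K e ^ 2 / x := by
  have hx0 := left_ne_zero s.algebraicIndependent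
  have hy0 := right_ne_zero s.algebraicIndependent
  obtain ⟨a, ha, hgx⟩ := hN.left
  obtain ⟨b, hb, hgy⟩ := hN.right
  replace hgx : g x = algebraMap k K a / y := by simpa [div_eq_mul_inv] using hgx
  replace hgy : g y = algebraMap k K b / x := by simpa [div_eq_mul_inv] using hgy
  have hc' : algebraMap k K c ≠ 0 := by simpa
  have ha' : algebraMap k K a ≠ 0 := by simpa
  have hb' : algebraMap k K b ≠ 0 := by simpa
  have h1 := (s.faithful _ (H.mul_mem hg hg) (by
    rw [show (1 : Matrix (Fin 2) (Fin 2) ℤ) = !![0, -1; -1, 0] * !![0, -1; -1, 0] by decide]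
    exact hN.mul hN)).1
  have hgs : g * σ ∈ H := H.mul_mem hg hσ
  have h2 := (s.faithful _ (H.mul_mem hgs hgs) (by
    rw [show (1 : Matrix (Fin 2) (Fin 2) ℤ) = (!![0, -1; -1, 0] * !![0, -1; 1, -1]) *
      (!![0, -1; -1, 0] * !![0, -1; 1, -1]) by decide]
    exact (hN.mul hM).mul (hN.mul hM))).2
  simp only [AlgEquiv.mul_apply, map_mul, map_div₀, AlgEquiv.commutes, hgx, hgy, hx, hy] at h1 h2
  have hab : a = b := by
    apply (algebraMap k K).injective
    field_simp at h1
    exact h1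
  subst hab
  have h3 : c ^ 2 = a ^ 3 := by
    apply (algebraMap k K).injective
    rw [map_pow, map_pow]
    field_simp at h2
    grind
  have h4 : a = (c / a) ^ 2 := by
    field_simp
    exact h3.symm
  refine ⟨c / a, div_ne_zero hc ha, ?_, ?_, ?_⟩
  · field_simp
    rw [← h3]
  · rw [← map_pow, ← h4, hgx]
  · rw [← map_pow, ← h4, hgy]

/-- The constants of an inversion in a group containing `x ↦ y ↦ z ↦ x`. -/
lemma Setup.inversion_three (s : Setup H x y) (hσ : σ ∈ H) (hM : Acts σ x y !![0, -1; 1, -1])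
    (hx : σ x = y) (hc : c ≠ 0) (hy : σ y = algebraMap k K c / (x * y)) (hι : ι ∈ H)
    (hN : Acts ι x y (-1)) : ∃ e : k, e ≠ 0 ∧ c = e ^ 3 ∧
      ι x = algebraMap k K e ^ 2 / x ∧ ι y = algebraMap k K e ^ 2 / y := by
  have hx0 := left_ne_zero s.algebraicIndependent
  have hy0 := right_ne_zero s.algebraicIndependent
  obtain ⟨a, ha, hgx⟩ := hN.left
  obtain ⟨b, hb, hgy⟩ := hN.right
  replace hgx : ι x = algebraMap k K a / x := by simpa [div_eq_mul_inv] using hgx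
  replace hgy : ι y = algebraMap k K b / y := by simpa [div_eq_mul_inv] using hgy
  have hc' : algebraMap k K c ≠ 0 := by simpa
  have ha' : algebraMap k K a ≠ 0 := by simpa
  have hb' : algebraMap k K b ≠ 0 := by simpa
  obtain ⟨h1, h2⟩ := s.agree (H.mul_mem hσ hι) (H.mul_mem hι hσ) (hM.mul hN) (by
    have := hN.mul hM
    rwa [neg_mul, Matrix.one_mul, ← Matrix.mul_one !![0, -1; 1, -1], ← mul_neg] at this)
  simp only [AlgEquiv.mul_apply, map_mul, map_div₀, AlgEquiv.commutes, hgx, hgy, hx, hy] at h1 h2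
  have hab : a = b := by
    apply (algebraMap k K).injective
    field_simp at h1
    exact h1
  subst hab
  have h3 : c ^ 2 = a ^ 3 := by
    apply (algebraMap k K).injective
    rw [map_pow, map_pow]
    field_simp at h2
    grind
  have h4 : a = (c / a) ^ 2 := by
    field_simp
    exact h3.symm
  refine ⟨c / a, div_ne_zero hc ha, ?_, ?_, ?_⟩
  · field_simp
    rw [← h3]
  · rw [← map_pow, ← h4, hgx]
  · rw [← map_pow, ← h4, hgy]

lemma Setup.exists_descends_of_standard_three (s : Setup H x y) (hσ : σ ∈ H) (hx : σ x = y)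
    (hM : Acts σ x y !![0, -1; 1, -1]) :
    ∃ u v : K, Descends (H : Set (K ≃ₐ[k] K)) x y u v := by
  have hx0 := left_ne_zero s.algebraicIndependent
  have hy0 := right_ne_zero s.algebraicIndependent
  obtain ⟨c, hc, hy⟩ := hM.right
  replace hy : σ y = algebraMap k K c / (x * y) := by
    simpa [div_eq_mul_inv, mul_comm x⁻¹] using hy
  have hscale : ∀ e : k, e ≠ 0 → c = e ^ 3 → σ (x / algebraMap k K e) = y / algebraMap k K e ∧
      σ (y / algebraMap k K e) = 1 / (x / algebraMap k K e * (y / algebraMap k K e)) := by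
    rintro e he rfl
    have he' : algebraMap k K e ≠ 0 := by simpa
    rw [map_div₀, map_div₀, hx, hy, AlgEquiv.commutes, map_pow]
    refine ⟨rfl, ?_⟩
    field_simp
  by_cases hι : ∃ ι ∈ H, Acts ι x y (-1) <;> by_cases hg : ∃ g ∈ H, ∃ N, Acts g x y N ∧ N.det = -1
  · obtain ⟨ι, hι, hιN⟩ := hι
    obtain ⟨g, hg, hN⟩ : ∃ g ∈ H, Acts g x y !![0, 1; 1, 0] := by
      obtain ⟨g, hg, N, hN, hd⟩ := hg
      obtain ⟨i, hi | hi⟩ := reflection_cases_of_order_three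
        (s.exists_pow_mul_eq_one hσ hg hM hN) hd
      · exact ⟨g * σ ^ i, H.mul_mem hg (H.pow_mem hσ i), hi ▸ hN.mul (hM.pow i)⟩
      · refine ⟨g * σ ^ i * ι, H.mul_mem (H.mul_mem hg (H.pow_mem hσ i)) hι, ?_⟩
        have := (hN.mul (hM.pow i)).mul hιN
        rw [hi] at this
        convert this using 1
        decide
    obtain ⟨e, he, hce, hιx, hιy⟩ := s.inversion_three hσ hM hx hc hy hι hιN
    obtain ⟨hgx, hgy⟩ := s.swap_three hσ hM hx hc hy hg hN
    obtain ⟨h1, h2⟩ := hscale e he hce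
    obtain ⟨s', hE, hA⟩ := s.rescale he he
    have he' : algebraMap k K e ≠ 0 := by simpa
    obtain ⟨u, v, huv⟩ := exists_descends_dihedral_six (ι := ι) (g := g) s'.isTranscendenceBasis rfl
      h1 h2 (by rw [map_div₀, hιx, AlgEquiv.commutes]; field_simp)
      (by rw [map_div₀, hιy, AlgEquiv.commutes]; field_simp)
      (by rw [map_div₀, hgx, AlgEquiv.commutes]) (by rw [map_div₀, hgy, AlgEquiv.commutes])
    have hS : {σ} ∪ {g * ι} ∪ {g} ⊆ (H : Set (K ≃ₐ[k] K)) := by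
      rintro τ ((rfl | rfl) | rfl)
      exacts [hσ, H.mul_mem hg hι, hg]
    refine ⟨u, v, (huv.of_words hS ?_).congr hE⟩
    refine s'.isWord_of_rotations hS (s'.isWord_rotation_three hS (.inl (.inl rfl)) (hA _ _ hM)
      fun _ _ _ => ⟨ι, ?_, hA _ _ hιN⟩) (.inr rfl) (hA _ _ hN) (by simp)
    have := mul_mem (inv_mem (Subgroup.subset_closure (.inr rfl)))
      (Subgroup.subset_closure (.inl (.inr rfl)) : g * ι ∈ Subgroup.closure ({σ} ∪ {g * ι} ∪ {g}))
    rwa [inv_mul_cancel_left] at this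
  · obtain ⟨ι, hι, hιN⟩ := hι
    obtain ⟨e, he, hce, hιx, hιy⟩ := s.inversion_three hσ hM hx hc hy hι hιN
    obtain ⟨h1, h2⟩ := hscale e he hce
    obtain ⟨s', hE, hA⟩ := s.rescale he he
    have he' : algebraMap k K e ≠ 0 := by simpa
    obtain ⟨u, v, huv⟩ := exists_descends_order_six (ι := ι) s'.isTranscendenceBasis rfl
      h1 h2 (by rw [map_div₀, hιx, AlgEquiv.commutes]; field_simp)
      (by rw [map_div₀, hιy, AlgEquiv.commutes]; field_simp)
    have hS : {σ} ∪ {ι} ⊆ (H : Set (K ≃ₐ[k] K)) := by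
      rintro τ (rfl | rfl) <;> assumption
    refine ⟨u, v, (huv.of_words hS fun h hh => ?_).congr hE⟩
    obtain ⟨B, hB⟩ := s.acts h hh
    exact s'.isWord_rotation_three hS (.inl rfl) (hA _ _ hM)
      (fun _ _ _ => ⟨ι, Subgroup.subset_closure (.inr rfl), hA _ _ hιN⟩) h hh B (hA _ _ hB)
      ((s.det_eq_one_or hh hB).resolve_right fun hd => hg ⟨h, hh, B, hB, hd⟩)
  · obtain ⟨g, hg, N, hN, hd⟩ := hg
    obtain ⟨i, hi⟩ := reflection_cases_of_order_three (s.exists_pow_mul_eq_one hσ hg hM hN) hd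
    replace hg : g * σ ^ i ∈ H := H.mul_mem hg (H.pow_mem hσ i)
    replace hN := hN.mul (hM.pow i)
    generalize g * σ ^ i = g at *
    have hS : {σ} ∪ {g} ⊆ (H : Set (K ≃ₐ[k] K)) := by
      rintro τ (rfl | rfl) <;> assumption
    have hw := s.isWord_of_rotations hS (s.isWord_rotation_three hS (.inl rfl) hM
      fun ι h1 h2 => absurd ⟨ι, h1, h2⟩ hι) (.inr rfl) hN (by
        rcases hi with hi | hi <;> simp [hi])
    rcases hi with hi | hi
    · rw [hi] at hN
      obtain ⟨hgx, hgy⟩ := s.swap_three hσ hM hx hc hy hg hN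
      obtain ⟨u, v, huv⟩ := exists_descends_dihedral_three s.isTranscendenceBasis hc rfl hx hy
        hgx hgy
      exact ⟨u, v, huv.of_words hS hw⟩
    · rw [hi] at hN
      obtain ⟨e, he, hce, hgx, hgy⟩ := s.antiswap_three hσ hM hx hc hy hg hN
      obtain ⟨h1, h2⟩ := hscale e he hce
      obtain ⟨s', hE, hA⟩ := s.rescale he he
      have he' : algebraMap k K e ≠ 0 := by simpa
      have huv := (descends_twisted_dihedral_three (g := g) s'.isTranscendenceBasis rfl
        h1 h2 (by rw [map_div₀, hgx, AlgEquiv.commutes]; field_simp)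
        (by rw [map_div₀, hgy, AlgEquiv.commutes]; field_simp)).congr hE
      exact ⟨_, _, huv.of_words hS hw⟩
  · have hS : {σ} ⊆ (H : Set (K ≃ₐ[k] K)) := by
      rintro τ rfl
      exact hσ
    refine ⟨_, _, (descends_cyclic s.algebraicIndependent hc rfl hx hy).of_words hS fun h hh => ?_⟩
    obtain ⟨B, hB⟩ := s.acts h hh
    exact s.isWord_rotation_three hS rfl hM (fun ι h1 h2 => absurd ⟨ι, h1, h2⟩ hι) h hh B hB
      ((s.det_eq_one_or hh hB).resolve_right fun hd => hg ⟨h, hh, B, hB, hd⟩)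

/-- Descent for groups containing a rotation of order three or six. -/
lemma Setup.exists_descends_of_trace_eq_one_or (s : Setup H x y) (hσ : σ ∈ H) (hM : Acts σ x y M)
    (hd : M.det = 1) (ht : M.trace = 1 ∨ M.trace = -1) :
    ∃ u v : K, Descends (H : Set (K ≃ₐ[k] K)) x y u v := by
  obtain ⟨σ, hσ, M, hM, hd, ht⟩ : ∃ σ ∈ H, ∃ M, Acts σ x y M ∧ M.det = 1 ∧ M.trace = -1 := by
    rcases ht with ht | ht
    · refine ⟨σ ^ 2, H.pow_mem hσ 2, M ^ 2, hM.pow 2, by rw [det_pow, hd, one_pow], ?_⟩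
      rw [sq_fin_two, hd, ht]
      simp [ht]
    · exact ⟨σ, hσ, M, hM, hd, ht⟩
  obtain ⟨x', s', hE, hA⟩ := s.exists_cyclic_basis hM hd (.inr (.inr ht))
  rw [ht] at hA
  obtain ⟨u, v, h⟩ := s'.exists_descends_of_standard_three hσ rfl hA
  exact ⟨u, v, h.congr hE⟩

end CaseThree

/-! ### Groups without rotations of order greater than two -/

section CaseTwo

open Matrix

variable {S : Set (K ≃ₐ[k] K)} {H : Subgroup (K ≃ₐ[k] K)} {τ ι : K ≃ₐ[k] K} {x y : K}
  {M : Matrix (Fin 2) (Fin 2) ℤ} {a b c d : k}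

lemma Descends.of_mul_right {u v : K} (h : Descends ({τ * ι} ∪ {τ}) x y u v) :
    Descends ({τ} ∪ {ι}) x y u v := by
  refine h.of_closure ?_ ?_
  · have h1 : τ ∈ Subgroup.closure ({τ} ∪ {ι}) := Subgroup.subset_closure (.inl rfl)
    have h2 : ι ∈ Subgroup.closure ({τ} ∪ {ι}) := Subgroup.subset_closure (.inr rfl)
    rintro σ (rfl | rfl)
    · exact mul_mem h1 h2
    · exact h1
  · have h1 : τ * ι ∈ Subgroup.closure ({τ * ι} ∪ {τ}) := Subgroup.subset_closure (.inl rfl)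
    have h2 : τ ∈ Subgroup.closure ({τ * ι} ∪ {τ}) := Subgroup.subset_closure (.inr rfl)
    rintro σ (rfl | rfl)
    · exact h2
    · simpa using mul_mem (inv_mem h2) h1

/-- The Klein four-group generated by `x ↦ c * x`, `y ↦ d / y` and `x ↦ a / x`, `y ↦ b / y`. -/
lemma exists_descends_klein (h : AlgebraicIndependent k ![x, y]) (ha : a ≠ 0) (hb : b ≠ 0)
    (hc : c = 1 ∨ c = -1) (hd : d = b ∨ d = -b) (hx : τ x = algebraMap k K c * x)
    (hy : τ y = algebraMap k K d / y) (hx' : ι x = algebraMap k K a / x)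
    (hy' : ι y = algebraMap k K b / y) : ∃ u v : K, Descends ({τ} ∪ {ι}) x y u v := by
  have hx0 := left_ne_zero h
  have hy0 := right_ne_zero h
  have ha0 : algebraMap k K a ≠ 0 := by simpa
  have hb0 : algebraMap k K b ≠ 0 := by simpa
  by_cases h1 : c = 1 <;> by_cases h2 : d = b
  · subst h1 h2
    rw [map_one, one_mul] at hx
    have h3 := descends_inv_inv (τ' := τ * ι) h ha hb hx hy
      (by rw [AlgEquiv.mul_apply, hx', map_div₀, AlgEquiv.commutes, hx])
      (by
        rw [AlgEquiv.mul_apply, hy', map_div₀, AlgEquiv.commutes, hy]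
        field_simp)
    rw [Set.union_comm] at h3
    exact ⟨_, _, h3.of_mul_right⟩
  · obtain rfl := hd.resolve_left h2
    subst h1
    rw [map_one, one_mul] at hx
    have hd0 : -b ≠ 0 := neg_ne_zero.2 hb
    have h3 : Descends {τ} x y x (y + algebraMap k K (-b) / y) :=
      descends_inv hx hy (τ.commutes _) (IntermediateField.algebraMap_mem _ _)
        (IntermediateField.algebraMap_mem _ _) (by simpa using hb) hy0 (sq_ne_right h hd0)
    refine ⟨_, _, h3.symm.trans (descends_neg (σ := ι) ha ?_ hx' hx0 (sq_ne_left h ha))⟩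
    rw [map_add, map_div₀, AlgEquiv.commutes, hy', map_neg]
    field_simp
    ring
  · obtain rfl := hc.resolve_left h1
    subst h2
    rw [map_neg, map_one, neg_one_mul] at hx
    have ha' : -a ≠ 0 := neg_ne_zero.2 ha
    have h3 : Descends {τ * ι} y x y (x + algebraMap k K (-a) / x) := by
      refine descends_inv ?_ ?_ ((τ * ι).commutes _) (IntermediateField.algebraMap_mem _ _)
        (IntermediateField.algebraMap_mem _ _) (by simpa using ha) hx0 (sq_ne_left h ha')
      · rw [AlgEquiv.mul_apply, hy', map_div₀, AlgEquiv.commutes, hy]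
        field_simp
      · rw [AlgEquiv.mul_apply, hx', map_div₀, AlgEquiv.commutes, hx, map_neg, div_neg, neg_div]
    have h4 := (h3.congr (adjoin_pair_comm x y)).symm.trans
      (descends_neg (σ := τ) hb (by
        rw [map_add, map_div₀, AlgEquiv.commutes, hx, map_neg]
        field_simp
        ring) hy hy0 (sq_ne_right h hb))
    exact ⟨_, _, h4.of_mul_right⟩
  · obtain rfl := hc.resolve_left h1
    obtain rfl := hd.resolve_left h2
    have h3 : (2 : k) ≠ 0 := fun h3 => h1 (by linear_combination -h3)
    have h4 := (descends_inversion (σ := ι) h ha hb hx' hy').trans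
      (descends_conic_of_two_ne_zero (τ := τ) h h3 ha hb (by rw [hx]; simp)
        (by rw [hy, map_neg]))
    rw [Set.union_comm] at h4
    exact ⟨_, _, h4⟩

lemma exists_normal_form (hd : M.det = -1) (ht : M.trace = 0) :
    ∃ P Q : Matrix (Fin 2) (Fin 2) ℤ, P * Q = 1 ∧
      (Q * M * P = !![1, 0; 0, -1] ∨ Q * M * P = !![1, 1; 0, -1]) := by
  obtain ⟨α, β, ⟨s, t, hst⟩, h1, h2⟩ := exists_fixed_vector hd ht
  obtain ⟨i, hi⟩ : ∃ i, !![s, t; -β, α] * M * !![α, -t; β, s] = !![1, i; 0, -1] := by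
    refine ⟨s * (M 0 0 * -t + M 0 1 * s) + t * (M 1 0 * -t + M 1 1 * s), ?_⟩
    have e : (!![s, t; -β, α] * M * !![α, -t; β, s]).trace = 0 := by
      rw [trace_mul_comm, ← Matrix.mul_assoc]
      have : !![α, -t; β, s] * !![s, t; -β, α] = 1 := by
        ext i j
        fin_cases i <;> fin_cases j <;> simp [Matrix.mul_apply, Fin.sum_univ_two] <;>
          first | linear_combination hst | ring
      rw [this, Matrix.one_mul, ht]
    rw [trace_fin_two] at e
    have e0 : (!![s, t; -β, α] * M * !![α, -t; β, s]) 0 0 = 1 := by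
      simp [Matrix.mul_apply, Fin.sum_univ_two, vecMul, dotProduct]
      linear_combination s * h1 + t * h2 + hst
    have e1 : (!![s, t; -β, α] * M * !![α, -t; β, s]) 1 0 = 0 := by
      simp [Matrix.mul_apply, Fin.sum_univ_two, vecMul, dotProduct]
      linear_combination -β * h1 + α * h2
    rw [eta_fin_two (!![s, t; -β, α] * M * !![α, -t; β, s]), e0, e1,
      show (!![s, t; -β, α] * M * !![α, -t; β, s]) 1 1 = -1 by omega]
    simp [Matrix.mul_apply, Fin.sum_univ_two, vecMul, dotProduct]
    ring
  refine ⟨!![α, -t; β, s] * !![1, -(i / 2); 0, 1], !![1, i / 2; 0, 1] * !![s, t; -β, α], ?_, ?_⟩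
  · ext i j
    fin_cases i <;> fin_cases j <;> simp [Matrix.mul_apply, Fin.sum_univ_two] <;>
      first | linear_combination hst | ring
  · have : !![1, i / 2; 0, 1] * !![s, t; -β, α] * M *
        (!![α, -t; β, s] * !![1, -(i / 2); 0, 1]) = !![1, i % 2; 0, -1] := by
      calc _ = !![1, i / 2; 0, 1] * (!![s, t; -β, α] * M * !![α, -t; β, s]) *
            !![1, -(i / 2); 0, 1] := by simp only [Matrix.mul_assoc]
        _ = _ := by
          rw [hi]
          ext j l
          fin_cases j <;> fin_cases l <;> simp [Matrix.mul_apply, Fin.sum_univ_two]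
          omega
    rw [this]
    rcases Int.emod_two_eq_zero_or_one i with h | h <;> simp [h]

lemma Setup.isWord_of_eq_one_or (s : Setup H x y) (hS : S ⊆ H)
    (hC : ∀ h ∈ H, ∀ M, Acts h x y M → M.det = 1 → M = 1 ∨ M = -1)
    (hι : ∀ h ∈ H, Acts h x y (-1) → ∃ g ∈ Subgroup.closure S, Acts g x y (-1)) :
    ∀ h ∈ H, ∀ M, Acts h x y M → M.det = 1 → IsWord S x y h := by
  intro h hh M hM hd
  rcases hC h hh M hM hd with rfl | rfl
  · exact s.isWord hS hh hM (one_mem _) Acts.one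
  · obtain ⟨g, hg, hg'⟩ := hι h hh hM
    exact s.isWord hS hh hM hg hg'

lemma Acts.inversion (hι : Acts ι x y (-1)) :
    ∃ a b : k, a ≠ 0 ∧ b ≠ 0 ∧ ι x = algebraMap k K a / x ∧ ι y = algebraMap k K b / y := by
  obtain ⟨a, ha, hx⟩ := hι.left
  obtain ⟨b, hb, hy⟩ := hι.right
  exact ⟨a, b, ha, hb, by simpa [div_eq_mul_inv] using hx, by simpa [div_eq_mul_inv] using hy⟩

lemma Setup.exists_descends_of_diagonal (s : Setup H x y) (hτ : τ ∈ H)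
    (hM : Acts τ x y !![1, 0; 0, -1])
    (hC : ∀ h ∈ H, ∀ M, Acts h x y M → M.det = 1 → M = 1 ∨ M = -1) :
    ∃ u v : K, Descends (H : Set (K ≃ₐ[k] K)) x y u v := by
  have hi := s.algebraicIndependent
  have hx0 := left_ne_zero hi
  have hy0 := right_ne_zero hi
  obtain ⟨c, hc, hx⟩ := hM.left
  obtain ⟨d, hd, hy⟩ := hM.right
  replace hx : τ x = algebraMap k K c * x := by simpa using hx
  replace hy : τ y = algebraMap k K d / y := by simpa [div_eq_mul_inv] using hy
  have hd0 : algebraMap k K d ≠ 0 := by simpa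
  have h1 := (s.faithful _ (H.mul_mem hτ hτ) (by
    rw [show (1 : Matrix (Fin 2) (Fin 2) ℤ) = !![1, 0; 0, -1] * !![1, 0; 0, -1] by decide]
    exact hM.mul hM)).1
  rw [AlgEquiv.mul_apply, hx, map_mul, AlgEquiv.commutes, hx, ← mul_assoc, ← map_mul,
    mul_eq_right₀ hx0, map_eq_one_iff _ (algebraMap k K).injective, mul_self_eq_one_iff] at h1
  by_cases hι : ∃ ι ∈ H, Acts ι x y (-1)
  · obtain ⟨ι, hιH, hι⟩ := hι
    obtain ⟨a, b, ha, hb, hx', hy'⟩ := hι.inversion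
    have ha0 : algebraMap k K a ≠ 0 := by simpa
    have hb0 : algebraMap k K b ≠ 0 := by simpa
    have h2 := (s.agree (H.mul_mem hτ hιH) (H.mul_mem hιH hτ) (hM.mul hι) (by
      rw [show (!![1, 0; 0, -1] * -1 : Matrix (Fin 2) (Fin 2) ℤ) = -1 * !![1, 0; 0, -1] by decide]
      exact hι.mul hM)).2
    rw [AlgEquiv.mul_apply, AlgEquiv.mul_apply, hy, hy', map_div₀, map_div₀, AlgEquiv.commutes,
      AlgEquiv.commutes, hy, hy'] at h2
    have h3 : d * d = b * b := by
      field_simp at h2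
      apply (algebraMap k K).injective
      rw [map_mul, map_mul]
      linear_combination -h2
    obtain ⟨u, v, huv⟩ := exists_descends_klein hi ha hb h1 (mul_self_eq_mul_self_iff.1 h3)
      hx hy hx' hy'
    have hS : {τ} ∪ {ι} ⊆ (H : Set (K ≃ₐ[k] K)) := by
      rintro τ (rfl | rfl) <;> assumption
    exact ⟨u, v, huv.of_words hS (s.isWord_of_rotations hS (s.isWord_of_eq_one_or hS hC
      fun _ _ _ => ⟨ι, Subgroup.subset_closure (.inr rfl), hι⟩) (.inl rfl) hM (by simp))⟩
  · have hS : {τ} ⊆ (H : Set (K ≃ₐ[k] K)) := Set.singleton_subset_iff.2 hτ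
    have hw := s.isWord_of_rotations hS (s.isWord_of_eq_one_or hS hC
      fun h hh hN => absurd ⟨h, hh, hN⟩ hι) rfl hM (by simp)
    rcases h1 with rfl | rfl
    · exact ⟨_, _, (descends_inv (by simpa using hx) hy (τ.commutes d)
        (IntermediateField.algebraMap_mem _ _) (IntermediateField.algebraMap_mem _ _) hd0 hy0
        (sq_ne_right hi hd)).of_words hS hw⟩
    · exact ⟨_, _, (descends_neg hd (by simpa using hx) hy hy0
        (sq_ne_right hi hd)).of_words hS hw⟩

lemma descends_unipotent (h : AlgebraicIndependent k ![x, y]) (hd : d ≠ 0) (hx : τ x = x)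
    (hy : τ y = algebraMap k K d * x / y) :
    Descends {τ} x y x (y + algebraMap k K d * x / y) := by
  have hd0 : algebraMap k K d ≠ 0 := by simpa
  have hx0 := left_ne_zero h
  refine descends_inv hx hy (by rw [map_mul, AlgEquiv.commutes, hx])
    (mul_mem (IntermediateField.algebraMap_mem _ _) (mem_left _ _))
    (mul_mem (IntermediateField.algebraMap_mem _ _) (mem_left _ _)) (mul_ne_zero hd0 hx0)
    (right_ne_zero h) ?_
  have := aeval_ne_zero h (X 1 * X 1 - C d * X 0) 1 0 (by simpa)
  rw [← sub_ne_zero]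
  simpa using this

lemma Setup.exists_descends_of_unipotent (s : Setup H x y) (hτ : τ ∈ H)
    (hM : Acts τ x y !![1, 1; 0, -1])
    (hC : ∀ h ∈ H, ∀ M, Acts h x y M → M.det = 1 → M = 1 ∨ M = -1) :
    ∃ u v : K, Descends (H : Set (K ≃ₐ[k] K)) x y u v := by
  have hi := s.algebraicIndependent
  have hx0 := left_ne_zero hi
  have hy0 := right_ne_zero hi
  obtain ⟨c, hc, hx⟩ := hM.left
  obtain ⟨d, hd, hy⟩ := hM.right
  replace hx : τ x = algebraMap k K c * x := by simpa using hx
  replace hy : τ y = algebraMap k K d * x / y := by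
    simpa [div_eq_mul_inv, mul_assoc] using hy
  have hd0 : algebraMap k K d ≠ 0 := by simpa
  have h1 := (s.faithful _ (H.mul_mem hτ hτ) (by
    rw [show (1 : Matrix (Fin 2) (Fin 2) ℤ) = !![1, 1; 0, -1] * !![1, 1; 0, -1] by decide]
    exact hM.mul hM)).2
  rw [AlgEquiv.mul_apply, hy, map_div₀, map_mul, AlgEquiv.commutes, hx, hy] at h1
  have hc1 : algebraMap k K c = 1 := by
    field_simp at h1
    simpa using h1
  rw [hc1, one_mul] at hx
  by_cases hι : ∃ ι ∈ H, Acts ι x y (-1)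
  · obtain ⟨ι, hιH, hι⟩ := hι
    obtain ⟨a, b, ha, hb, hx', hy'⟩ := hι.inversion
    have ha0 : algebraMap k K a ≠ 0 := by simpa
    have hb0 : algebraMap k K b ≠ 0 := by simpa
    have h2 := (s.agree (H.mul_mem hτ hιH) (H.mul_mem hιH hτ) (hM.mul hι) (by
      rw [show (!![1, 1; 0, -1] * -1 : Matrix (Fin 2) (Fin 2) ℤ) = -1 * !![1, 1; 0, -1] by decide]
      exact hι.mul hM)).2
    rw [AlgEquiv.mul_apply, AlgEquiv.mul_apply, hy, hy', map_div₀, map_div₀, map_mul,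
      AlgEquiv.commutes, AlgEquiv.commutes, hy, hx', hy'] at h2
    have h3 : algebraMap k K b ^ 2 = algebraMap k K d ^ 2 * algebraMap k K a := by
      field_simp at h2
      linear_combination h2
    have hbd : b / d ≠ 0 := div_ne_zero hb hd
    obtain ⟨s', hE, hA⟩ := s.rescale hbd one_ne_zero
    rw [map_one, div_one] at s' hE hA
    have hi' := s'.algebraicIndependent
    have h4 := descends_unipotent hi' hb (τ := τ) (by
      rw [map_div₀, AlgEquiv.commutes, hx]) (by
      rw [hy, map_div₀]
      field_simp)
    have h5 := descends_affine (σ := ι) (x := x / algebraMap k K (b / d))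
      (t := y + algebraMap k K b * (x / algebraMap k K (b / d)) / y) (by
        rw [map_div₀, AlgEquiv.commutes, hx', map_div₀]
        field_simp
        linear_combination -h3) (by
        rw [map_add, map_div₀, map_mul, AlgEquiv.commutes, map_div₀, AlgEquiv.commutes, hx',
          hy', map_div₀]
        field_simp
        linear_combination -y ^ 2 * h3) (left_ne_zero hi') (by
        simpa using sq_ne_left hi' (one_ne_zero (α := k)))
    have hS : {τ} ∪ {ι} ⊆ (H : Set (K ≃ₐ[k] K)) := by
      rintro τ (rfl | rfl) <;> assumption
    exact ⟨_, _, ((h4.trans h5).congr hE).of_words hS (s.isWord_of_rotations hS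
      (s.isWord_of_eq_one_or hS hC fun _ _ _ => ⟨ι, Subgroup.subset_closure (.inr rfl), hι⟩)
      (.inl rfl) hM (by simp))⟩
  · have hS : {τ} ⊆ (H : Set (K ≃ₐ[k] K)) := Set.singleton_subset_iff.2 hτ
    exact ⟨_, _, (descends_unipotent hi hd hx hy).of_words hS (s.isWord_of_rotations hS
      (s.isWord_of_eq_one_or hS hC fun h hh hN => absurd ⟨h, hh, hN⟩ hι) rfl hM (by simp))⟩

lemma Setup.exists_descends_of_rotations (s : Setup H x y)
    (hC : ∀ h ∈ H, ∀ M, Acts h x y M → M.det = 1 → M = 1 ∨ M = -1) :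
    ∃ u v : K, Descends (H : Set (K ≃ₐ[k] K)) x y u v := by
  by_cases hg : ∃ g ∈ H, ∃ N, Acts g x y N ∧ N.det = -1
  · obtain ⟨g, hg, N, hN, hd⟩ := hg
    obtain ⟨n, hn, h1⟩ := s.exists_pow_eq_one hg hN
    obtain ⟨P, Q, hPQ, hnf⟩ := exists_normal_form hd (trace_eq_zero_of_det hn h1 hd)
    obtain ⟨s', hE, hA⟩ := s.change hPQ (Rel.refl _) (Rel.refl _)
    have hQP : Q * P = 1 := mul_eq_one_comm.1 hPQ
    have hC' : ∀ h ∈ H, ∀ M, Acts h (mono x y fun i => P i 0) (mono x y fun i => P i 1) M →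
        M.det = 1 → M = 1 ∨ M = -1 := by
      intro h hh M hM hd
      obtain ⟨L, hL⟩ := s.acts h hh
      obtain rfl := hM.unique s'.algebraicIndependent (hA h L hL)
      rw [Matrix.mul_assoc, det_mul_comm, Matrix.mul_assoc, hPQ, Matrix.mul_one] at hd
      rcases hC h hh L hL hd with rfl | rfl
      · exact .inl (by rw [Matrix.mul_one, hQP])
      · exact .inr (by rw [Matrix.mul_neg, Matrix.mul_one, Matrix.neg_mul, hQP])
    have hN' := hA g N hN
    rcases hnf with hnf | hnf <;> rw [hnf] at hN'
    · obtain ⟨u, v, h⟩ := s'.exists_descends_of_diagonal hg hN' hC'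
      exact ⟨u, v, h.congr hE⟩
    · obtain ⟨u, v, h⟩ := s'.exists_descends_of_unipotent hg hN' hC'
      exact ⟨u, v, h.congr hE⟩
  · have hdet : ∀ h ∈ H, ∀ M, Acts h x y M → M.det = 1 := fun h hh M hM =>
      (s.det_eq_one_or hh hM).resolve_right fun hd => hg ⟨h, hh, M, hM, hd⟩
    by_cases hι : ∃ ι ∈ H, Acts ι x y (-1)
    · obtain ⟨ι, hιH, hι⟩ := hι
      obtain ⟨a, b, ha, hb, hx, hy⟩ := hι.inversion
      have hS : {ι} ⊆ (H : Set (K ≃ₐ[k] K)) := Set.singleton_subset_iff.2 hιH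
      refine ⟨_, _, (descends_inversion s.algebraicIndependent ha hb hx hy).of_words hS
        fun h hh => ?_⟩
      obtain ⟨M, hM⟩ := s.acts h hh
      exact s.isWord_of_eq_one_or hS hC (fun _ _ _ => ⟨ι, Subgroup.subset_closure rfl, hι⟩)
        h hh M hM (hdet h hh M hM)
    · refine ⟨_, _, (descends_empty x y).of_words (Set.empty_subset _) fun h hh => ?_⟩
      obtain ⟨M, hM⟩ := s.acts h hh
      exact s.isWord_of_eq_one_or (Set.empty_subset _) hC (fun h hh hN => absurd ⟨h, hh, hN⟩ hι)
        h hh M hM (hdet h hh M hM)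

/-- Descent for a finite group acting monomially. -/
theorem Setup.exists_descends (s : Setup H x y) :
    ∃ u v : K, Descends (H : Set (K ≃ₐ[k] K)) x y u v := by
  by_cases hC : ∀ h ∈ H, ∀ M, Acts h x y M → M.det = 1 → M = 1 ∨ M = -1
  · exact s.exists_descends_of_rotations hC
  · push Not at hC
    obtain ⟨h, hh, M, hM, hd, h1, h2⟩ := hC
    obtain ⟨n, hn, hMn⟩ := s.exists_pow_eq_one hh hM
    rcases trace_cases hn hMn hd with h3 | h3 | h3 | h3 | h3
    · exact absurd h3 h1
    · exact absurd h3 h2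
    · exact s.exists_descends_of_trace_eq_zero hh hM hd h3
    · exact s.exists_descends_of_trace_eq_one_or hh hM hd (.inl h3)
    · exact s.exists_descends_of_trace_eq_one_or hh hM hd (.inr h3)

end CaseTwo

/-! ### Reduction to a faithful action on exponents -/

section Diagonal

open Matrix

lemma exists_hermite_basis (L : AddSubgroup (Fin 2 → ℤ)) : ∃ P : Matrix (Fin 2) (Fin 2) ℤ,
    (∀ v, P *ᵥ v ∈ L) ∧ ∀ v ∈ L, ∃ w, P *ᵥ w = v := by
  obtain ⟨p, hp⟩ := Int.subgroup_cyclic (L.map (Pi.evalAddMonoidHom (fun _ : Fin 2 => ℤ) 0))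
  obtain ⟨q, hq⟩ := Int.subgroup_cyclic (L.comap (AddMonoidHom.single (fun _ : Fin 2 => ℤ) 1))
  simp only [AddSubgroup.ext_iff, AddSubgroup.mem_map, AddSubgroup.mem_closure_singleton,
    Pi.evalAddMonoidHom_apply, AddSubgroup.mem_comap, AddMonoidHom.single_apply] at hp hq
  obtain ⟨w, hw, hwp⟩ := (hp p).2 ⟨1, one_smul _ _⟩
  have hqL := (hq q).2 ⟨1, one_smul _ _⟩
  have hP : ∀ v, !![w 0, 0; w 1, q] *ᵥ v = v 0 • w + v 1 • Pi.single 1 q := by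
    intro v
    funext i
    fin_cases i <;> simp [mulVec, dotProduct, Fin.sum_univ_two, mul_comm]
  refine ⟨!![w 0, 0; w 1, q], fun v => ?_, fun v hv => ?_⟩
  · rw [hP]
    exact add_mem (zsmul_mem hw _) (zsmul_mem hqL _)
  · obtain ⟨a, ha⟩ := (hp (v 0)).1 ⟨v, hv, rfl⟩
    have h1 : v - a • w = Pi.single 1 (v 1 - a * w 1) := by
      funext i
      fin_cases i <;> simp [← ha, hwp]
    obtain ⟨b, hb⟩ := (hq (v 1 - a * w 1)).1 (by
      rw [← h1]
      exact sub_mem hv (zsmul_mem hw _))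
    refine ⟨![a, b], ?_⟩
    rw [hP]
    funext i
    have h2 := congrFun h1 i
    fin_cases i
    · simp at h2 ⊢
      linear_combination -h2
    · simp at hb ⊢
      linear_combination hb

variable {H : Subgroup (K ≃ₐ[k] K)} {x y : K} {σ : K ≃ₐ[k] K}

/-- The elements of `H` acting diagonally on monomials. -/
def diagonalSubgroup (H : Subgroup (K ≃ₐ[k] K)) (x y : K) : Subgroup (K ≃ₐ[k] K) where
  carrier := {h | h ∈ H ∧ Acts h x y 1}
  one_mem' := ⟨H.one_mem, Acts.one⟩
  mul_mem' h h' := ⟨H.mul_mem h.1 h'.1, by simpa using h.2.mul h'.2⟩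
  inv_mem' := by
    rintro h ⟨hh, h1⟩
    refine ⟨H.inv_mem hh, fun v => ?_⟩
    have h2 := ((h1 v).map h⁻¹).symm
    rw [one_mulVec] at h2 ⊢
    rwa [← AlgEquiv.mul_apply, inv_mul_cancel] at h2

/-- The exponents of the monomials fixed by the diagonal elements of `H`. -/
def fixedExponents (H : Subgroup (K ≃ₐ[k] K)) {x y : K} (hx : x ≠ 0) (hy : y ≠ 0) :
    AddSubgroup (Fin 2 → ℤ) where
  carrier := {v | ∀ h ∈ diagonalSubgroup H x y, h (mono x y v) = mono x y v}
  zero_mem' h _ := by simp [mono]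
  add_mem' {v w} hv hw h hh := by rw [mono_add hx hy, map_mul, hv h hh, hw h hh]
  neg_mem' {v} hv h hh := by
    rw [← neg_one_smul ℤ, mono_smul, map_zpow₀, hv h hh]

lemma nsmul_mem_fixedExponents [Finite H] (hx : x ≠ 0) (hy : y ≠ 0) (v : Fin 2 → ℤ) :
    Nat.card H • v ∈ fixedExponents H hx hy := by
  rintro h ⟨hh, h1⟩
  obtain ⟨c, hc, h2⟩ := h1 v
  rw [one_mulVec] at h2
  have h3 : ∀ n : ℕ, (h ^ n) (mono x y v) = algebraMap k K (c ^ n) * mono x y v := by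
    intro n
    induction n with
    | zero => simp
    | succ n ih =>
      rw [pow_succ', AlgEquiv.mul_apply, ih, map_mul, AlgEquiv.commutes, h2, pow_succ, map_mul,
        mul_assoc]
  have h4 : h ^ Nat.card H = 1 :=
    congrArg Subtype.val (pow_card_eq_one' (x := (⟨h, hh⟩ : H)))
  have h5 := h3 (Nat.card H)
  rw [h4, AlgEquiv.one_apply, eq_comm, mul_eq_right₀ (mono_ne_zero hx hy v)] at h5
  rw [← natCast_zsmul, mono_smul, map_zpow₀, h2, zpow_natCast, zpow_natCast, mul_pow, ← map_pow,
    h5, one_mul]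

lemma Acts.conj_mem_diagonalSubgroup {M : Matrix (Fin 2) (Fin 2) ℤ}
    (hi : AlgebraicIndependent k ![x, y]) (hacts : ∀ h ∈ H, ∃ M, Acts h x y M) (hσ : σ ∈ H)
    (hM : Acts σ x y M) {g : K ≃ₐ[k] K} (hg : g ∈ diagonalSubgroup H x y) :
    σ⁻¹ * g * σ ∈ diagonalSubgroup H x y := by
  refine ⟨H.mul_mem (H.mul_mem (H.inv_mem hσ) hg.1) hσ, ?_⟩
  obtain ⟨N, hN⟩ := hacts _ (H.inv_mem hσ)
  have h1 : N * M = 1 := by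
    have h2 := hN.mul hM
    rw [inv_mul_cancel] at h2
    exact h2.unique hi Acts.one
  have := (hN.mul hg.2).mul hM
  rwa [Matrix.mul_one, h1] at this

lemma Acts.mulVec_mem_fixedExponents {M : Matrix (Fin 2) (Fin 2) ℤ} (hx : x ≠ 0) (hy : y ≠ 0)
    (hi : AlgebraicIndependent k ![x, y]) (hacts : ∀ h ∈ H, ∃ M, Acts h x y M) (hσ : σ ∈ H)
    (hM : Acts σ x y M) {v : Fin 2 → ℤ} (hv : v ∈ fixedExponents H hx hy) :
    M *ᵥ v ∈ fixedExponents H hx hy := by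
  intro g hg
  have h1 := congrArg σ (hv _ (hM.conj_mem_diagonalSubgroup hi hacts hσ hg))
  rw [← AlgEquiv.mul_apply, mul_assoc, mul_inv_cancel_left, AlgEquiv.mul_apply] at h1
  obtain ⟨c, hc, h2⟩ := hM v
  rw [h2, map_mul, AlgEquiv.commutes] at h1
  exact mul_left_cancel₀ (by simpa) h1

/-- The character by which a group acting diagonally acts on a monomial. -/
def monoCharacter (H : Subgroup (K ≃ₐ[k] K)) {x y : K} (hx : x ≠ 0) (hy : y ≠ 0)
    (v : Fin 2 → ℤ) : diagonalSubgroup H x y →* K where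
  toFun g := (g : K ≃ₐ[k] K) (mono x y v) / mono x y v
  map_one' := div_self (mono_ne_zero hx hy v)
  map_mul' g h := by
    have h0 := mono_ne_zero hx hy v
    obtain ⟨c, hc, h1⟩ := h.2.2 v
    rw [one_mulVec] at h1
    rw [Subgroup.coe_mul, AlgEquiv.mul_apply, h1, map_mul, AlgEquiv.commutes]
    field_simp

/-- If `E` contains the fixed monomials, the field `k(x, y)` is spanned over `E` by
eigenvectors of the diagonal group. -/
lemma exists_eigen_decomposition {E : IntermediateField k K} (hx : x ≠ 0) (hy : y ≠ 0)
    (htop : k⟮x, y⟯ = ⊤) (hxa : IsAlgebraic E x) (hya : IsAlgebraic E y)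
    (hE : ∀ g ∈ diagonalSubgroup H x y, ∀ e ∈ E, g e = e)
    (hm : ∀ v ∈ fixedExponents H hx hy, mono x y v ∈ E) (f : K) :
    ∃ F : (diagonalSubgroup H x y →* K) →₀ K,
      (∀ χ (g : diagonalSubgroup H x y), (g : K ≃ₐ[k] K) (F χ) = χ g * F χ) ∧ F 1 ∈ E ∧
        (F.sum fun _ z => z) = f := by
  classical
  have hspan : f ∈ Submodule.span E (Set.range (mono x y)) := by
    have h1 : f ∈ (IntermediateField.adjoin E {x, y}).restrictScalars k := by
      have : k⟮x, y⟯ ≤ (IntermediateField.adjoin E {x, y}).restrictScalars k :=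
        adjoin_pair_le (IntermediateField.subset_adjoin E _ (.inl rfl))
          (IntermediateField.subset_adjoin E _ (.inr rfl))
      exact this (htop ▸ IntermediateField.mem_top)
    have h2 : f ∈ (IntermediateField.adjoin E {x, y}).toSubalgebra := h1
    rw [IntermediateField.adjoin_toSubalgebra_of_isAlgebraic (by
      rintro z (rfl | rfl) <;> assumption), ← Subalgebra.mem_toSubmodule,
      Algebra.adjoin_eq_span] at h2
    refine Submodule.span_mono ?_ h2
    intro z hz
    induction hz using Submonoid.closure_induction with
    | mem z hz =>
      rcases hz with rfl | rfl
      · exact ⟨_, mono_left _ _⟩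
      · exact ⟨_, mono_right _ _⟩
    | one => exact ⟨0, by simp [mono]⟩
    | mul z w _ _ h3 h4 =>
      obtain ⟨v, rfl⟩ := h3
      obtain ⟨w, rfl⟩ := h4
      exact ⟨v + w, mono_add hx hy v w⟩
  induction hspan using Submodule.span_induction with
  | mem f hf =>
    obtain ⟨v, rfl⟩ := hf
    refine ⟨Finsupp.single (monoCharacter H hx hy v) (mono x y v), fun χ g => ?_, ?_, by simp⟩
    · rw [Finsupp.single_apply]
      split_ifs with h
      · rw [← h]
        exact (div_mul_cancel₀ _ (mono_ne_zero hx hy v)).symm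
      · simp
    · rw [Finsupp.single_apply]
      split_ifs with h
      · refine hm v fun g hg => ?_
        exact (div_eq_one_iff_eq (mono_ne_zero hx hy v)).1 (DFunLike.congr_fun h ⟨g, hg⟩)
      · exact zero_mem E
  | zero => exact ⟨0, by simp, zero_mem E, by simp⟩
  | add f f' _ _ hf hf' =>
    obtain ⟨F, h1, h2, rfl⟩ := hf
    obtain ⟨F', h1', h2', rfl⟩ := hf'
    refine ⟨F + F', fun χ g => ?_, add_mem h2 h2', ?_⟩
    · rw [Finsupp.add_apply, map_add, h1, h1', mul_add]
    · exact Finsupp.sum_add_index' (fun _ => rfl) fun _ _ _ => rfl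
  | smul e f _ hf =>
    obtain ⟨F, h1, h2, rfl⟩ := hf
    refine ⟨F.mapRange (fun z => (e : K) * z) (mul_zero _), fun χ g => ?_, ?_, ?_⟩
    · rw [Finsupp.mapRange_apply, map_mul, hE g g.2 e e.2, h1]
      ring
    · rw [Finsupp.mapRange_apply]
      exact mul_mem e.2 h2
    · rw [Finsupp.sum_mapRange_index fun _ => rfl]
      exact (Finsupp.mul_sum _ _).symm

lemma mem_of_diagonal_fixed {E : IntermediateField k K} (hx : x ≠ 0) (hy : y ≠ 0)
    (htop : k⟮x, y⟯ = ⊤) (hxa : IsAlgebraic E x) (hya : IsAlgebraic E y)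
    (hE : ∀ g ∈ diagonalSubgroup H x y, ∀ e ∈ E, g e = e)
    (hm : ∀ v ∈ fixedExponents H hx hy, mono x y v ∈ E) {f : K}
    (hf : ∀ g ∈ diagonalSubgroup H x y, g f = f) : f ∈ E := by
  obtain ⟨F, h1, h2, h3⟩ := exists_eigen_decomposition hx hy htop hxa hya hE hm f
  have h4 := linearIndependent_iff.1 (linearIndependent_monoidHom (diagonalSubgroup H x y) K)
    (F - Finsupp.single 1 f) (by
      funext g
      have h5 : (F.sum fun χ z => z * χ g) = f := by
        have h6 := congrArg (g : K ≃ₐ[k] K) h3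
        rw [hf g g.2, map_finsuppSum] at h6
        rw [← h6]
        exact Finsupp.sum_congr fun χ _ => by rw [h1, mul_comm]
      rw [map_sub, Finsupp.linearCombination_single, Finsupp.linearCombination_apply,
        Pi.sub_apply, Finsupp.sum_apply']
      simpa [sub_eq_zero] using h5)
  rw [sub_eq_zero] at h4
  rw [h4, Finsupp.single_eq_same] at h2
  exact h2

/-- A monomial action on `k(x, y)` becomes faithful on exponents after passing to the fixed field
of the diagonal subgroup. -/
lemma exists_setup (hxy : IsTranscendenceBasis k ![x, y]) (htop : k⟮x, y⟯ = ⊤) [Finite H]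
    (hacts : ∀ h ∈ H, ∃ M, Acts h x y M) :
    ∃ x' y' : K, Setup H x' y' ∧ ∀ f : K, (∀ h ∈ H, h f = f) → f ∈ k⟮x', y'⟯ := by
  have hi := hxy.1
  have hx := left_ne_zero hi
  have hy := right_ne_zero hi
  have hcard : Nat.card H ≠ 0 := Nat.card_pos.ne'
  have hL := nsmul_mem_fixedExponents (H := H) hx hy
  obtain ⟨P, hP, hP'⟩ := exists_hermite_basis (fixedExponents H hx hy)
  set x' := mono x y (fun i => P i 0) with hx'
  set y' := mono x y (fun i => P i 1) with hy'
  have hPv : ∀ v, P *ᵥ v = v 0 • (fun i => P i 0) + v 1 • fun i => P i 1 := by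
    intro v
    funext i
    simp [mulVec, dotProduct, Fin.sum_univ_two, mul_comm]
  have hmono : ∀ v, mono x' y' v = mono x y (P *ᵥ v) := by
    intro v
    rw [hPv, mono_add hx hy, mono_smul, mono_smul]
    rfl
  have hm : ∀ v ∈ fixedExponents H hx hy, mono x y v ∈ k⟮x', y'⟯ := by
    intro v hv
    obtain ⟨w, rfl⟩ := hP' v hv
    rw [← hmono]
    exact mono_mem _ _ _
  have hL0 : (fun i => P i 0) ∈ fixedExponents H hx hy := by
    have := hP ![1, 0]
    rw [hPv] at this
    simpa using this
  have hL1 : (fun i => P i 1) ∈ fixedExponents H hx hy := by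
    have := hP ![0, 1]
    rw [hPv] at this
    simpa using this
  have halg : ∀ v, IsAlgebraic k⟮x', y'⟯ (mono x y v) := by
    intro v
    refine IsAlgebraic.of_pow (Nat.pos_of_ne_zero hcard) ?_
    have := hm _ (hL v)
    rw [← natCast_zsmul, mono_smul, zpow_natCast] at this
    exact isAlgebraic_algebraMap (⟨_, this⟩ : k⟮x', y'⟯)
  have hxa : IsAlgebraic k⟮x', y'⟯ x := by simpa using halg ![1, 0]
  have hya : IsAlgebraic k⟮x', y'⟯ y := by simpa using halg ![0, 1]
  have htb : IsTranscendenceBasis k ![x', y'] := isTranscendenceBasis_of_isAlgebraic hxy hxa hya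
  have hacts' : ∀ h ∈ H, ∀ M, Acts h x y M → ∃ N, Acts h x' y' N ∧ M * P = P * N := by
    intro h hh M hM
    obtain ⟨w₀, hw₀⟩ := hP' _ (hM.mulVec_mem_fixedExponents hx hy hi hacts hh hL0)
    obtain ⟨w₁, hw₁⟩ := hP' _ (hM.mulVec_mem_fixedExponents hx hy hi hacts hh hL1)
    refine ⟨of fun i j => ![w₀ i, w₁ i] j, .of_generators (mono_ne_zero hx hy _)
      (mono_ne_zero hx hy _) ?_ ?_, ?_⟩
    · rw [hmono]
      simpa [hw₀] using hM fun i => P i 0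
    · rw [hmono]
      simpa [hw₁] using hM fun i => P i 1
    · ext i j
      have h0 := congrFun hw₀ i
      have h1 := congrFun hw₁ i
      simp only [mulVec, dotProduct, Fin.sum_univ_two] at h0 h1
      fin_cases j
      · simpa [Matrix.mul_apply, Fin.sum_univ_two] using h0.symm
      · simpa [Matrix.mul_apply, Fin.sum_univ_two] using h1.symm
  refine ⟨x', y', ⟨htb, inferInstance, fun h hh => ?_, fun h hh h1 => ?_⟩, fun f hf => ?_⟩
  · obtain ⟨M, hM⟩ := hacts h hh
    obtain ⟨N, hN, -⟩ := hacts' h hh M hM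
    exact ⟨N, hN⟩
  · obtain ⟨M, hM⟩ := hacts h hh
    obtain ⟨N, hN, hMP⟩ := hacts' h hh M hM
    obtain rfl := hN.unique htb.1 h1
    rw [Matrix.mul_one] at hMP
    have h2 : M = 1 := by
      refine ext_of_mulVec_single fun i => ?_
      obtain ⟨w, hw⟩ := hP' _ (hL (Pi.single i 1))
      have h3 : M *ᵥ (Nat.card H • Pi.single i 1) = Nat.card H • Pi.single i 1 := by
        rw [← hw, mulVec_mulVec, hMP]
      rw [mulVec_smul] at h3
      rw [one_mulVec]
      exact smul_right_injective _ hcard h3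
    subst h2
    exact ⟨hL0 h ⟨hh, hM⟩, hL1 h ⟨hh, hM⟩⟩
  · exact mem_of_diagonal_fixed hx hy htop hxa hya
      (fun g hg e he => map_eq_self_of_mem_adjoin g (hL0 g hg) (hL1 g hg) he) hm
      fun g hg => hf g hg.1

end Diagonal

/-! ### The fixed field -/

/-- The fixed field of a finite group acting monomially on `k(x, y)` is purely transcendental. -/
theorem exists_fixedField_eq_adjoin {H : Subgroup (K ≃ₐ[k] K)} [Finite H] {x y : K}
    (hxy : IsTranscendenceBasis k ![x, y]) (htop : k⟮x, y⟯ = ⊤)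
    (hacts : ∀ h ∈ H, ∃ M, Acts h x y M) :
    ∃ u v : K, IntermediateField.fixedField H = k⟮u, v⟯ ∧ AlgebraicIndependent k ![u, v] := by
  obtain ⟨x', y', s, hfix⟩ := exists_setup hxy htop hacts
  obtain ⟨u, v, huv⟩ := s.exists_descends
  have hmem : ∀ f : K, (∀ h ∈ H, h f = f) → f ∈ k⟮u, v⟯ := fun f hf =>
    huv.mem_of_forall f (hfix f hf) hf
  have halg : ∀ z : K, IsAlgebraic k⟮u, v⟯ z := by
    have : Algebra.IsInvariant k⟮u, v⟯ K H :=
      ⟨fun b hb => ⟨⟨b, hmem b fun h hh => hb ⟨h, hh⟩⟩, rfl⟩⟩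
    have : SMulCommClass H k⟮u, v⟯ K := ⟨fun h e z => by
      have h1 : (h : K ≃ₐ[k] K) e = e := map_eq_self_of_mem_adjoin _ (huv.map_left _ h.2)
        (huv.map_right _ h.2) e.2
      change (h : K ≃ₐ[k] K) (e * z) = e * (h : K ≃ₐ[k] K) z
      rw [map_mul, h1]⟩
    have := Algebra.IsInvariant.isIntegral k⟮u, v⟯ K H
    exact fun z => (Algebra.IsIntegral.isIntegral z).isAlgebraic
  refine ⟨u, v, le_antisymm (fun f hf => hmem f fun h hh => hf ⟨h, hh⟩) ?_,
    (isTranscendenceBasis_of_isAlgebraic hxy (halg x) (halg y)).1⟩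
  exact adjoin_pair_le (fun h => huv.map_left _ h.2) fun h => huv.map_right _ h.2

lemma isRational_adjoin {u v : K} (h : AlgebraicIndependent k ![u, v]) :
    IsRational k k⟮u, v⟯ := by
  refine ⟨2, ⟨(IntermediateField.equivOfEq ?_).trans h.aevalEquivField.symm⟩⟩
  rw [Matrix.range_cons_cons_empty]

lemma isTranscendenceBasis_X (k : Type*) [Field k] : IsTranscendenceBasis k
    ![algebraMap (MvPolynomial (Fin 2) k) (FractionRing (MvPolynomial (Fin 2) k)) (X 0),
      algebraMap (MvPolynomial (Fin 2) k) (FractionRing (MvPolynomial (Fin 2) k)) (X 1)] := by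
  have : Algebra.IsAlgebraic (MvPolynomial (Fin 2) k) (FractionRing (MvPolynomial (Fin 2) k)) :=
    IsLocalization.isAlgebraic _ (nonZeroDivisors (MvPolynomial (Fin 2) k))
  have h := (IsTranscendenceBasis.mvPolynomial (Fin 2) k).algebraMap_comp
    (A := FractionRing (MvPolynomial (Fin 2) k))
  convert h using 1
  funext i
  fin_cases i <;> rfl

lemma adjoin_X_eq_top (k : Type*) [Field k] :
    k⟮algebraMap (MvPolynomial (Fin 2) k) (FractionRing (MvPolynomial (Fin 2) k)) (X 0),
      algebraMap (MvPolynomial (Fin 2) k) (FractionRing (MvPolynomial (Fin 2) k)) (X 1)⟯ = ⊤ := by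
  set E := k⟮algebraMap (MvPolynomial (Fin 2) k) (FractionRing (MvPolynomial (Fin 2) k)) (X 0),
      algebraMap (MvPolynomial (Fin 2) k) (FractionRing (MvPolynomial (Fin 2) k)) (X 1)⟯
  have hp : ∀ p : MvPolynomial (Fin 2) k, algebraMap _ (FractionRing (MvPolynomial (Fin 2) k)) p
      ∈ E := by
    intro p
    induction p using MvPolynomial.induction_on with
    | C a =>
      have : algebraMap (MvPolynomial (Fin 2) k) (FractionRing (MvPolynomial (Fin 2) k)) (C a) =
          algebraMap k _ a :=
        (IsScalarTower.algebraMap_apply k (MvPolynomial (Fin 2) k) _ a).symm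
      rw [this]
      exact E.algebraMap_mem a
    | add p q hp hq =>
      rw [map_add]
      exact add_mem hp hq
    | mul_X p i hp =>
      rw [map_mul]
      refine mul_mem hp ?_
      fin_cases i
      · exact mem_left _ _
      · exact mem_right _ _
  refine eq_top_iff.2 fun f _ => ?_
  obtain ⟨p, q, -, rfl⟩ := IsFractionRing.div_surjective (A := MvPolynomial (Fin 2) k) f
  exact div_mem (hp p) (hp q)

end MonomialAction

/-- **Hajja's theorem.** Let `k` be a field and `G` a finite group acting on the rational
function field `k(x₁,x₂)` by monomial `k`-automorphisms, i.e. via a homomorphism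
`ρ : G →* Aut_k(k(x₁,x₂))` such that every `ρ σ` sends each variable `x_j` to
`c_j(σ) · x₁^{a₁ⱼ} x₂^{a₂ⱼ}` with `c_j(σ) ∈ kˣ` and `[a_{ij}] ∈ GL₂(ℤ)`.
Then the fixed field `k(x₁,x₂)^G` is `k`-rational. -/
theorem monomial_action_dim_two_rational
    (k : Type*) [Field k] (G : Type*) [Group G] [Finite G]
    (ρ : G →* (FractionRing (MvPolynomial (Fin 2) k) ≃ₐ[k] FractionRing (MvPolynomial (Fin 2) k)))
    (hmono : ∀ σ : G, ∃ (c : Fin 2 → k) (A : Matrix (Fin 2) (Fin 2) ℤ),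
      (∀ j, c j ≠ 0) ∧ IsUnit A.det ∧
      ∀ j : Fin 2, ρ σ (algebraMap (MvPolynomial (Fin 2) k) _ (X j)) =
        algebraMap k _ (c j) *
          ∏ i : Fin 2, (algebraMap (MvPolynomial (Fin 2) k) _ (X i)) ^ (A i j)) :
    IsRational k (IntermediateField.fixedField ρ.range) := by
  have hX := MonomialAction.isTranscendenceBasis_X k
  have : Finite ρ.range := Finite.of_surjective ρ.rangeRestrict ρ.rangeRestrict_surjective
  obtain ⟨u, v, h, huv⟩ := MonomialAction.exists_fixedField_eq_adjoin (H := ρ.range) hX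
    (MonomialAction.adjoin_X_eq_top k) (by
      rintro _ ⟨σ, rfl⟩
      obtain ⟨c, A, hc, -, hA⟩ := hmono σ
      refine ⟨A, .of_generators (MonomialAction.left_ne_zero hX.1)
        (MonomialAction.right_ne_zero hX.1) ⟨c 0, hc 0, ?_⟩ ⟨c 1, hc 1, ?_⟩⟩
      · rw [hA, Fin.prod_univ_two]
        rfl
      · rw [hA, Fin.prod_univ_two]
        rfl)
  rw [h]
  exact MonomialAction.isRational_adjoin huv
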